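/- arXiv:1511.04298 — 3 statements merged into one kernel-verified Lean document; each statement's English description precedes it below -/
import Mathlib

section
/- For the reverse Kreweras model, the generating function Q(x,y;t) is algebraic: there exists a nonzero polynomial P ∈ ℚ[x,y,t,u] such that P(x, y, t, Q(x,y;t)) = 0 in the formal power series ring ℚ[[x,y,t]]. -/
/-- The set of quadrant walks of length `n` from `(0,0)` to `(i,j)` with steps in `S`. -/
def quadWalks (S : Set (ℤ × ℤ)) (i j n : ℕ) : Set (List (ℤ × ℤ)) :=
  {w | w.length = n ∧ (∀ s ∈ w, s ∈ S) ∧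
    (∀ k, 0 ≤ ((w.take k).map Prod.fst).sum ∧ 0 ≤ ((w.take k).map Prod.snd).sum) ∧
    (w.map Prod.fst).sum = i ∧ (w.map Prod.snd).sum = j}

/-- The number `q(i,j;n)` of quadrant walks of length `n` from `(0,0)` to `(i,j)`. -/
noncomputable def q (S : Set (ℤ × ℤ)) (i j n : ℕ) : ℕ := Nat.card (quadWalks S i j n)

/-- The generating function `Q(x,y;t) = Σ q(i,j;n) x^i y^j t^n`, as a formal power
series in the three variables `x = X 0`, `y = X 1`, `t = X 2`. -/
noncomputable def Q (S : Set (ℤ × ℤ)) : MvPowerSeries (Fin 3) ℚ :=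
  fun d => (q S (d 0) (d 1) (d 2) : ℚ)

/-- The reverse Kreweras step set. -/
def reverseKrewerasSteps : Set (ℤ × ℤ) := {(1, 0), (0, 1), (-1, -1)}

namespace RK
open MvPowerSeries

abbrev S3 := MvPowerSeries (Fin 3) ℚ

noncomputable def E (v : Fin 3 → S3) (h : ∀ i, constantCoeff (v i) = 0) : S3 →ₐ[ℚ] S3 :=
  substAlgHom (hasSubst_of_constantCoeff_zero h)

theorem E_X (v : Fin 3 → S3) (h) (i : Fin 3) : E v h (X i) = v i := by
  unfold E; exact substAlgHom_X _ i

theorem E_comp (v w u : Fin 3 → S3) (hv hw hu) (h : ∀ i, E v hv (w i) = u i) (f : S3) :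
    E v hv (E w hw f) = E u hu f := by
  unfold E at *
  rw [substAlgHom_comp_substAlgHom_apply, substAlgHom_apply, substAlgHom_apply]
  congr 1
  funext i
  rw [← h i, substAlgHom_apply]

theorem constantCoeff_E (v : Fin 3 → S3) (h) (f : S3) :
    constantCoeff (E v h f) = constantCoeff f := by
  have h1 : constantCoeff (E v h (f - C (constantCoeff f))) = 0 := by
    unfold E
    rw [substAlgHom_apply]
    exact constantCoeff_subst_eq_zero (hasSubst_of_constantCoeff_zero h) h (by simp)
  have h2 : E v h (C (constantCoeff f)) = C (constantCoeff f) := by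
    exact (E v h).commutes (constantCoeff f)
  rw [map_sub, map_sub, h2] at h1
  simpa [sub_eq_zero] using h1

/-- set variable `s` to zero -/
noncomputable def Z (s : Fin 3) : S3 →ₐ[ℚ] S3 :=
  E (fun i => if i = s then 0 else X i) (by intro i; split_ifs <;> simp)

theorem coeff_Z (s : Fin 3) (f : S3) (d : Fin 3 →₀ ℕ) :
    coeff d (Z s f) = if d s = 0 then coeff d f else 0 := by
  unfold Z E
  rw [substAlgHom_apply, coeff_subst (hasSubst_of_constantCoeff_zero (by
    intro i; split_ifs <;> simp))]
  have key : ∀ e : Fin 3 →₀ ℕ, (e.prod fun i k => (if i = s then (0 : S3) else X i) ^ k)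
      = if e s = 0 then monomial e 1 else 0 := by
    intro e
    split_ifs with he
    · rw [monomial_one_eq]
      apply Finsupp.prod_congr
      intro i hi
      have : i ≠ s := by
        rintro rfl
        simp [he] at hi
      simp [this]
    · apply Finset.prod_eq_zero (i := s)
      · simpa using he
      · simp [he]
  rw [finsum_eq_single _ d]
  · rw [key]
    split_ifs <;> simp
  · intro e he
    rw [key]
    split_ifs
    · rw [coeff_monomial, if_neg (Ne.symm he)]; simp
    · simp

noncomputable def sw : S3 →ₐ[ℚ] S3 :=
  E (fun i => X (Equiv.swap 0 1 i)) (by intro i; simp)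

theorem coeff_sw (f : S3) (d : Fin 3 →₀ ℕ) :
    coeff d (sw f) = coeff (d.equivMapDomain (Equiv.swap 0 1)) f := by
  unfold sw E
  rw [substAlgHom_apply, coeff_subst (hasSubst_of_constantCoeff_zero (by
    intro i; simp))]
  have key : ∀ e : Fin 3 →₀ ℕ, (e.prod fun i k => (X (Equiv.swap 0 1 i) : S3) ^ k)
      = monomial (e.equivMapDomain (Equiv.swap 0 1)) 1 := by
    intro e
    rw [monomial_one_eq]
    rw [Finsupp.prod_fintype _ _ (by simp), Finsupp.prod_fintype _ _ (by simp)]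
    simp [Fin.prod_univ_three, Finsupp.equivMapDomain_apply]
    have h2 : Equiv.swap (0 : Fin 3) 1 2 = 2 := by decide
    rw [h2]; ring
  have inv : ∀ e : Fin 3 →₀ ℕ, (e.equivMapDomain (Equiv.swap 0 1)).equivMapDomain
      (Equiv.swap 0 1) = e := by
    intro e; ext i; simp [Finsupp.equivMapDomain_apply]
  rw [finsum_eq_single _ (d.equivMapDomain (Equiv.swap 0 1))]
  · rw [key, inv]; simp
  · intro e he
    rw [key, coeff_monomial, if_neg]
    · simp
    · rintro rfl; exact he (inv e).symm

theorem X_dvd_of_Z (s : Fin 3) (f : S3) (h : Z s f = 0) : X s ∣ f := by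
  rw [X_dvd_iff]
  intro m hm
  have := coeff_Z s f m
  rw [h, if_pos hm] at this
  simpa using this.symm

theorem eq_zero_of_pow_dvd (s : Fin 3) (f : S3) (h : ∀ k, X s ^ k ∣ f) : f = 0 := by
  ext d
  have := X_pow_dvd_iff.1 (h (d s + 1)) d (by omega)
  simpa using this

end RK
namespace RK
open MvPowerSeries

theorem exists_n : ∃ n : S3, n = 1 + 4 * X 2 ^ 3 * n ^ 3 := by
  let P : PowerSeries ℚ := PowerSeries.X * (1 - PowerSeries.X) ^ 2
  have hP : P.constantCoeff = 0 := by simp [P]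
  have hP1 : PowerSeries.coeff 1 P = 1 := by
    have : P = PowerSeries.X * (1 - PowerSeries.X) ^ 2 := rfl
    rw [this, show (1 : ℕ) = 0 + 1 from rfl, PowerSeries.coeff_succ_X_mul]
    simp
  have : Invertible (PowerSeries.coeff 1 P) := by rw [hP1]; exact invertibleOne
  have h := PowerSeries.subst_substInv_right P hP
  set z := PowerSeries.substInv P with hz
  have hzs : PowerSeries.HasSubst z := PowerSeries.HasSubst.substInv P
  have h1 : z * (1 - z) ^ 2 = PowerSeries.X := by
    have := h
    rw [← PowerSeries.coe_substAlgHom hzs] at this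
    simp only [P, map_mul, map_pow, map_sub, map_one, PowerSeries.substAlgHom_X] at this
    exact this
  have hc : (4 * X 2 ^ 3 : S3).constantCoeff = 0 := by simp
  have hs : PowerSeries.HasSubst (4 * X 2 ^ 3 : S3) := PowerSeries.HasSubst.of_constantCoeff_zero hc
  set w : S3 := PowerSeries.substAlgHom (R := ℚ) hs z with hw
  have h2 : w * (1 - w) ^ 2 = 4 * X 2 ^ 3 := by
    have := congrArg (PowerSeries.substAlgHom (R := ℚ) hs) h1
    simpa only [map_mul, map_pow, map_sub, map_one, PowerSeries.substAlgHom_X] using this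
  have h3 : constantCoeff w = 0 := by
    rw [hw, PowerSeries.coe_substAlgHom hs]
    exact PowerSeries.constantCoeff_subst_eq_zero hc z (by rw [hz]; exact PowerSeries.constantCoeff_substInv P)
  have h4 : (1 - w) * (1 - w)⁻¹ = 1 := MvPowerSeries.mul_inv_cancel _ (by simp [h3])
  refine ⟨(1 - w)⁻¹, ?_⟩
  rw [← h2]
  generalize (1 - w)⁻¹ = m at *
  have e : (1 - w) ^ 2 * m ^ 2 = 1 := by rw [← mul_pow, h4, one_pow]
  linear_combination (-w * m) * e + h4

theorem exists_sqrt (f : S3) (hf : constantCoeff f = 1) :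
    ∃ s : S3, s ^ 2 = f ∧ constantCoeff s = 1 := by
  have hc : (f - 1).constantCoeff = 0 := by simp [hf]
  have hs : PowerSeries.HasSubst (f - 1) := PowerSeries.HasSubst.of_constantCoeff_zero hc
  let b : PowerSeries ℚ := PowerSeries.binomialSeries ℚ (1/2 : ℚ)
  have hb : b ^ 2 = 1 + PowerSeries.X := by
    have h1 := PowerSeries.binomialSeries_add (A := ℚ) (1/2 : ℚ) (1/2)
    have h2 := PowerSeries.binomialSeries_nat (R := ℚ) (A := ℚ) 1
    rw [pow_two, ← h1]
    norm_num at h2 ⊢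
    exact h2
  have hb1 : (b - 1).constantCoeff = 0 := by
    simp [b]
  refine ⟨PowerSeries.substAlgHom (R := ℚ) hs b, ?_, ?_⟩
  · rw [← map_pow, hb, map_add, map_one, PowerSeries.substAlgHom_X]; ring
  · have := PowerSeries.constantCoeff_subst_eq_zero hc (b - 1) hb1
    rw [← PowerSeries.coe_substAlgHom hs, map_sub, map_one, map_sub] at this
    simpa [sub_eq_zero] using this

theorem sq_eq_one (f : S3) (h : f ^ 2 = 1) (hf : constantCoeff f = 1) : f = 1 := by
  have : (f - 1) * (f + 1) = 0 := by linear_combination h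
  rcases mul_eq_zero.1 this with h | h
  · linear_combination h
  · have := congrArg constantCoeff h
    norm_num [hf] at this

/-- walks with integer endpoint -/
def qw (i j : ℤ) (n : ℕ) : Set (List (ℤ × ℤ)) :=
  {w | w.length = n ∧ (∀ s ∈ w, s ∈ reverseKrewerasSteps) ∧
    (∀ k, 0 ≤ ((w.take k).map Prod.fst).sum ∧ 0 ≤ ((w.take k).map Prod.snd).sum) ∧
    (w.map Prod.fst).sum = i ∧ (w.map Prod.snd).sum = j}

theorem qw_neg (i j : ℤ) (n : ℕ) (h : i < 0 ∨ j < 0) : qw i j n = ∅ := by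
  ext w
  simp only [qw, Set.mem_ofPred_eq, Set.mem_empty_iff_false, iff_false]
  rintro ⟨h1, h2, h3, h4, h5⟩
  have := h3 n
  rw [← h1, List.take_length, h4, h5] at this
  omega

theorem qw_zero (i j : ℤ) : qw i j 0 = if i = 0 ∧ j = 0 then {[]} else ∅ := by
  ext w
  simp only [qw, Set.mem_ofPred_eq, List.length_eq_zero_iff]
  constructor
  · rintro ⟨rfl, -, -, h4, h5⟩
    simp at h4 h5
    simp [← h4, ← h5]
  · split_ifs with h
    · rintro rfl
      simp [h.1, h.2]
    · simp

theorem mem_qw_append (i j : ℤ) (n : ℕ) (w : List (ℤ × ℤ)) (s : ℤ × ℤ) (hi : 0 ≤ i) (hj : 0 ≤ j) :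
    w ++ [s] ∈ qw i j (n + 1) ↔ s ∈ reverseKrewerasSteps ∧ w ∈ qw (i - s.1) (j - s.2) n := by
  simp only [qw, Set.mem_ofPred_eq, List.length_append, List.length_singleton, add_left_inj,
    List.mem_append, List.mem_singleton, List.map_append, List.sum_append, List.map_cons,
    List.map_nil, List.sum_cons, List.sum_nil, add_zero]
  constructor
  · rintro ⟨h1, h2, h3, h4, h5⟩
    refine ⟨h2 s (Or.inr rfl), h1, fun r hr => h2 r (Or.inl hr), fun k => ?_, by omega, by omega⟩
    have := h3 (min k n)
    rw [List.take_append_of_le_length (by omega)] at this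
    have e : w.take (min k n) = w.take k := by
      rw [← h1, List.take_eq_take_iff]; omega
    rwa [e] at this
  · rintro ⟨h0, h1, h2, h3, h4, h5⟩
    refine ⟨h1, ?_, fun k => ?_, by omega, by omega⟩
    · rintro r (hr | rfl)
      · exact h2 r hr
      · exact h0
    · by_cases hk : k ≤ n
      · rw [List.take_append_of_le_length (by omega)]
        exact h3 k
      · rw [List.take_of_length_le (by simp; omega)]
        simp
        omega

theorem qw_succ (i j : ℤ) (n : ℕ) (hi : 0 ≤ i) (hj : 0 ≤ j) :
    qw i j (n + 1) = (fun w => w ++ [((1 : ℤ), (0 : ℤ))]) '' qw (i - 1) j n ∪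
      ((fun w => w ++ [((0 : ℤ), (1 : ℤ))]) '' qw i (j - 1) n ∪
       (fun w => w ++ [((-1 : ℤ), (-1 : ℤ))]) '' qw (i + 1) (j + 1) n) := by
  ext w
  constructor
  · intro hw
    have hl : w.length = n + 1 := hw.1
    rcases List.eq_nil_or_concat w with rfl | ⟨v, s, rfl⟩
    · simp at hl
    · rw [List.concat_eq_append] at hw ⊢
      rw [mem_qw_append _ _ _ _ _ hi hj] at hw
      obtain ⟨hs, hv⟩ := hw
      simp only [reverseKrewerasSteps, Set.mem_insert_iff, Set.mem_singleton_iff] at hs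
      rcases hs with rfl | rfl | rfl
      · left; exact ⟨v, by simpa using hv, rfl⟩
      · right; left; exact ⟨v, by simpa using hv, rfl⟩
      · right; right; exact ⟨v, by simpa using hv, rfl⟩
  · rintro (⟨v, hv, rfl⟩ | ⟨v, hv, rfl⟩ | ⟨v, hv, rfl⟩)
    all_goals
      simp only
      rw [mem_qw_append _ _ _ _ _ hi hj]
      refine ⟨by simp [reverseKrewerasSteps], by simpa using hv⟩

theorem qw_finite (n : ℕ) : ∀ i j : ℤ, (qw i j n).Finite := by
  induction n with
  | zero => intro i j; rw [qw_zero]; split_ifs <;> simp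
  | succ n ih =>
    intro i j
    by_cases h : i < 0 ∨ j < 0
    · rw [qw_neg _ _ _ h]; simp
    · rw [qw_succ _ _ _ (by omega) (by omega)]
      exact ((ih _ _).image _).union (((ih _ _).image _).union ((ih _ _).image _))

noncomputable def qz (i j : ℤ) (n : ℕ) : ℕ := (qw i j n).ncard

theorem qz_neg (i j : ℤ) (n : ℕ) (h : i < 0 ∨ j < 0) : qz i j n = 0 := by
  rw [qz, qw_neg _ _ _ h]; simp

theorem qz_zero (i j : ℤ) : qz i j 0 = if i = 0 ∧ j = 0 then 1 else 0 := by
  rw [qz, qw_zero]; split_ifs <;> simp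

theorem append_disj (a b : ℤ × ℤ) (h : a ≠ b) (A B : Set (List (ℤ × ℤ))) :
    Disjoint ((fun w => w ++ [a]) '' A) ((fun w => w ++ [b]) '' B) := by
  rw [Set.disjoint_left]
  rintro _ ⟨v, hv, rfl⟩ ⟨u, hu, he⟩
  have := List.append_inj' he rfl
  simp at this
  exact h this.2.symm

theorem ncard_append (a : ℤ × ℤ) (A : Set (List (ℤ × ℤ))) :
    ((fun w => w ++ [a]) '' A).ncard = A.ncard :=
  Set.ncard_image_of_injective _ (List.append_left_injective [a])

theorem qz_succ (i j : ℤ) (n : ℕ) (hi : 0 ≤ i) (hj : 0 ≤ j) :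
    qz i j (n + 1) = qz (i - 1) j n + qz i (j - 1) n + qz (i + 1) (j + 1) n := by
  have f := qw_finite n
  unfold qz
  rw [qw_succ _ _ _ hi hj, Set.ncard_union_eq _ ((f _ _).image _)
    (((f _ _).image _).union ((f _ _).image _)), Set.ncard_union_eq _ ((f _ _).image _)
    ((f _ _).image _), ncard_append, ncard_append, ncard_append, add_assoc]
  · exact append_disj _ _ (by decide) _ _
  · rw [Set.disjoint_union_right]
    exact ⟨append_disj _ _ (by decide) _ _, append_disj _ _ (by decide) _ _⟩

theorem qz_symm (n : ℕ) : ∀ i j : ℤ, qz i j n = qz j i n := by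
  induction n with
  | zero => intro i j; rw [qz_zero, qz_zero]; simp only [and_comm]
  | succ n ih =>
    intro i j
    by_cases h : i < 0 ∨ j < 0
    · rw [qz_neg _ _ _ h, qz_neg _ _ _ h.symm]
    · rw [qz_succ _ _ _ (by omega) (by omega), qz_succ _ _ _ (by omega) (by omega),
        ih (i - 1) j, ih i (j - 1), ih (i + 1) (j + 1)]
      ring

/-- the generating function -/
noncomputable abbrev QQ : S3 := Q reverseKrewerasSteps

theorem coeff_QQ (d : Fin 3 →₀ ℕ) : coeff d QQ = (qz (d 0) (d 1) (d 2) : ℚ) := rfl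

noncomputable def UU : S3 := fun d => (qz (d 0 + 1) (d 1 + 1) (d 2) : ℚ)

theorem coeff_UU (d : Fin 3 →₀ ℕ) : coeff d UU = (qz (d 0 + 1) (d 1 + 1) (d 2) : ℚ) := rfl

theorem coeff_X_mul' (s : Fin 3) (f : S3) (d : Fin 3 →₀ ℕ) :
    coeff d (X s * f) = if d s = 0 then 0 else coeff (d - Finsupp.single s 1) f := by
  split_ifs with h
  · exact X_dvd_iff.1 (Dvd.intro f rfl) d h
  · have : d = Finsupp.single s 1 + (d - Finsupp.single s 1) := by
      ext i
      by_cases hi : s = i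
      · subst hi; simp; omega
      · simp [hi]
    conv_lhs => rw [this]
    rw [X, coeff_add_monomial_mul, one_mul]

theorem QQ_rec : QQ = 1 + X 2 * (X 0 * QQ + X 1 * QQ + UU) := by
  ext d
  rw [map_add, coeff_X_mul', coeff_one]
  have hd : d = 0 ↔ d 0 = 0 ∧ d 1 = 0 ∧ d 2 = 0 := by
    rw [Finsupp.ext_iff]; simp [Fin.forall_fin_succ]
  rw [coeff_QQ]
  rcases h : d 2 with _ | n
  · rw [qz_zero]
    simp only [hd, h]
    simp
  · have : d ≠ 0 := by rw [Ne, hd]; omega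
    rw [if_neg this, if_neg (by omega), map_add, map_add, coeff_X_mul', coeff_X_mul', coeff_QQ,
      coeff_QQ, coeff_UU, qz_succ _ _ _ (by omega) (by omega)]
    simp [h]
    congr 1
    · split_ifs with h0
      · rw [h0, qz_neg] <;> simp
      · congr 2; omega
    · split_ifs with h0
      · rw [h0, qz_neg] <;> simp
      · congr 2; omega

theorem QQ_bdry : X 0 * (X 1 * UU) = QQ - Z 0 QQ - Z 1 QQ + Z 0 (Z 1 QQ) := by
  ext d
  simp only [map_add, map_sub, coeff_Z, coeff_X_mul', coeff_UU, coeff_QQ]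
  by_cases h0 : d 0 = 0 <;> by_cases h1 : d 1 = 0 <;> simp [h0, h1]
  congr 1 <;> omega

theorem sw_QQ : sw QQ = QQ := by
  ext d
  rw [coeff_sw, coeff_QQ, coeff_QQ, qz_symm]
  have h2 : Equiv.swap (0 : Fin 3) 1 2 = 2 := by decide
  simp [Finsupp.equivMapDomain_apply, h2]

end RK
namespace RK
open MvPowerSeries

theorem X_ne (s : Fin 3) : (X s : S3) ≠ 0 := by
  intro h
  have := congrArg (coeff (Finsupp.single s 1)) h
  rw [X, coeff_monomial_same] at this
  simp at this

theorem two_ne : (2 : S3) ≠ 0 := by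
  intro h
  have := congrArg constantCoeff h
  rw [map_ofNat] at this
  norm_num at this

noncomputable def kap : S3 := 1 + X 0 ^ 2 * X 1 + X 0 * X 1 ^ 2
noncomputable def ik : S3 := kap⁻¹
noncomputable def tau : S3 := X 0 * X 1 * ik

theorem kap_mul : kap * ik = 1 := MvPowerSeries.mul_inv_cancel _ (by simp [kap])
theorem constantCoeff_ik : constantCoeff ik = 1 := by
  have := congrArg constantCoeff kap_mul
  simpa [kap] using this
theorem tau_kap : tau * kap = X 0 * X 1 := by
  unfold tau; linear_combination X 0 * X 1 * kap_mul
theorem tau_ne : tau ≠ 0 := by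
  intro h
  have := tau_kap
  rw [h, zero_mul] at this
  exact mul_ne_zero (X_ne 0) (X_ne 1) this.symm

noncomputable def ph : S3 →ₐ[ℚ] S3 :=
  E ![X 0, X 1, tau] (by intro i; fin_cases i <;> simp [tau])

@[simp] theorem ph0 : ph (X 0) = X 0 := by unfold ph; rw [E_X]; rfl
@[simp] theorem ph1 : ph (X 1) = X 1 := by unfold ph; rw [E_X]; rfl
@[simp] theorem ph2 : ph (X 2) = tau := by unfold ph; rw [E_X]; rfl
@[simp] theorem sw0 : sw (X 0) = X 1 := by unfold sw; rw [E_X]; simp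
@[simp] theorem sw1 : sw (X 1) = X 0 := by unfold sw; rw [E_X]; simp
@[simp] theorem sw2 : sw (X 2) = X 2 := by
  unfold sw; rw [E_X]; exact congrArg X (by decide)
@[simp] theorem ZX (s i : Fin 3) : Z s (X i) = if i = s then 0 else X i := by unfold Z; rw [E_X]
@[simp] theorem Z1tau : Z 1 tau = 0 := by simp [tau]
@[simp] theorem Z0tau : Z 0 tau = 0 := by simp [tau]

theorem cc_Z (s f) : constantCoeff (Z s f) = constantCoeff f := constantCoeff_E _ _ _
theorem cc_sw (f) : constantCoeff (sw f) = constantCoeff f := constantCoeff_E _ _ _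
theorem cc_ph (f) : constantCoeff (ph f) = constantCoeff f := constantCoeff_E _ _ _

/-- two composites of substitutions agreeing on variables agree -/
def Sub (F : S3 →ₐ[ℚ] S3) : Prop := ∃ v h, F = E v h

theorem Sub.comp {F G : S3 →ₐ[ℚ] S3} (hF : Sub F) (hG : Sub G) : Sub (F.comp G) := by
  obtain ⟨v, hv, rfl⟩ := hF
  obtain ⟨w, hw, rfl⟩ := hG
  refine ⟨fun i => E v hv (w i), fun i => by rw [constantCoeff_E, hw], ?_⟩
  apply AlgHom.ext
  intro f
  exact E_comp v w _ hv hw _ (fun i => rfl) f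

theorem Sub.ext {F G : S3 →ₐ[ℚ] S3} (hF : Sub F) (hG : Sub G) (h0 : F (X 0) = G (X 0))
    (h1 : F (X 1) = G (X 1)) (h2 : F (X 2) = G (X 2)) : F = G := by
  obtain ⟨v, hv, rfl⟩ := hF
  obtain ⟨w, hw, rfl⟩ := hG
  have : v = w := by
    funext i
    rw [E_X, E_X] at h0 h1 h2
    fin_cases i
    · exact h0
    · exact h1
    · exact h2
  subst this
  rfl

theorem sub_Z (s) : Sub (Z s) := ⟨_, _, rfl⟩
theorem sub_sw : Sub sw := ⟨_, _, rfl⟩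
theorem sub_ph : Sub ph := ⟨_, _, rfl⟩

theorem Z_idem (s f) : Z s (Z s f) = Z s f := by
  have : (Z s).comp (Z s) = Z s := Sub.ext ((sub_Z s).comp (sub_Z s)) (sub_Z s)
    (by simp; split_ifs <;> simp_all) (by simp; split_ifs <;> simp_all)
    (by simp; split_ifs <;> simp_all)
  exact DFunLike.congr_fun this f

theorem Z_comm01 (f) : Z 0 (Z 1 f) = Z 1 (Z 0 f) := by
  have : (Z 0).comp (Z 1) = (Z 1).comp (Z 0) :=
    Sub.ext ((sub_Z _).comp (sub_Z _)) ((sub_Z _).comp (sub_Z _)) (by simp) (by simp) (by simp)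
  exact DFunLike.congr_fun this f

theorem sw_Z01 (f) : sw (Z 0 (Z 1 f)) = Z 0 (Z 1 f) := by
  have : sw.comp ((Z 0).comp (Z 1)) = (Z 0).comp (Z 1) :=
    Sub.ext (sub_sw.comp ((sub_Z _).comp (sub_Z _))) ((sub_Z _).comp (sub_Z _))
      (by simp) (by simp) (by simp)
  exact DFunLike.congr_fun this f

theorem sw_Z1 (f) : sw (Z 1 f) = Z 0 (sw f) := by
  have : sw.comp (Z 1) = (Z 0).comp sw :=
    Sub.ext (sub_sw.comp (sub_Z _)) ((sub_Z _).comp sub_sw) (by simp) (by simp) (by simp)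
  exact DFunLike.congr_fun this f

theorem Z1_ph_Z1 (f) : Z 1 (ph (Z 1 f)) = Z 2 (Z 1 f) := by
  have : (Z 1).comp (ph.comp (Z 1)) = (Z 2).comp (Z 1) :=
    Sub.ext ((sub_Z _).comp (sub_ph.comp (sub_Z _))) ((sub_Z _).comp (sub_Z _))
      (by simp) (by simp) (by simp)
  exact DFunLike.congr_fun this f

theorem Z1_ph_sw_Z1 (f) : Z 1 (ph (sw (Z 1 f))) = Z 0 (Z 2 (Z 1 f)) := by
  have : (Z 1).comp (ph.comp (sw.comp (Z 1))) = (Z 0).comp ((Z 2).comp (Z 1)) :=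
    Sub.ext ((sub_Z _).comp (sub_ph.comp (sub_sw.comp (sub_Z _))))
      ((sub_Z _).comp ((sub_Z _).comp (sub_Z _)))
      (by simp) (by simp) (by simp)
  exact DFunLike.congr_fun this f

theorem descent_step (D : S3) (h1 : Z 1 D = D) (h2 : ph D + ph (sw D) = 0) :
    ∃ D', D = X 2 * D' ∧ Z 1 D' = D' ∧ ph D' + ph (sw D') = 0 := by
  have e : Z 2 D + Z 0 (Z 2 D) = 0 := by
    have := congrArg (Z 1) h2
    rw [← h1, map_add, Z1_ph_Z1, Z1_ph_sw_Z1, h1, map_zero] at this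
    exact this
  have e0 : Z 0 (Z 2 D) = 0 := by
    have := congrArg (Z 0) e
    rw [map_add, Z_idem, map_zero, ← two_mul] at this
    exact (mul_eq_zero.1 this).resolve_left two_ne
  rw [e0, add_zero] at e
  obtain ⟨D', rfl⟩ := X_dvd_of_Z 2 D e
  refine ⟨D', rfl, ?_, ?_⟩
  · rw [map_mul] at h1
    simp at h1
    exact h1.resolve_right (X_ne 2)
  · simp only [map_mul, ph2, sw2, ← mul_add] at h2
    exact (mul_eq_zero.1 h2).resolve_left tau_ne

theorem descent (D : S3) (h1 : Z 1 D = D) (h2 : ph D + ph (sw D) = 0) : D = 0 := by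
  apply eq_zero_of_pow_dvd 2
  intro k
  induction k generalizing D with
  | zero => simp
  | succ k ih =>
    obtain ⟨D', rfl, h3, h4⟩ := descent_step D h1 h2
    rw [pow_succ']
    exact mul_dvd_mul_left _ (ih D' h3 h4)

noncomputable def RR : S3 := Z 1 QQ
noncomputable def R0 : S3 := Z 0 (Z 1 QQ)
noncomputable def TT : S3 := X 0 * X 2 ^ 2 * (2 * RR - R0) + X 2 - X 0 ^ 2 + X 2 * X 0 ^ 3

theorem Z0_QQ : Z 0 QQ = sw RR := by rw [RR, sw_Z1, sw_QQ]
theorem sw_R0 : sw R0 = R0 := sw_Z01 _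

theorem func_eq : (X 0 * X 1 - X 2 * kap) * QQ = X 0 * X 1 - X 2 * (RR + sw RR - R0) := by
  have h1 := QQ_rec
  have h2 := QQ_bdry
  rw [Z0_QQ] at h2
  change _ = QQ - _ - RR + R0 at h2
  unfold kap
  linear_combination X 0 * X 1 * h1 + X 2 * h2

theorem ph_eq : X 0 * X 1 = tau * (ph RR + ph (sw RR) - ph R0) := by
  have := congrArg ph func_eq
  have hk : ph kap = kap := by simp [kap]
  simp only [map_mul, map_sub, map_add, ph0, ph1, ph2, hk] at this
  linear_combination -this - ph QQ * tau_kap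

theorem TT_eq : X 1 * ph TT + X 0 * ph (sw TT) = 0 := by
  simp only [TT, map_mul, map_sub, map_add, map_pow, ph0, ph1, ph2, sw0, sw2, sw_R0,
    map_ofNat]
  have h1 := ph_eq
  have h2 := tau_kap
  unfold kap at h2
  linear_combination (-2 * X 0 * X 1 * tau) * h1 + (X 0 + X 1) * h2

end RK
namespace RK
open MvPowerSeries

theorem inv_id (x t n : S3) (h : n = 1 + 4 * t ^ 3 * n ^ 3) :
    n ^ 2 * ((t + 2 * x * t ^ 2 * n - x ^ 2 * (1 - 4 * t ^ 3 * n ^ 2)) ^ 2 *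
      (1 - x * t * n * (n + 1) + x ^ 2 * t ^ 2 * n ^ 2)) =
    n ^ 2 * (t + x ^ 2 - t * x ^ 3) ^ 2 + t ^ 2 * n ^ 3 * (3 - n) * x * (t + x ^ 2 - t * x ^ 3)
      + (t ^ 4 * n ^ 4 - 4 * t ^ 4 * n ^ 5 - 2 * t * n - 2 * n ^ 2 * t) * x ^ 2 := by
  have e : n * (t + 2 * x * t ^ 2 * n - x ^ 2 * (1 - 4 * t ^ 3 * n ^ 2)) =
      t * n + 2 * x * t ^ 2 * n ^ 2 - x ^ 2 := by linear_combination - x ^ 2 * h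
  rw [← mul_assoc, ← mul_pow, e]
  linear_combination (x ^ 3 * t ^ 2 * n ^ 3 - x ^ 4 * (n + 1 + t ^ 3 * n ^ 3) + x ^ 5 * t * n) * h

theorem sq_id (x y t n : S3) (hn : n ≠ 0) (h : n = 1 + 4 * t ^ 3 * n ^ 3)
    (ht : t * (1 + x ^ 2 * y + x * y ^ 2) = x * y) :
    y ^ 2 * ((t + 2 * x * t ^ 2 * n - x ^ 2 * (1 - 4 * t ^ 3 * n ^ 2)) ^ 2 *
      (1 - x * t * n * (n + 1) + x ^ 2 * t ^ 2 * n ^ 2)) =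
    x ^ 2 * ((t + 2 * y * t ^ 2 * n - y ^ 2 * (1 - 4 * t ^ 3 * n ^ 2)) ^ 2 *
      (1 - y * t * n * (n + 1) + y ^ 2 * t ^ 2 * n ^ 2)) := by
  have hx := inv_id x t n h
  have hy := inv_id y t n h
  have hj : y * (t + x ^ 2 - t * x ^ 3) = x * (t + y ^ 2 - t * y ^ 3) := by
    linear_combination (y - x) * ht
  apply mul_left_cancel₀ (pow_ne_zero 2 hn)
  linear_combination y ^ 2 * hx - x ^ 2 * hy + (n ^ 2 * (y * (t + x ^ 2 - t * x ^ 3) +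
    x * (t + y ^ 2 - t * y ^ 3)) + t ^ 2 * n ^ 3 * (3 - n) * x * y) * hj

theorem n_data : ∃ n : S3, n = 1 + 4 * X 2 ^ 3 * n ^ 3 ∧ Z 0 n = n ∧ Z 1 n = n ∧ sw n = n := by
  obtain ⟨n, hn⟩ := exists_n
  refine ⟨Z 0 (Z 1 n), ?_, ?_, ?_, ?_⟩
  · have := congrArg (fun f => Z 0 (Z 1 f)) hn
    simpa [map_ofNat] using this
  · rw [Z_idem]
  · rw [Z_comm01, Z_idem]
  · rw [sw_Z01]

theorem s_data (n : S3) (h : Z 1 n = n) : ∃ s : S3,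
    s ^ 2 = 1 - X 0 * X 2 * n * (n + 1) + X 0 ^ 2 * X 2 ^ 2 * n ^ 2 ∧ constantCoeff s = 1 ∧
    Z 1 s = s := by
  obtain ⟨s, hs, h1⟩ := exists_sqrt
    (1 - X 0 * X 2 * n * (n + 1) + X 0 ^ 2 * X 2 ^ 2 * n ^ 2) (by simp)
  refine ⟨Z 1 s, ?_, ?_, Z_idem _ _⟩
  · have := congrArg (Z 1) hs
    simpa [h] using this
  · rw [cc_Z, h1]

section
variable (n s : S3) (hn : n = 1 + 4 * X 2 ^ 3 * n ^ 3) (n0 : Z 0 n = n) (n1 : Z 1 n = n)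
  (nsw : sw n = n) (hs : s ^ 2 = 1 - X 0 * X 2 * n * (n + 1) + X 0 ^ 2 * X 2 ^ 2 * n ^ 2)
  (s1 : constantCoeff s = 1) (sZ : Z 1 s = s)

/-- the explicit candidate for `TT` -/
noncomputable def CC (n s : S3) : S3 :=
  (X 2 + 2 * X 0 * X 2 ^ 2 * n - X 0 ^ 2 * (1 - 4 * X 2 ^ 3 * n ^ 2)) * s

include hn nsw hs s1 in
theorem CC_eq : X 1 * ph (CC n s) + X 0 * ph (sw (CC n s)) = 0 := by
  have N := congrArg ph hn
  have A := congrArg ph hs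
  have B := congrArg (fun f => ph (sw f)) hs
  have a1 : constantCoeff (ph s) = 1 := by rw [cc_ph, s1]
  have b1 : constantCoeff (ph (sw s)) = 1 := by rw [cc_ph, cc_sw, s1]
  simp only [CC, map_mul, map_sub, map_add, map_pow, ph0, ph1, ph2, sw0, sw2, nsw,
    map_ofNat, map_one] at N A B ⊢
  generalize ph s = a at *
  generalize ph (sw s) = b at *
  generalize ph n = m at *
  have hm : m ≠ 0 := by
    rintro rfl
    simp at N
  have K := tau_kap
  unfold kap at K
  have key := sq_id (X 0) (X 1) tau m hm N K
  rw [← A, ← B] at key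
  have hp : (X 1 * ((tau + 2 * X 0 * tau ^ 2 * m - X 0 ^ 2 * (1 - 4 * tau ^ 3 * m ^ 2)) * a) -
      X 0 * ((tau + 2 * X 1 * tau ^ 2 * m - X 1 ^ 2 * (1 - 4 * tau ^ 3 * m ^ 2)) * b)) *
      (X 1 * ((tau + 2 * X 0 * tau ^ 2 * m - X 0 ^ 2 * (1 - 4 * tau ^ 3 * m ^ 2)) * a) +
      X 0 * ((tau + 2 * X 1 * tau ^ 2 * m - X 1 ^ 2 * (1 - 4 * tau ^ 3 * m ^ 2)) * b)) = 0 := by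
    linear_combination key
  refine (mul_eq_zero.1 hp).resolve_left ?_
  intro h
  have h' : X 0 * X 1 * (X 1 * (ik * (1 + 2 * X 0 * tau * m) * a + (1 - 4 * tau ^ 3 * m ^ 2) * b)
      - X 0 * ((1 - 4 * tau ^ 3 * m ^ 2) * a + ik * (1 + 2 * X 1 * tau * m) * b)) = 0 := by
    have ht : tau = X 0 * X 1 * ik := rfl
    linear_combination h - (X 1 * a * (1 + 2 * X 0 * tau * m) -
      X 0 * b * (1 + 2 * X 1 * tau * m)) * ht
  have h2 := (mul_eq_zero.1 h').resolve_left (mul_ne_zero (X_ne 0) (X_ne 1))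
  have h3 := congrArg (Z 0) h2
  simp only [map_mul, map_sub, map_add, ZX, map_one, map_pow, map_ofNat, map_zero, Z0tau] at h3
  simp only [Fin.isValue, one_ne_zero, if_false, if_true, zero_mul, sub_zero] at h3
  have h4 := (mul_eq_zero.1 h3).resolve_left (X_ne 1)
  have h5 := congrArg constantCoeff h4
  simp [cc_Z, a1, b1, constantCoeff_ik] at h5

include hn n1 nsw hs s1 sZ in
theorem TT_eq_CC : TT = CC n s := by
  have hA : Z 0 s = 1 := by
    apply sq_eq_one _ _ (by rw [cc_Z, s1])
    have := congrArg (Z 0) hs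
    simpa using this
  have hB : Z 2 s = 1 := by
    apply sq_eq_one _ _ (by rw [cc_Z, s1])
    have := congrArg (Z 2) hs
    simpa using this
  have h0 : Z 0 (TT - CC n s) = 0 := by simp [TT, CC, hA]
  have h2 : Z 2 (TT - CC n s) = 0 := by simp [TT, CC, hB]
  have h1 : Z 1 (TT - CC n s) = TT - CC n s := by
    simp [TT, CC, n1, sZ, RR, R0, Z_idem, Z_comm01, map_ofNat]
  have hf : X 1 * ph (TT - CC n s) + X 0 * ph (sw (TT - CC n s)) = 0 := by
    have a := TT_eq
    have b := CC_eq n s hn nsw hs s1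
    simp only [map_sub]
    linear_combination a - b
  obtain ⟨M, hM⟩ := X_dvd_of_Z 0 _ h0
  rw [hM] at h1 h2 hf
  have h2' : Z 2 M = 0 := by
    simpa [X_ne] using h2
  obtain ⟨D, rfl⟩ := X_dvd_of_Z 2 _ h2'
  have h1' : Z 1 D = D := by
    simpa [X_ne] using h1
  have hD : ph D + ph (sw D) = 0 := by
    simp only [map_mul, ph0, ph1, ph2, sw0, sw2] at hf
    have : X 0 * X 1 * tau * (ph D + ph (sw D)) = 0 := by linear_combination hf
    exact (mul_eq_zero.1 this).resolve_left
      (mul_ne_zero (mul_ne_zero (X_ne 0) (X_ne 1)) tau_ne)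
  rw [descent D h1' hD] at hM
  linear_combination hM

include hn n0 n1 nsw hs s1 sZ in
theorem R0_eq : 2 * R0 = n * (3 - n) := by
  have h := TT_eq_CC n s hn n1 nsw hs s1 sZ
  have h0 : Z 0 R0 = R0 := Z_idem _ _
  obtain ⟨R', hR⟩ : X 0 ∣ RR - R0 := X_dvd_of_Z 0 _ (by
    rw [map_sub, h0]; unfold R0 RR; simp)
  have hR' : RR = R0 + X 0 * R' := by linear_combination hR
  have hsq : TT ^ 2 = (X 2 + 2 * X 0 * X 2 ^ 2 * n - X 0 ^ 2 * (1 - 4 * X 2 ^ 3 * n ^ 2)) ^ 2 *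
      (1 - X 0 * X 2 * n * (n + 1) + X 0 ^ 2 * X 2 ^ 2 * n ^ 2) := by
    rw [h, CC, mul_pow, hs]
  unfold TT at hsq
  rw [hR'] at hsq
  have hd : X 0 ∣ X 2 ^ 3 * (2 * R0 - n * (3 - n)) := by
    have : X 0 * X 0 ∣ X 0 * (X 2 ^ 3 * (2 * R0 - n * (3 - n))) := by
      have hP : ∀ (x t r g n p : S3),
        ((x * t ^ 2 * (2 * (r + x * g) - r) + t - x ^ 2 + t * x ^ 3) ^ 2 =
         (t + 2 * x * t ^ 2 * n - x ^ 2 * p) ^ 2 *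
           (1 - x * t * n * (n + 1) + x ^ 2 * t ^ 2 * n ^ 2)) →
        x * x ∣ x * (t ^ 3 * (2 * r - n * (3 - n))) := by
        intro x t r g n p h
        set A := t ^ 2 * 2 * g - 1 + t * x with hA
        have e1 : (x * t ^ 2 * (2 * (r + x * g) - r) + t - x ^ 2 + t * x ^ 3) =
          t + x * t ^ 2 * r + x ^ 2 * A := by rw [hA]; ring
        rw [e1] at h
        refine ⟨-(2 * t * A + (t ^ 2 * r + x * A) ^ 2) + ((2 * t ^ 2 * n - x * p) ^ 2 - 2 * t * p)
           + (- t * n * (n + 1)) * (2 * t * (2 * t ^ 2 * n - x * p) + x * (2 * t ^ 2 * n - x * p) ^ 2)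
           + t ^ 2 * n ^ 2 * (t + 2 * x * t ^ 2 * n - x ^ 2 * p) ^ 2, ?_⟩
        linear_combination h
      exact hP _ _ _ _ _ _ hsq
    exact (mul_dvd_mul_iff_left (X_ne 0)).1 this
  obtain ⟨g, hg⟩ := hd
  have := congrArg (Z 0) hg
  simp only [map_mul, map_sub, map_pow, map_ofNat, h0, n0, ZX] at this
  simp [X_ne] at this
  linear_combination this

end

end RK
namespace RK
open MvPowerSeries

abbrev A3 := MvPolynomial (Fin 3) ℚ

theorem alg_X (i : Fin 3) : IsAlgebraic A3 (X i : S3) := by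
  have := isAlgebraic_algebraMap (R := A3) (A := S3) (MvPolynomial.X i)
  rw [MvPowerSeries.algebraMap_apply'] at this
  simpa using this

theorem alg_div (a f : S3) (ha : a ≠ 0) (hA : IsAlgebraic A3 a) (h : IsAlgebraic A3 (a * f)) :
    IsAlgebraic A3 f :=
  IsAlgebraic.of_mul (mem_nonZeroDivisors_of_ne_zero ha) hA h

theorem alg_one : IsAlgebraic A3 (1 : S3) := isAlgebraic_one
theorem alg_ofNat (k : ℕ) [k.AtLeastTwo] : IsAlgebraic A3 (OfNat.ofNat k : S3) := by
  have := isAlgebraic_natCast (R := A3) (A := S3) k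
  exact this

theorem alg_n (n : S3) (hn : n = 1 + 4 * X 2 ^ 3 * n ^ 3) : IsAlgebraic A3 n := by
  have hX : algebraMap A3 S3 (MvPolynomial.X 2) = X 2 := by
    rw [MvPowerSeries.algebraMap_apply']; simp
  refine ⟨1 - Polynomial.X + Polynomial.C (4 * MvPolynomial.X 2 ^ 3) * Polynomial.X ^ 3, ?_, ?_⟩
  · intro h
    have := congrArg (Polynomial.eval 0) h
    simp at this
  · simp only [map_add, map_sub, map_one, map_mul, map_pow, Polynomial.aeval_X, Polynomial.aeval_C,
      hX, map_ofNat]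
    linear_combination -hn

theorem alg_sw_R : IsAlgebraic A3 RR ∧ IsAlgebraic A3 (sw RR) ∧ IsAlgebraic A3 R0 := by
  obtain ⟨n, hn, n0, n1, nsw⟩ := n_data
  obtain ⟨s, hs, s1, sZ⟩ := s_data n n1
  have hT := TT_eq_CC n s hn n1 nsw hs s1 sZ
  have hR := R0_eq n s hn n0 n1 nsw hs s1 sZ
  have an := alg_n n hn
  have ax := alg_X 0
  have ay := alg_X 1
  have az := alg_X 2
  have a1 := alg_one
  have a2 := alg_ofNat 2
  have a3 := alg_ofNat 3
  have a4 := alg_ofNat 4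
  have aR0 : IsAlgebraic A3 R0 := alg_div 2 _ two_ne a2 (by rw [hR]; exact an.mul (a3.sub an))
  have as : IsAlgebraic A3 s := IsAlgebraic.of_pow (n := 2) (by norm_num) (by
    rw [hs]
    exact (a1.sub (((ax.mul az).mul an).mul (an.add a1))).add
      (((ax.pow 2).mul (az.pow 2)).mul (an.pow 2)))
  have hs' := congrArg sw hs
  simp only [map_mul, map_sub, map_add, map_pow, sw0, sw2, nsw, map_one] at hs'
  have asw : IsAlgebraic A3 (sw s) := IsAlgebraic.of_pow (n := 2) (by norm_num) (by
    rw [hs']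
    exact (a1.sub (((ay.mul az).mul an).mul (an.add a1))).add
      (((ay.pow 2).mul (az.pow 2)).mul (an.pow 2)))
  have gen : ∀ x r σ : S3, x ≠ 0 → IsAlgebraic A3 x → IsAlgebraic A3 σ →
      x * X 2 ^ 2 * (2 * r - R0) + X 2 - x ^ 2 + X 2 * x ^ 3 =
        (X 2 + 2 * x * X 2 ^ 2 * n - x ^ 2 * (1 - 4 * X 2 ^ 3 * n ^ 2)) * σ →
      IsAlgebraic A3 r := by
    intro x r σ hx0 hx hσ h
    have e : (x * X 2 ^ 2 * 2) * r =
        (X 2 + 2 * x * X 2 ^ 2 * n - x ^ 2 * (1 - 4 * X 2 ^ 3 * n ^ 2)) * σ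
          + x * X 2 ^ 2 * R0 - X 2 + x ^ 2 - X 2 * x ^ 3 := by linear_combination h
    refine alg_div (x * X 2 ^ 2 * 2) r
      (mul_ne_zero (mul_ne_zero hx0 (pow_ne_zero 2 (X_ne 2))) two_ne)
      ((hx.mul (az.pow 2)).mul a2) ?_
    rw [e]
    have b1 := (az.add (((a2.mul hx).mul (az.pow 2)).mul an)).sub
      ((hx.pow 2).mul (a1.sub ((a4.mul (az.pow 3)).mul (an.pow 2))))
    exact ((((b1.mul hσ).add ((hx.mul (az.pow 2)).mul aR0)).sub az).add (hx.pow 2)).sub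
      (az.mul (hx.pow 3))
  unfold TT CC at hT
  have hT' := congrArg sw hT
  simp only [map_mul, map_sub, map_add, map_pow, sw0, sw2, nsw, map_one, map_ofNat, sw_R0] at hT'
  exact ⟨gen _ _ _ (X_ne 0) ax as hT, gen _ _ _ (X_ne 1) ay asw hT', aR0⟩

theorem alg_QQ : IsAlgebraic A3 QQ := by
  obtain ⟨h1, h2, h3⟩ := alg_sw_R
  have ax := alg_X 0
  have ay := alg_X 1
  have az := alg_X 2
  have ak : IsAlgebraic A3 kap :=
    (alg_one.add ((ax.pow 2).mul ay)).add (ax.mul (ay.pow 2))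
  refine alg_div _ _ ?_ ((ax.mul ay).sub (az.mul ak)) (by
    rw [func_eq]; exact (ax.mul ay).sub (az.mul ((h1.add h2).sub h3)))
  intro h
  have := congrArg (Z 2) h
  simp [X_ne] at this

theorem aeval_conv (f : S3) (g : MvPolynomial (Fin 4) ℚ) :
    MvPolynomial.aeval ![f, X 0, X 1, X 2] g =
      Polynomial.aeval f (MvPolynomial.finSuccEquiv ℚ 3 g) := by
  induction g using MvPolynomial.induction_on with
  | C a =>
    rw [MvPolynomial.finSuccEquiv_apply]
    simp [MvPowerSeries.algebraMap_apply']
    rfl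
  | add p q hp hq => rw [map_add, map_add, map_add, hp, hq]
  | mul_X p i hp =>
    rw [map_mul, map_mul, map_mul, hp]
    congr 1
    refine Fin.cases ?_ (fun j => ?_) i
    · rw [MvPolynomial.finSuccEquiv_X_zero]; simp
    · rw [MvPolynomial.finSuccEquiv_X_succ]
      simp [MvPowerSeries.algebraMap_apply']
      fin_cases j <;> rfl

theorem extract (f : S3) (hf : IsAlgebraic A3 f) : ∃ P : MvPolynomial (Fin 4) ℚ, P ≠ 0 ∧
    MvPolynomial.aeval ![X 0, X 1, X 2, f] P = 0 := by
  obtain ⟨p, hp, h⟩ := hf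
  obtain ⟨g, rfl⟩ := (MvPolynomial.finSuccEquiv ℚ 3).surjective p
  rw [← aeval_conv] at h
  have hinj : Function.Injective ![(3 : Fin 4), 0, 1, 2] := by decide
  refine ⟨MvPolynomial.rename ![(3 : Fin 4), 0, 1, 2] g, ?_, ?_⟩
  · intro h0
    apply hp
    rw [MvPolynomial.rename_injective _ hinj (h0.trans (map_zero _).symm), map_zero]
  · rw [MvPolynomial.aeval_rename, ← h]
    congr 2
    funext i
    fin_cases i <;> rfl

end RK

/-- For the reverse Kreweras model, the generating function `Q(x,y;t)` is algebraic:
some nonzero polynomial `P ∈ ℚ[x,y,t,u]` satisfies `P(x,y,t,Q(x,y;t)) = 0`. -/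
theorem reverse_kreweras_algebraic :
    ∃ P : MvPolynomial (Fin 4) ℚ, P ≠ 0 ∧
      MvPolynomial.aeval
        ![MvPowerSeries.X 0, MvPowerSeries.X 1, MvPowerSeries.X 2,
          Q reverseKrewerasSteps] P = 0 := by
  exact RK.extract _ RK.alg_QQ
end

section
/- For the weighted model with steps and weights w(−1,0)=2, w(−1,1)=1, w(0,1)=2, w(1,1)=1, w(1,0)=1, w(0,−1)=1, w(−1,−1)=1, the weighted generating function Q(x,y;t) is algebraic: there exists a nonzero polynomial P ∈ ℚ[x,y,t,u] such that P(x, y, t, Q(x,y;t)) = 0 in the formal power series ring ℚ[[x,y,t]]. -/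
/-- The step set of the weighted model. -/
def wSteps : Set (ℤ × ℤ) := {(-1, 0), (-1, 1), (0, 1), (1, 1), (1, 0), (0, -1), (-1, -1)}

/-- The weights: `(-1,0)` and `(0,1)` have weight `2`, the other steps weight `1`. -/
def wt (s : ℤ × ℤ) : ℚ := if s = (-1, 0) then 2 else if s = (0, 1) then 2 else 1

/-- The total weight `q(i,j;n)` of weighted quadrant walks of length `n` from
`(0,0)` to `(i,j)`, each walk weighted by the product of its step weights. -/
noncomputable def qW (i j n : ℕ) : ℚ :=
  ∑ᶠ w ∈ quadWalks wSteps i j n, ((w.map wt).prod)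

/-- The weighted generating function `Q(x,y;t) = Σ q(i,j;n) x^i y^j t^n`, as a formal
power series in the three variables `x = X 0`, `y = X 1`, `t = X 2`. -/
noncomputable def QW : MvPowerSeries (Fin 3) ℚ :=
  fun d => qW (d 0) (d 1) (d 2)



/-- The ambient power series ring. -/
abbrev PS := MvPowerSeries (Fin 3) ℚ

namespace WM
open MvPowerSeries

/-- Series not involving the variable `i`. -/
def noVar (i : Fin 3) : Subalgebra ℚ PS where
  carrier := {f | ∀ d, d i ≠ 0 → coeff d f = 0}
  mul_mem' := by
    intro f g hf hg d hd
    rw [coeff_mul]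
    apply Finset.sum_eq_zero
    intro p hp
    rw [Finset.HasAntidiagonal.mem_antidiagonal] at hp
    by_cases h : p.1 i = 0
    · have : p.2 i ≠ 0 := by
        intro h2; apply hd; rw [← hp]; simp [h, h2]
      rw [hg _ this, mul_zero]
    · rw [hf _ h, zero_mul]
  add_mem' := by
    intro f g hf hg d hd
    rw [map_add, hf d hd, hg d hd, add_zero]
  algebraMap_mem' := by
    intro r d hd
    rw [MvPowerSeries.algebraMap_apply, coeff_C, if_neg]
    rintro rfl; simp at hd

theorem mem_noVar {i : Fin 3} {f : PS} : f ∈ noVar i ↔ ∀ d, d i ≠ 0 → coeff d f = 0 := Iff.rfl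

theorem X_mem_noVar {i j : Fin 3} (h : j ≠ i) : (X j : PS) ∈ noVar i := by
  intro d hd
  rw [coeff_X, if_neg]
  rintro rfl
  simp [h] at hd

theorem decomp (i : Fin 3) (f : PS) : ∃ g h : PS, f = g + X i * h ∧ g ∈ noVar i ∧
    (∀ j, f ∈ noVar j → g ∈ noVar j) ∧ (∀ j, j ≠ i → f ∈ noVar j → h ∈ noVar j) := by
  let g : PS := fun d => if d i = 0 then coeff d f else 0
  let h : PS := fun d => coeff (d + Finsupp.single i 1) f
  have hg : ∀ d, coeff d g = if d i = 0 then coeff d f else 0 := fun d => rfl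
  have hh : ∀ d, coeff d h = coeff (d + Finsupp.single i 1) f := fun d => rfl
  refine ⟨g, h, ?_, ?_, ?_, ?_⟩
  · ext d
    rw [map_add, hg, X_def, coeff_monomial_mul]
    by_cases hd : d i = 0
    · rw [if_pos hd, if_neg, add_zero]
      intro hle
      have := hle i
      simp [hd] at this
    · have hle : Finsupp.single i 1 ≤ d := by
        rw [Finsupp.single_le_iff]; omega
      rw [if_neg hd, if_pos hle, hh, tsub_add_cancel_of_le hle]; simp
  · intro d hd; rw [hg, if_neg hd]
  · intro j hf d hd
    rw [hg, hf d hd]; simp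
  · intro j hj hf d hd
    rw [hh]; apply hf
    simp [hd]

theorem eq_zero_of_dvd {i : Fin 3} {f : PS} (hf : f ∈ noVar i) (h : X i ∣ f) : f = 0 := by
  ext d
  rw [X_dvd_iff] at h
  by_cases hd : d i = 0
  · rw [h d hd]; simp
  · rw [hf d hd]; simp

theorem X_dvd_mul {i : Fin 3} {f g : PS} (h : X i ∣ f * g) : X i ∣ f ∨ X i ∣ g := by
  obtain ⟨f0, f1, hf, hf0, -, -⟩ := decomp i f
  obtain ⟨g0, g1, hg, hg0, -, -⟩ := decomp i g
  have h1 : X i ∣ f0 * g0 := by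
    have : f0 * g0 = f * g - X i * (f1 * g0 + f0 * g1 + X i * f1 * g1) := by
      rw [hf, hg]; ring
    rw [this]
    exact dvd_sub h (dvd_mul_right _ _)
  have h2 := eq_zero_of_dvd (mul_mem hf0 hg0) h1
  rcases mul_eq_zero.mp h2 with h3 | h3
  · left; rw [hf, h3, zero_add]; exact dvd_mul_right _ _
  · right; rw [hg, h3, zero_add]; exact dvd_mul_right _ _

theorem inv_mem_noVar {i : Fin 3} {f g : PS} (hf : f ∈ noVar i) (h : f * g = 1) : g ∈ noVar i := by
  obtain ⟨g0, g1, hg, hg0, -, -⟩ := decomp i g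
  have h1 : f * g0 - 1 = 0 := by
    apply eq_zero_of_dvd (i := i) (sub_mem (mul_mem hf hg0) (one_mem _))
    refine ⟨- f * g1, ?_⟩
    rw [← h, hg]; ring
  have : g = g0 := by
    calc g = (f * g0) * g := by rw [sub_eq_zero.mp h1, one_mul]
      _ = (f * g) * g0 := by ring
      _ = g0 := by rw [h, one_mul]
  rw [this]; exact hg0

theorem exists_inv {f : PS} (hf : constantCoeff f ≠ 0) : ∃ g : PS, f * g = 1 :=
  ⟨f⁻¹, MvPowerSeries.mul_inv_cancel f hf⟩

theorem ne_zero_of_cc {f : PS} (hf : constantCoeff f ≠ 0) : f ≠ 0 := by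
  rintro rfl; simp at hf

theorem X_ne_zero' (i : Fin 3) : (X i : PS) ≠ 0 := by
  intro h
  have := congrArg (coeff (Finsupp.single i 1)) h
  simp [coeff_X] at this

/-- Substitution homomorphism. -/
noncomputable def sub (a : Fin 3 → PS) (ha : ∀ i, constantCoeff (a i) = 0) : PS →ₐ[ℚ] PS :=
  substAlgHom (hasSubst_of_constantCoeff_zero ha)

theorem sub_X (a : Fin 3 → PS) (ha : ∀ i, constantCoeff (a i) = 0) (i : Fin 3) :
    sub a ha (X i) = a i := substAlgHom_X _ i

theorem coeff_sub (a : Fin 3 → PS) (ha : ∀ i, constantCoeff (a i) = 0) (f : PS) (e : Fin 3 →₀ ℕ) :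
    coeff e (sub a ha f) = ∑ᶠ d, coeff d f • coeff e (d.prod fun s k => (a s) ^ k) := by
  unfold sub
  rw [substAlgHom_apply, coeff_subst (hasSubst_of_constantCoeff_zero ha)]

theorem sub_congr {a b : Fin 3 → PS} (ha : ∀ i, constantCoeff (a i) = 0)
    (hb : ∀ i, constantCoeff (b i) = 0) {f : PS}
    (h : ∀ i, a i = b i ∨ f ∈ noVar i) : sub a ha f = sub b hb f := by
  ext e
  rw [coeff_sub, coeff_sub]
  apply finsum_congr
  intro d
  by_cases hd : coeff d f = 0
  · rw [hd, zero_smul, zero_smul]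
  · congr 2
    apply Finsupp.prod_congr
    intro i hi
    rw [Finsupp.mem_support_iff] at hi
    rcases h i with h | h
    · rw [h]
    · exact absurd (h d hi) hd

theorem sub_mem_noVar {a : Fin 3 → PS} (ha : ∀ i, constantCoeff (a i) = 0) {f : PS} {j : Fin 3}
    (h : ∀ i, a i ∈ noVar j ∨ f ∈ noVar i) : sub a ha f ∈ noVar j := by
  intro e he
  rw [coeff_sub]
  apply finsum_eq_zero_of_forall_eq_zero
  intro d
  by_cases hd : coeff d f = 0
  · rw [hd, zero_smul]
  · have : (d.prod fun s k => (a s) ^ k) ∈ noVar j := by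
      apply prod_mem
      intro i hi
      rw [Finsupp.mem_support_iff] at hi
      rcases h i with h | h
      · exact pow_mem h _
      · exact absurd (h d hi) hd
    rw [this e he, smul_zero]

theorem constantCoeff_sub' (a : Fin 3 → PS) (ha : ∀ i, constantCoeff (a i) = 0) (f : PS) :
    constantCoeff (sub a ha f) = constantCoeff f := by
  have h : sub a ha (f - C (constantCoeff f)) = sub a ha f - C (constantCoeff f) := by
    rw [map_sub]
    congr 1
    exact (sub a ha).commutes (constantCoeff f)
  have h2 : constantCoeff (sub a ha (f - C (constantCoeff f))) = 0 := by
    unfold sub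
    rw [substAlgHom_apply]
    apply constantCoeff_subst_eq_zero (hasSubst_of_constantCoeff_zero ha) ha
    simp
  rw [h] at h2
  simpa [sub_eq_zero] using h2

/-- The kernel polynomial. -/
noncomputable def NN : PS := X 1 ^ 2 * (1 + X 0) ^ 2 + X 1 * (2 + X 0 ^ 2) + 1 + X 0

theorem inv_lemma {f g H : PS} (hf : f ∈ noVar 1) (hg : g ∈ noVar 0)
    (h : f - g = (X 0 * X 1 - X 2 * NN) * H) : H = 0 := by
  have key : ∀ n : ℕ, (X 2 : PS) ^ n ∣ H := by
    intro n
    induction n with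
    | zero => simp
    | succ n ih =>
      obtain ⟨H', rfl⟩ := ih
      rw [pow_succ]
      apply mul_dvd_mul_left
      rw [X_dvd_iff]
      intro m hm
      set e : Fin 3 →₀ ℕ := Finsupp.single 0 1 + Finsupp.single 1 1 with he
      have h1 : coeff (Finsupp.single 2 n + (e + m)) (f - g) = 0 := by
        rw [map_sub, hf, hg, sub_zero] <;> simp [he]
      have h2 : f - g = monomial (Finsupp.single 2 n) 1 * (monomial e 1 * H' - X 2 * (NN * H')) := by
        rw [h, he, ← X_pow_eq, ← one_mul (1:ℚ), ← monomial_mul_monomial, ← X_def, ← X_def]; ring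
      rw [h2, coeff_add_monomial_mul, one_mul, map_sub, coeff_add_monomial_mul, one_mul] at h1
      have h3 : coeff (e + m) (X 2 * (NN * H')) = 0 := by
        have : (X 2 : PS) ∣ X 2 * (NN * H') := dvd_mul_right _ _
        rw [X_dvd_iff] at this
        apply this
        simp [he, hm]
      rw [h3, sub_zero] at h1
      exact h1
  ext m
  have := key (m 2 + 1)
  rw [X_pow_dvd_iff] at this
  rw [this m (by omega)]; simp

end WM

namespace WM
open MvPowerSeries

/-- Walks with integer end point. -/
def wz (a b : ℤ) (n : ℕ) : Set (List (ℤ × ℤ)) :=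
  {w | w.length = n ∧ (∀ s ∈ w, s ∈ wSteps) ∧
    (∀ k, 0 ≤ ((w.take k).map Prod.fst).sum ∧ 0 ≤ ((w.take k).map Prod.snd).sum) ∧
    (w.map Prod.fst).sum = a ∧ (w.map Prod.snd).sum = b}

/-- Weighted count with integer end point. -/
noncomputable def qz (a b : ℤ) (n : ℕ) : ℚ := ∑ᶠ w ∈ wz a b n, ((w.map wt).prod)

theorem qW_eq (i j n : ℕ) : qW i j n = qz i j n := rfl

theorem wz_neg {a b : ℤ} {n : ℕ} (h : a < 0 ∨ b < 0) : wz a b n = ∅ := by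
  rw [Set.eq_empty_iff_forall_notMem]
  rintro w ⟨h1, h2, h3, h4, h5⟩
  have := h3 w.length
  rw [List.take_length, h4, h5] at this
  omega

theorem qz_neg {a b : ℤ} {n : ℕ} (h : a < 0 ∨ b < 0) : qz a b n = 0 := by
  unfold qz; rw [wz_neg h]; simp

theorem qz_zero (a b : ℤ) : qz a b 0 = if a = 0 ∧ b = 0 then 1 else 0 := by
  unfold qz
  split_ifs with h
  · obtain ⟨rfl, rfl⟩ := h
    have : wz 0 0 0 = {[]} := by
      ext w
      constructor
      · rintro ⟨h1, -⟩
        simpa using h1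
      · rintro rfl
        simp [wz]
    rw [this]; simp
  · have : wz a b 0 = ∅ := by
      rw [Set.eq_empty_iff_forall_notMem]
      rintro w ⟨h1, h2, h3, h4, h5⟩
      have : w = [] := by simpa using h1
      subst this
      simp at h4 h5
      exact h ⟨h4.symm, h5.symm⟩
    rw [this]; simp

/-- The steps as a finset. -/
def stp : Finset (ℤ × ℤ) := {(-1, 0), (-1, 1), (0, 1), (1, 1), (1, 0), (0, -1), (-1, -1)}

theorem mem_stp (s : ℤ × ℤ) : s ∈ wSteps ↔ s ∈ stp := by
  simp [wSteps, stp]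

theorem wz_succ {a b : ℤ} (n : ℕ) (ha : 0 ≤ a) (hb : 0 ≤ b) :
    wz a b (n + 1) = ⋃ s ∈ (stp : Set (ℤ × ℤ)),
      (fun w : List (ℤ × ℤ) => w ++ [s]) '' wz (a - s.1) (b - s.2) n := by
  ext w
  simp only [Set.mem_iUnion, Set.mem_image]
  constructor
  · rintro ⟨h1, h2, h3, h4, h5⟩
    have hne : w ≠ [] := by rintro rfl; simp at h1
    obtain ⟨v, s, rfl⟩ := List.eq_nil_or_concat' w |>.resolve_left hne
    refine ⟨s, ?_, v, ⟨?_, ?_, ?_, ?_, ?_⟩, rfl⟩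
    · rw [Finset.mem_coe, ← mem_stp]; exact h2 s (by simp)
    · simpa using h1
    · intro r hr; exact h2 r (by simp [hr])
    · intro k
      have := h3 (min k v.length)
      rw [List.take_append_of_le_length (by omega)] at this
      rcases le_total k v.length with hk | hk
      · rwa [min_eq_left hk] at this
      · rw [min_eq_right hk, List.take_length] at this
        rwa [List.take_of_length_le hk]
    · simp at h4; omega
    · simp at h5; omega
  · rintro ⟨s, hs, v, ⟨h1, h2, h3, h4, h5⟩, rfl⟩
    refine ⟨by simp [h1], ?_, ?_, by simp [h4], by simp [h5]⟩
    · intro r hr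
      rcases List.mem_append.mp hr with hr | hr
      · exact h2 r hr
      · rw [List.mem_singleton] at hr; subst hr; rw [mem_stp]; exact hs
    · intro k
      rcases Nat.lt_or_ge k (v.length + 1) with hk | hk
      · rw [List.take_append_of_le_length (by omega)]; exact h3 k
      · rw [List.take_of_length_le (by simp; omega)]
        simp [h4, h5, ha, hb]

theorem wz_finite (n : ℕ) : ∀ a b : ℤ, (wz a b n).Finite := by
  induction n with
  | zero =>
    intro a b
    apply Set.Finite.subset (Set.finite_singleton [])
    rintro w ⟨h1, -⟩
    simpa using h1
  | succ n ih =>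
    intro a b
    by_cases h : a < 0 ∨ b < 0
    · rw [wz_neg h]; exact Set.finite_empty
    · rw [wz_succ n (by omega) (by omega)]
      exact Set.Finite.biUnion (Finset.finite_toSet _) (fun s _ => (ih _ _).image _)

theorem qz_succ {a b : ℤ} (n : ℕ) (ha : 0 ≤ a) (hb : 0 ≤ b) :
    qz a b (n + 1) = ∑ s ∈ stp, wt s * qz (a - s.1) (b - s.2) n := by
  unfold qz
  rw [wz_succ n ha hb, finsum_mem_biUnion]
  · rw [finsum_mem_coe_finset]
    apply Finset.sum_congr rfl
    intro s _
    rw [finsum_mem_image]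
    · rw [mul_finsum_mem' _ _ (wz_finite _ _ _)]
      apply finsum_mem_congr rfl
      intro w _
      simp [mul_comm]
    · intro v _ w _ h
      exact List.append_cancel_right h
  · intro s _ r _ hsr
    rw [Function.onFun, Set.disjoint_left]
    rintro w ⟨v, -, rfl⟩ ⟨v', -, h⟩
    apply hsr
    have := congrArg List.getLast? h
    simp at this
    exact this.symm
  · exact Finset.finite_toSet _
  · intro s _
    exact (wz_finite _ _ _).image _

theorem qz_rec {a b : ℤ} (n : ℕ) (ha : 0 ≤ a) (hb : 0 ≤ b) :
    qz a b (n + 1) = 2 * qz (a + 1) b n + qz (a + 1) (b - 1) n + 2 * qz a (b - 1) n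
      + qz (a - 1) (b - 1) n + qz (a - 1) b n + qz a (b + 1) n + qz (a + 1) (b + 1) n := by
  rw [qz_succ n ha hb]
  simp only [stp]
  repeat rw [Finset.sum_insert (by decide)]
  rw [Finset.sum_singleton]
  simp [wt]
  ring

end WM


namespace WM
open MvPowerSeries

/-- exponent vector -/
noncomputable def ev (i j n : ℕ) : Fin 3 →₀ ℕ :=
  Finsupp.single 0 i + Finsupp.single 1 j + Finsupp.single 2 n

theorem ev_0 (i j n : ℕ) : ev i j n 0 = i := by simp [ev]
theorem ev_1 (i j n : ℕ) : ev i j n 1 = j := by simp [ev]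
theorem ev_2 (i j n : ℕ) : ev i j n 2 = n := by simp [ev]

theorem ev_self (d : Fin 3 →₀ ℕ) : ev (d 0) (d 1) (d 2) = d := by
  ext i; fin_cases i <;> simp [ev_0, ev_1, ev_2]

/-- Coefficients extended by zero to integer exponents. -/
noncomputable def cz (f : PS) (a b c : ℤ) : ℚ :=
  if 0 ≤ a ∧ 0 ≤ b ∧ 0 ≤ c then coeff (ev a.toNat b.toNat c.toNat) f else 0

theorem cz_ext {f g : PS} (h : ∀ a b c : ℤ, 0 ≤ a → 0 ≤ b → 0 ≤ c → cz f a b c = cz g a b c) :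
    f = g := by
  ext d
  have := h (d 0) (d 1) (d 2) (by omega) (by omega) (by omega)
  simpa [cz, ev_self] using this

theorem cz_add (f g : PS) (a b c : ℤ) : cz (f + g) a b c = cz f a b c + cz g a b c := by
  unfold cz; split_ifs <;> simp

theorem cz_sub (f g : PS) (a b c : ℤ) : cz (f - g) a b c = cz f a b c - cz g a b c := by
  unfold cz; split_ifs <;> simp

theorem coeff_X_mul' (i : Fin 3) (f : PS) (d : Fin 3 →₀ ℕ) :
    coeff d (X i * f) = if d i = 0 then 0 else coeff (d - Finsupp.single i 1) f := by
  rw [X_def, coeff_monomial_mul, one_mul]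
  by_cases h : d i = 0
  · rw [if_pos h, if_neg]
    intro hle
    have := hle i
    simp [h] at this
  · rw [if_neg h, if_pos]
    rw [Finsupp.single_le_iff]; omega

theorem cz_X0 (f : PS) (a b c : ℤ) : cz (X 0 * f) a b c = cz f (a - 1) b c := by
  unfold cz
  rw [coeff_X_mul', ev_0]
  have : ev a.toNat b.toNat c.toNat - Finsupp.single 0 1 = ev (a - 1).toNat b.toNat c.toNat := by
    ext i; fin_cases i <;> simp [ev_0, ev_1, ev_2]
  rw [this]
  split_ifs <;> first | rfl | omega

theorem cz_X1 (f : PS) (a b c : ℤ) : cz (X 1 * f) a b c = cz f a (b - 1) c := by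
  unfold cz
  rw [coeff_X_mul', ev_1]
  have : ev a.toNat b.toNat c.toNat - Finsupp.single 1 1 = ev a.toNat (b - 1).toNat c.toNat := by
    ext i; fin_cases i <;> simp [ev_0, ev_1, ev_2]
  rw [this]
  split_ifs <;> first | rfl | omega

theorem cz_X2 (f : PS) (a b c : ℤ) : cz (X 2 * f) a b c = cz f a b (c - 1) := by
  unfold cz
  rw [coeff_X_mul', ev_2]
  have : ev a.toNat b.toNat c.toNat - Finsupp.single 2 1 = ev a.toNat b.toNat (c - 1).toNat := by
    ext i; fin_cases i <;> simp [ev_0, ev_1, ev_2]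
  rw [this]
  split_ifs <;> first | rfl | omega

theorem cz_one (a b c : ℤ) : cz 1 a b c = if a = 0 ∧ b = 0 ∧ c = 0 then 1 else 0 := by
  unfold cz
  rw [coeff_one]
  have : ev a.toNat b.toNat c.toNat = 0 ↔ a.toNat = 0 ∧ b.toNat = 0 ∧ c.toNat = 0 := by
    constructor
    · intro h
      have h0 := DFunLike.congr_fun h 0
      have h1 := DFunLike.congr_fun h 1
      have h2 := DFunLike.congr_fun h 2
      rw [ev_0] at h0; rw [ev_1] at h1; rw [ev_2] at h2
      exact ⟨h0, h1, h2⟩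
    · rintro ⟨h0, h1, h2⟩; simp [ev, h0, h1, h2]
  simp only [this]
  split_ifs <;> first | rfl | omega

/-- `Q(x,0)` -/
noncomputable def QA : PS := fun d => if d 1 = 0 then QW d else 0
/-- `Q(0,y)` -/
noncomputable def QB : PS := fun d => if d 0 = 0 then QW d else 0
/-- `Q(0,0)` -/
noncomputable def QC : PS := fun d => if d 0 = 0 ∧ d 1 = 0 then QW d else 0

theorem cz_QW (a b : ℤ) (n : ℕ) : cz QW a b n = qz a b n := by
  unfold cz
  split_ifs with h
  · change QW _ = _
    unfold QW
    rw [ev_0, ev_1, ev_2, qW_eq, Int.toNat_of_nonneg h.1, Int.toNat_of_nonneg h.2.1]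
    simp
  · rw [qz_neg]; omega

theorem cz_neg (f : PS) {a b c : ℤ} (h : c < 0) : cz f a b c = 0 := by
  unfold cz; rw [if_neg]; omega

theorem cz_QA (a b c : ℤ) : cz QA a b c = if b = 0 then cz QW a b c else 0 := by
  unfold cz
  have : ∀ d, coeff d QA = if d 1 = 0 then coeff d QW else 0 := fun d => rfl
  rw [this, ev_1]
  split_ifs <;> first | rfl | omega

theorem cz_QB (a b c : ℤ) : cz QB a b c = if a = 0 then cz QW a b c else 0 := by
  unfold cz
  have : ∀ d, coeff d QB = if d 0 = 0 then coeff d QW else 0 := fun d => rfl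
  rw [this, ev_0]
  split_ifs <;> first | rfl | omega

theorem cz_QC (a b c : ℤ) : cz QC a b c = if a = 0 ∧ b = 0 then cz QW a b c else 0 := by
  unfold cz
  have : ∀ d, coeff d QC = if d 0 = 0 ∧ d 1 = 0 then coeff d QW else 0 := fun d => rfl
  rw [this, ev_0, ev_1]
  split_ifs <;> first | rfl | omega

theorem QA_mem : QA ∈ noVar 1 := by
  intro d hd
  change (if d 1 = 0 then QW d else 0) = 0
  rw [if_neg hd]

theorem QB_mem : QB ∈ noVar 0 := by
  intro d hd
  change (if d 0 = 0 then QW d else 0) = 0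
  rw [if_neg hd]

theorem QC_mem0 : QC ∈ noVar 0 := by
  intro d hd
  change (if d 0 = 0 ∧ d 1 = 0 then QW d else 0) = 0
  rw [if_neg (fun h => hd h.1)]

theorem QC_mem1 : QC ∈ noVar 1 := by
  intro d hd
  change (if d 0 = 0 ∧ d 1 = 0 then QW d else 0) = 0
  rw [if_neg (fun h => hd h.2)]

theorem FE_aux : X 0 * (X 1 * QW) + X 2 * QA + X 2 * (X 0 * QA) + X 2 * QB + X 2 * (X 1 * QB)
      + X 2 * (X 1 * QB) + X 2 * (X 1 * (X 1 * QB)) = X 0 * (X 1 * 1) + X 2 * QC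
      + X 2 * (X 1 * (X 1 * QW)) + X 2 * (X 0 * (X 1 * (X 1 * QW))) + X 2 * (X 0 * (X 1 * (X 1 * QW)))
      + X 2 * (X 0 * (X 0 * (X 1 * (X 1 * QW)))) + X 2 * (X 1 * QW) + X 2 * (X 1 * QW)
      + X 2 * (X 0 * (X 0 * (X 1 * QW))) + X 2 * QW + X 2 * (X 0 * QW) := by
  apply cz_ext
  intro a b c ha hb hc
  simp only [cz_add, cz_X0, cz_X1, cz_X2, cz_one, cz_QA, cz_QB, cz_QC]
  obtain ⟨n, rfl⟩ := Int.eq_ofNat_of_zero_le hc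
  rcases n with _ | n
  · have hneg : ∀ a b : ℤ, cz QW a b ((0 : ℕ) - 1 : ℤ) = 0 := fun a b => cz_neg _ (by simp)
    simp only [hneg, cz_QW, qz_zero]
    simp
  · have hs : ((n + 1 : ℕ) : ℤ) - 1 = (n : ℤ) := by push_cast; ring
    simp only [hs, cz_QW]
    have e1 : a - 1 - 1 = a - 2 := by ring
    have e2 : b - 1 - 1 = b - 2 := by ring
    simp only [e1, e2]
    have hc' : ¬ (a - 1 = 0 ∧ b - 1 = 0 ∧ ((n + 1 : ℕ) : ℤ) = 0) := by omega
    rw [if_neg hc']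
    by_cases hx : a = 0
    · subst hx
      by_cases hy : b = 0
      · subst hy
        have z1 : ∀ c : ℤ, qz (0 - 1) c n = 0 := fun c => qz_neg (by omega)
        have z2 : ∀ c : ℤ, qz (0 - 2) c n = 0 := fun c => qz_neg (by omega)
        have z3 : ∀ c : ℤ, qz c (0 - 1) n = 0 := fun c => qz_neg (by omega)
        have z4 : ∀ c : ℤ, qz c (0 - 2) n = 0 := fun c => qz_neg (by omega)
        rw [qz_neg (a := 0 - 1) (by omega)]
        simp only [z1, z2, z3, z4]; simp
      · have z1 : ∀ c : ℤ, qz (0 - 1) c n = 0 := fun c => qz_neg (by omega)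
        have z2 : ∀ c : ℤ, qz (0 - 2) c n = 0 := fun c => qz_neg (by omega)
        rw [qz_neg (a := 0 - 1) (by omega)]
        simp only [z1, z2, hy]; simp; ring
    · by_cases hy : b = 0
      · subst hy
        have z3 : ∀ c : ℤ, qz c (0 - 1) n = 0 := fun c => qz_neg (by omega)
        have z4 : ∀ c : ℤ, qz c (0 - 2) n = 0 := fun c => qz_neg (by omega)
        rw [qz_neg (b := 0 - 1) (by omega)]
        simp only [z3, z4, hx]; simp
      · rw [qz_rec n (by omega) (by omega)]
        have f1 : a - 1 + 1 = a := by ring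
        have f2 : b - 1 + 1 = b := by ring
        simp only [f1, f2, e1, e2, hx, hy]
        simp
        ring

theorem FE : (X 0 * X 1 - X 2 * NN) * QW = X 0 * X 1 - X 2 * (1 + X 0) * QA
    - X 2 * (1 + X 1) ^ 2 * QB + X 2 * QC := by
  unfold NN
  linear_combination FE_aux

theorem QA_dec : ∃ A1 : PS, QA = QC + X 0 * A1 ∧ A1 ∈ noVar 1 := by
  obtain ⟨g, h, h1, h2, h3, h4⟩ := decomp 0 QA
  have : g = QC := by
    have hd : X 0 ∣ g - QC := by
      have e : g - QC = (QA - QC) - X 0 * h := by rw [h1]; ring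
      rw [e]
      apply dvd_sub _ (dvd_mul_right _ _)
      rw [X_dvd_iff]
      intro m hm
      rw [map_sub]
      change (if m 1 = 0 then QW m else 0) - (if m 0 = 0 ∧ m 1 = 0 then QW m else 0) = 0
      simp [hm]
    exact sub_eq_zero.mp (eq_zero_of_dvd (sub_mem h2 QC_mem0) hd)
  exact ⟨h, by rw [← this]; exact h1, h4 1 (by decide) QA_mem⟩

theorem QB_dec : ∃ b B2 : PS, QB = QC + X 1 * b + X 1 ^ 2 * B2 ∧ b ∈ noVar 0 ∧ b ∈ noVar 1 ∧
    B2 ∈ noVar 0 := by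
  obtain ⟨g, h, h1, h2, h3, h4⟩ := decomp 1 QB
  have : g = QC := by
    have hd : X 1 ∣ g - QC := by
      have e : g - QC = (QB - QC) - X 1 * h := by rw [h1]; ring
      rw [e]
      apply dvd_sub _ (dvd_mul_right _ _)
      rw [X_dvd_iff]
      intro m hm
      rw [map_sub]
      change (if m 0 = 0 then QW m else 0) - (if m 0 = 0 ∧ m 1 = 0 then QW m else 0) = 0
      simp [hm]
    exact sub_eq_zero.mp (eq_zero_of_dvd (sub_mem h2 QC_mem1) hd)
  have hh := h4 0 (by decide) QB_mem
  obtain ⟨g', h', h1', h2', h3', h4'⟩ := decomp 1 h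
  exact ⟨g', h', by rw [h1, h1', this]; ring, h3' 0 hh, h2', h4' 0 (by decide) hh⟩

end WM


namespace WM
open MvPowerSeries

/-- numerator of the invariant in `x` -/
def ii {R : Type*} [CommRing R] (x t : R) : R :=
  t * (1 + x) * (x ^ 2 + 1) * (x - t * (x ^ 2 + 2)) + (x - t * (x ^ 2 + 2)) ^ 2
    - 2 * t ^ 2 * (1 + x) ^ 3 + t * (1 + x) * (1 + 3 * t)

/-- numerator of the invariant in `y` -/
def jj {R : Type*} [CommRing R] (y t : R) : R :=
  t * (1 + y) * (1 + y ^ 2) * (y - t * (1 + 2 * y ^ 2)) + y * (y - t * (1 + 2 * y ^ 2)) ^ 2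
    - 2 * t ^ 2 * y ^ 2 * (1 + y) ^ 3 + t * y ^ 4 * (1 + y) * (1 + 3 * t)

/-- cofactor of the kernel in the invariant identity -/
def hh {R : Type*} [CommRing R] (x y t : R) : R :=
  y * (x - y) * (1 - x * y) + t * (-3 * y ^ 2 - x + 2 * x * y + 3 * x * y ^ 3 - x ^ 2
    - 2 * x ^ 2 * y ^ 2 + x ^ 3 * y + x ^ 3 * y ^ 2)

theorem inv_id {R : Type*} [CommRing R] (x y t : R) :
    y ^ 2 * (1 + y) ^ 2 * ii x t - x * (1 + x) ^ 2 * jj y t =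
      (x * y - t * (y ^ 2 * (1 + x) ^ 2 + y * (2 + x ^ 2) + 1 + x)) * hh x y t := by
  unfold ii jj hh; ring

/-- quotient on the `y` side -/
def ll {R : Type*} [CommRing R] (y t v1 v3 : R) : R :=
  1 + 6*t + (-1)*t*v1 + 9*t^2 + 2*t^2*v3 + (-2)*t^2*v1 + y*t + (-1)*y*t*v3 + (-2)*y*t*v1
  + 3*y*t^2 + 2*y*t^2*v3 + (-4)*y*t^2*v1 + y*t^2*v1^2 + y^2*t + (-2)*y^2*t*v3 + (-1)*y^2*t*v1
  + 3*y^2*t^2 + (-2)*y^2*t^2*v3 + (-2)*y^2*t^2*v1 + 2*y^2*t^2*v1*v3 + 2*y^2*t^2*v1^2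
  + (-1)*y^3*t*v3 + (-2)*y^3*t^2*v3 + y^3*t^2*v3^2 + 4*y^3*t^2*v1*v3 + y^3*t^2*v1^2
  + 2*y^4*t^2*v3^2 + 2*y^4*t^2*v1*v3 + y^5*t^2*v3^2

theorem ll_id {R : Type*} [CommRing R] (y t v1 v3 : R) :
    jj y t + (1 + y) ^ 2 * ((t * (1 + y ^ 2 * v1 + y ^ 3 * v3)) ^ 2
      + (-(1 + 2 * t)) * y * (t * (1 + y ^ 2 * v1 + y ^ 3 * v3))
      + (8 * t ^ 2 + 3 * t - 2 * t ^ 2 * v1) * y ^ 2) = y ^ 3 * ll y t v1 v3 := by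
  unfold jj ll; ring

theorem main_id {R : Type*} [CommRing R] (x y u w k M a b d i j h : R)
    (h1 : y * u - (1 + x) * w = k * M)
    (h2 : y ^ 2 * (1 + y) ^ 2 * i - x * (1 + x) ^ 2 * j = k * h) :
    y ^ 3 * (1 + y) ^ 2 * ((i + x * (u ^ 2 + a * (1 + x) * u + b * (1 + x) ^ 2)) * (u - d * (1 + x)))
     - x * (1 + x) ^ 3 * ((j + (1 + y) ^ 2 * (w ^ 2 + a * y * w + b * y ^ 2)) * (w - d * y))
     = k * (h * y * (u - d * (1 + x)) + M * x * ((1 + x) ^ 2 * j + (1 + y) ^ 2 * (y ^ 2 * u ^ 2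
        + y * (1 + x) * u * w + (1 + x) ^ 2 * w ^ 2 + (a - d) * y * (1 + x) * (y * u + (1 + x) * w)
        + (b - a * d) * y ^ 2 * (1 + x) ^ 2))) := by
  linear_combination (y * (u - d * (1 + x))) * h2 + (x * ((1 + x) ^ 2 * j + (1 + y) ^ 2 * (y ^ 2 * u ^ 2
        + y * (1 + x) * u * w + (1 + x) ^ 2 * w ^ 2 + (a - d) * y * (1 + x) * (y * u + (1 + x) * w)
        + (b - a * d) * y ^ 2 * (1 + x) ^ 2))) * h1

theorem ker_X1 (G : PS) (h : X 1 ∣ (X 0 * X 1 - X 2 * NN) * G) : X 1 ∣ G := by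
  rcases X_dvd_mul h with h | h
  · exfalso
    have h1 : X 1 ∣ (X 2 * (1 + X 0) : PS) := by
      have : (X 2 * (1 + X 0) : PS) = X 1 * (X 0 - X 2 * (X 1 * (1 + X 0) ^ 2 + (2 + X 0 ^ 2)))
        - (X 0 * X 1 - X 2 * NN) := by unfold NN; ring
      rw [this]; exact dvd_sub (dvd_mul_right _ _) h
    have h2 := eq_zero_of_dvd (mul_mem (X_mem_noVar (by decide)) (add_mem (one_mem _)
      (X_mem_noVar (by decide)))) h1
    rcases mul_eq_zero.mp h2 with h3 | h3
    · exact X_ne_zero' _ h3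
    · exact ne_zero_of_cc (by simp) h3
  · exact h

theorem ker_X0 (G : PS) (h : X 0 ∣ (X 0 * X 1 - X 2 * NN) * G) : X 0 ∣ G := by
  rcases X_dvd_mul h with h | h
  · exfalso
    have h1 : X 0 ∣ (X 2 * (1 + X 1) ^ 2 : PS) := by
      have : (X 2 * (1 + X 1) ^ 2 : PS) = X 0 * (X 1 - X 2 * (X 1 ^ 2 * (2 + X 0) + X 0 * X 1 + 1))
        - (X 0 * X 1 - X 2 * NN) := by unfold NN; ring
      rw [this]; exact dvd_sub (dvd_mul_right _ _) h
    have h2 := eq_zero_of_dvd (mul_mem (X_mem_noVar (by decide)) (pow_mem (add_mem (one_mem _)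
      (X_mem_noVar (by decide))) 2)) h1
    rcases mul_eq_zero.mp h2 with h3 | h3
    · exact X_ne_zero' _ h3
    · exact ne_zero_of_cc (f := (1 + X 1) ^ 2) (by simp) h3
  · exact h

theorem ker_cancel {F G : PS} (h : X 0 * X 1 ^ 3 * F = (X 0 * X 1 - X 2 * NN) * G) :
    ∃ H, F = (X 0 * X 1 - X 2 * NN) * H := by
  have c1 : ∀ {F G : PS}, X 1 * F = (X 0 * X 1 - X 2 * NN) * G →
      ∃ H, F = (X 0 * X 1 - X 2 * NN) * H := by
    intro F G h
    obtain ⟨H, rfl⟩ := ker_X1 G ⟨F, h.symm⟩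
    exact ⟨H, mul_left_cancel₀ (X_ne_zero' 1) (by rw [h]; ring)⟩
  have c0 : ∀ {F G : PS}, X 0 * F = (X 0 * X 1 - X 2 * NN) * G →
      ∃ H, F = (X 0 * X 1 - X 2 * NN) * H := by
    intro F G h
    obtain ⟨H, rfl⟩ := ker_X0 G ⟨F, h.symm⟩
    exact ⟨H, mul_left_cancel₀ (X_ne_zero' 0) (by rw [h]; ring)⟩
  obtain ⟨G1, h1⟩ := c0 (F := X 1 ^ 3 * F) (G := G) (by rw [← h]; ring)
  obtain ⟨G2, h2⟩ := c1 (F := X 1 ^ 2 * F) (G := G1) (by rw [← h1]; ring)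
  obtain ⟨G3, h3⟩ := c1 (F := X 1 * F) (G := G2) (by rw [← h2]; ring)
  exact c1 h3

theorem catalytic : ∃ u v b d c r : PS, ∃ v' : PS,
    u ∈ noVar 1 ∧ v ∈ noVar 0 ∧ b ∈ noVar 0 ∧ b ∈ noVar 1 ∧ d ∈ noVar 0 ∧ d ∈ noVar 1 ∧
    c ∈ noVar 0 ∧ c ∈ noVar 1 ∧
    u = X 0 - X 2 * r ∧ v = 1 + X 1 * v' ∧
    X 1 * u - X 2 * (1 + X 0) * v =
      (X 0 * X 1 - X 2 * NN) * (X 2 * (1 + X 0) * X 1 * QW + 1) ∧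
    (ii (X 0) (X 2) + X 0 * (u ^ 2 + (-(1 + 2 * X 2)) * (1 + X 0) * u + b * (1 + X 0) ^ 2))
      * (u - d * (1 + X 0)) = c * X 0 * (1 + X 0) ^ 3 ∧
    (jj (X 1) (X 2) + (1 + X 1) ^ 2 * ((X 2 * v) ^ 2 + (-(1 + 2 * X 2)) * X 1 * (X 2 * v)
      + b * X 1 ^ 2)) * (X 2 * v - d * X 1) = c * X 1 ^ 3 * (1 + X 1) ^ 2 := by
  obtain ⟨A1, hA, hA1⟩ := QA_dec
  obtain ⟨b0, B2, hB, hb0, hb1, hB2⟩ := QB_dec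
  have x1 : (X 0 : PS) ∈ noVar 1 := X_mem_noVar (by decide)
  have t1 : (X 2 : PS) ∈ noVar 1 := X_mem_noVar (by decide)
  have y0 : (X 1 : PS) ∈ noVar 0 := X_mem_noVar (by decide)
  have t0 : (X 2 : PS) ∈ noVar 0 := X_mem_noVar (by decide)
  have n0 : ∀ n : ℕ, [n.AtLeastTwo] → (OfNat.ofNat n : PS) ∈ noVar 0 := fun n _ => ofNat_mem _ n
  have n1 : ∀ n : ℕ, [n.AtLeastTwo] → (OfNat.ofNat n : PS) ∈ noVar 1 := fun n _ => ofNat_mem _ n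
  have o0 : (1 : PS) ∈ noVar 0 := one_mem _
  have o1 : (1 : PS) ∈ noVar 1 := one_mem _
  have c0 := QC_mem0
  have c1 := QC_mem1
  have mA := QA_mem
  have mB := QB_mem
  set v1 : PS := 1 + X 2 * (2 * QC + b0) with hv1
  have v10 : v1 ∈ noVar 0 := add_mem o0 (mul_mem t0 (add_mem (mul_mem (n0 2) c0) hb0))
  have v11 : v1 ∈ noVar 1 := add_mem o1 (mul_mem t1 (add_mem (mul_mem (n1 2) c1) hb1))
  set v3 : PS := X 2 * (QC + 2 * b0 + X 1 * b0 + (1 + X 1) ^ 2 * B2) with hv3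
  have v30 : v3 ∈ noVar 0 := mul_mem t0 (add_mem (add_mem (add_mem c0 (mul_mem (n0 2) hb0))
    (mul_mem y0 hb0)) (mul_mem (pow_mem (add_mem o0 y0) 2) hB2))
  set v : PS := 1 + X 1 ^ 2 * v1 + X 1 ^ 3 * v3 with hv
  have v0 : v ∈ noVar 0 := add_mem (add_mem o0 (mul_mem (pow_mem y0 2) v10))
    (mul_mem (pow_mem y0 3) v30)
  have hvB : v = X 2 * X 1 * (1 + X 1) ^ 2 * QB + X 1 ^ 2 + 1 - X 2 * QC * X 1 := by
    rw [hv, hv1, hv3, hB]; ring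
  set r : PS := X 0 ^ 2 + 2 + X 2 * (1 + X 0) ^ 2 * QA with hr
  set u : PS := X 0 - X 2 * r with hu
  have r1 : r ∈ noVar 1 := add_mem (add_mem (pow_mem x1 2) (n1 2))
    (mul_mem (mul_mem t1 (pow_mem (add_mem o1 x1) 2)) mA)
  have u1 : u ∈ noVar 1 := sub_mem x1 (mul_mem t1 r1)
  set b : PS := 8 * X 2 ^ 2 + 3 * X 2 - 2 * X 2 ^ 2 * v1 with hb
  have b0' : b ∈ noVar 0 := sub_mem (add_mem (mul_mem (n0 8) (pow_mem t0 2)) (mul_mem (n0 3) t0))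
    (mul_mem (mul_mem (n0 2) (pow_mem t0 2)) v10)
  have b1' : b ∈ noVar 1 := sub_mem (add_mem (mul_mem (n1 8) (pow_mem t1 2)) (mul_mem (n1 3) t1))
    (mul_mem (mul_mem (n1 2) (pow_mem t1 2)) v11)
  set d : PS := - (X 2 * (2 + X 2 * QC)) with hd
  have d0 : d ∈ noVar 0 := neg_mem (mul_mem t0 (add_mem (n0 2) (mul_mem t0 c0)))
  have d1 : d ∈ noVar 1 := neg_mem (mul_mem t1 (add_mem (n1 2) (mul_mem t1 c1)))
  have hrel : X 1 * u - X 2 * (1 + X 0) * v =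
      (X 0 * X 1 - X 2 * NN) * (X 2 * (1 + X 0) * X 1 * QW + 1) := by
    have hFE := FE
    unfold NN at hFE ⊢
    rw [hvB, hu, hr]
    linear_combination (-(X 2 * (1 + X 0) * X 1)) * hFE
  -- the `x` side
  set m : PS := 1 - X 2 * X 0 + X 2 * 2 + X 2 ^ 2 * QC
    - X 2 ^ 2 * (QC * (2 + X 0) + (1 + X 0) ^ 2 * A1) with hm
  have hum : u - d * (1 + X 0) = X 0 * m := by
    rw [hu, hr, hd, hm, hA]; ring
  have m1 : m ∈ noVar 1 := by
    rw [hm]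
    exact sub_mem (add_mem (add_mem (sub_mem o1 (mul_mem t1 x1)) (mul_mem t1 (n1 2)))
      (mul_mem (pow_mem t1 2) c1)) (mul_mem (pow_mem t1 2) (add_mem (mul_mem c1 (add_mem (n1 2) x1))
      (mul_mem (pow_mem (add_mem o1 x1) 2) hA1)))
  have i1 : ii (X 0) (X 2) ∈ noVar 1 := by
    unfold ii
    have q1 : (1 + X 0 : PS) ∈ noVar 1 := add_mem o1 x1
    have q2 : (X 0 - X 2 * (X 0 ^ 2 + 2) : PS) ∈ noVar 1 :=
      sub_mem x1 (mul_mem t1 (add_mem (pow_mem x1 2) (n1 2)))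
    exact add_mem (sub_mem (add_mem (mul_mem (mul_mem (mul_mem t1 q1) (add_mem (pow_mem x1 2) o1)) q2)
      (pow_mem q2 2)) (mul_mem (mul_mem (n1 2) (pow_mem t1 2)) (pow_mem q1 3)))
      (mul_mem (mul_mem t1 q1) (add_mem o1 (mul_mem (n1 3) t1)))
  set f : PS := (ii (X 0) (X 2) + X 0 * (u ^ 2 + (-(1 + 2 * X 2)) * (1 + X 0) * u
    + b * (1 + X 0) ^ 2)) * m with hf
  have f1 : f ∈ noVar 1 := by
    have q1 : (1 + X 0 : PS) ∈ noVar 1 := add_mem o1 x1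
    exact mul_mem (add_mem i1 (mul_mem x1 (add_mem (add_mem (pow_mem u1 2)
      (mul_mem (mul_mem (neg_mem (add_mem o1 (mul_mem (n1 2) t1))) q1) u1))
      (mul_mem b1' (pow_mem q1 2))))) m1
  have l0 : ll (X 1) (X 2) v1 v3 ∈ noVar 0 := by
    have e := ll_id (X 1 : PS) (X 2) v1 v3
    have hj : (jj (X 1) (X 2) : PS) ∈ noVar 0 := by
      unfold jj
      have q1 : (1 + X 1 : PS) ∈ noVar 0 := add_mem o0 y0
      have q2 : (X 1 - X 2 * (1 + 2 * X 1 ^ 2) : PS) ∈ noVar 0 :=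
        sub_mem y0 (mul_mem t0 (add_mem o0 (mul_mem (n0 2) (pow_mem y0 2))))
      exact add_mem (sub_mem (add_mem (mul_mem (mul_mem (mul_mem t0 q1) (add_mem o0 (pow_mem y0 2))) q2)
        (mul_mem y0 (pow_mem q2 2))) (mul_mem (mul_mem (mul_mem (n0 2) (pow_mem t0 2)) (pow_mem y0 2))
        (pow_mem q1 3))) (mul_mem (mul_mem (mul_mem t0 (pow_mem y0 4)) q1)
        (add_mem o0 (mul_mem (n0 3) t0)))
    have hL : X 1 ^ 3 * ll (X 1) (X 2) v1 v3 ∈ noVar 0 := by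
      rw [← e, ← hv, ← hb]
      have q1 : (1 + X 1 : PS) ∈ noVar 0 := add_mem o0 y0
      exact add_mem hj (mul_mem (pow_mem q1 2) (add_mem (add_mem (pow_mem (mul_mem t0 v0) 2)
        (mul_mem (mul_mem (neg_mem (add_mem o0 (mul_mem (n0 2) t0))) y0) (mul_mem t0 v0)))
        (mul_mem b0' (pow_mem y0 2))))
    intro e' he'
    have := hL (Finsupp.single 1 3 + e') (by simpa using he')
    rwa [X_pow_eq, coeff_add_monomial_mul, one_mul] at this
  set g : PS := ll (X 1) (X 2) v1 v3 * (X 2 * v - d * X 1) with hg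
  have g0 : g ∈ noVar 0 := mul_mem l0 (sub_mem (mul_mem t0 v0) (mul_mem d0 y0))
  have hmain := main_id (X 0 : PS) (X 1) u (X 2 * v) (X 0 * X 1 - X 2 * NN)
    (X 2 * (1 + X 0) * X 1 * QW + 1) (-(1 + 2 * X 2)) b d (ii (X 0) (X 2)) (jj (X 1) (X 2))
    (hh (X 0) (X 1) (X 2)) (by rw [← hrel]; ring) (inv_id _ _ _)
  have hll := ll_id (X 1 : PS) (X 2) v1 v3
  rw [← hv, ← hb] at hll
  rw [hll, hum] at hmain
  obtain ⟨H, hH⟩ := ker_cancel (F := (1 + X 1) ^ 2 * f - (1 + X 0) ^ 3 * g) (by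
    rw [← hmain, hf, hg]; ring)
  obtain ⟨ax, hax⟩ := exists_inv (f := (1 + X 0 : PS)) (by simp)
  obtain ⟨ay, hay⟩ := exists_inv (f := (1 + X 1 : PS)) (by simp)
  have ax1 : ax ∈ noVar 1 := inv_mem_noVar (add_mem o1 x1) hax
  have ay0 : ay ∈ noVar 0 := inv_mem_noVar (add_mem o0 y0) hay
  have e1 : ((1 + X 0) * ax) ^ 3 = (1 : PS) := by rw [hax, one_pow]
  have e2 : ((1 + X 1) * ay) ^ 2 = (1 : PS) := by rw [hay, one_pow]
  have hfg : f * ax ^ 3 - g * ay ^ 2 = (X 0 * X 1 - X 2 * NN) * (H * ax ^ 3 * ay ^ 2) := by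
    linear_combination (ax ^ 3 * ay ^ 2) * hH - (f * ax ^ 3) * e2 + (g * ay ^ 2) * e1
  have hz := inv_lemma (mul_mem f1 (pow_mem ax1 3)) (mul_mem g0 (pow_mem ay0 2)) hfg
  rw [hz, mul_zero, sub_eq_zero] at hfg
  refine ⟨u, v, b, d, f * ax ^ 3, r, X 1 * v1 + X 1 ^ 2 * v3, u1, v0, b0', b1', d0, d1, ?_, ?_, rfl,
    by rw [hv]; ring, hrel, ?_, ?_⟩
  · rw [hfg]; exact mul_mem g0 (pow_mem ay0 2)
  · exact mul_mem f1 (pow_mem ax1 3)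
  · rw [hum]
    linear_combination X 0 * hf.symm - (X 0 * f) * e1
  · rw [hll, hfg]
    linear_combination X 1 ^ 3 * hg.symm - (X 1 ^ 3 * g) * e2

end WM


namespace WM
open MvPowerSeries

/-- homogeneous cubic -/
def cub {R : Type*} [CommRing R] (a B c W D : R) : R :=
  W ^ 3 + a * W ^ 2 * D + B * W * D ^ 2 - c * D ^ 3

/-- its discriminant -/
def dsc {R : Type*} [CommRing R] (a B c : R) : R :=
  -4 * B ^ 3 + a ^ 2 * B ^ 2 - 18 * a * c * B + 4 * a ^ 3 * c - 27 * c ^ 2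

theorem dsc_id {R : Type*} [CommRing R] (a B c W D : R)
    (h0 : cub a B c W D = 0) (h1 : 3 * W ^ 2 + 2 * a * W * D + B * D ^ 2 = 0) :
    9 * (D ^ 4 * dsc a B c) = 0 := by
  unfold cub at h0
  unfold dsc
  linear_combination (-(6 * B - 2 * a ^ 2) ^ 2 * D ^ 2
    - (3 * W + a * D) * (3 * (6 * B - 2 * a ^ 2) * W - 3 * (-9 * c - a * B) * D
      + 2 * a * (6 * B - 2 * a ^ 2) * D)) * h1
    + 9 * (3 * (6 * B - 2 * a ^ 2) * W - 3 * (-9 * c - a * B) * D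
      + 2 * a * (6 * B - 2 * a ^ 2) * D) * h0

theorem cub_expand {R : Type*} [CommRing R] (a B c W0 W1 W2 D0 D1 e : R) :
    cub a B c (W0 + e * W1 + e ^ 2 * W2) (D0 + e * D1) = cub a B c W0 D0
     + e * (W1 * (3 * W0 ^ 2 + 2 * a * W0 * D0 + B * D0 ^ 2)
        + D1 * (a * W0 ^ 2 + 2 * B * W0 * D0 - 3 * c * D0 ^ 2))
     + e ^ 2 * (W2 * (3 * W0 ^ 2 + 2 * a * W0 * D0 + B * D0 ^ 2)
        + (W0 * (3 * (W1 + e * W2) ^ 2 + 2 * a * (W1 + e * W2) * D1 + B * D1 ^ 2)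
        + D0 * (a * (W1 + e * W2) ^ 2 + 2 * B * (W1 + e * W2) * D1 - 3 * c * D1 ^ 2))
        + e * cub a B c (W1 + e * W2) D1) := by
  unfold cub; ring

theorem dsc_zero {a B c W0 W1 W2 D0 D1 : PS} (ha : a ∈ noVar 0) (hB : B ∈ noVar 0)
    (hc : c ∈ noVar 0) (hW0 : W0 ∈ noVar 0) (hW1 : W1 ∈ noVar 0) (hD0 : D0 ∈ noVar 0)
    (hD1 : D1 ∈ noVar 0)
    (h : X 0 ^ 2 ∣ cub a B c (W0 + X 0 * W1 + X 0 ^ 2 * W2) (D0 + X 0 * D1))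
    (hD : D0 ≠ 0) (hw : W1 * D0 - W0 * D1 ≠ 0) : dsc a B c = 0 := by
  obtain ⟨G, hG⟩ := h
  rw [cub_expand] at hG
  have n0 : ∀ n : ℕ, [n.AtLeastTwo] → (OfNat.ofNat n : PS) ∈ noVar 0 := fun n _ => ofNat_mem _ n
  have hp : cub a B c W0 D0 = 0 := by
    apply eq_zero_of_dvd (i := 0)
    · unfold cub
      exact sub_mem (add_mem (add_mem (pow_mem hW0 3) (mul_mem (mul_mem ha (pow_mem hW0 2)) hD0))
        (mul_mem (mul_mem hB hW0) (pow_mem hD0 2))) (mul_mem hc (pow_mem hD0 3))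
    · exact ⟨X 0 * G - (W1 * (3 * W0 ^ 2 + 2 * a * W0 * D0 + B * D0 ^ 2)
        + D1 * (a * W0 ^ 2 + 2 * B * W0 * D0 - 3 * c * D0 ^ 2))
       - X 0 * (W2 * (3 * W0 ^ 2 + 2 * a * W0 * D0 + B * D0 ^ 2)
        + (W0 * (3 * (W1 + X 0 * W2) ^ 2 + 2 * a * (W1 + X 0 * W2) * D1 + B * D1 ^ 2)
        + D0 * (a * (W1 + X 0 * W2) ^ 2 + 2 * B * (W1 + X 0 * W2) * D1 - 3 * c * D1 ^ 2))
        + X 0 * cub a B c (W1 + X 0 * W2) D1), by linear_combination hG⟩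
  rw [hp, zero_add] at hG
  set pW : PS := 3 * W0 ^ 2 + 2 * a * W0 * D0 + B * D0 ^ 2 with hpW
  set pD : PS := a * W0 ^ 2 + 2 * B * W0 * D0 - 3 * c * D0 ^ 2 with hpD
  have mW : pW ∈ noVar 0 := add_mem (add_mem (mul_mem (n0 3) (pow_mem hW0 2))
    (mul_mem (mul_mem (mul_mem (n0 2) ha) hW0) hD0)) (mul_mem hB (pow_mem hD0 2))
  have mD : pD ∈ noVar 0 := sub_mem (add_mem (mul_mem ha (pow_mem hW0 2))
    (mul_mem (mul_mem (mul_mem (n0 2) hB) hW0) hD0)) (mul_mem (mul_mem (n0 3) hc) (pow_mem hD0 2))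
  have h1 : W1 * pW + D1 * pD = 0 := by
    apply eq_zero_of_dvd (i := 0) (add_mem (mul_mem hW1 mW) (mul_mem hD1 mD))
    refine ⟨G - (W2 * pW
        + (W0 * (3 * (W1 + X 0 * W2) ^ 2 + 2 * a * (W1 + X 0 * W2) * D1 + B * D1 ^ 2)
        + D0 * (a * (W1 + X 0 * W2) ^ 2 + 2 * B * (W1 + X 0 * W2) * D1 - 3 * c * D1 ^ 2))
        + X 0 * cub a B c (W1 + X 0 * W2) D1), ?_⟩
    apply mul_left_cancel₀ (X_ne_zero' 0)
    linear_combination hG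
  have h2 : (W1 * D0 - W0 * D1) * pW = 0 := by
    unfold cub at hp
    rw [hpW, hpD] at h1
    rw [hpW]
    linear_combination D0 * h1 - 3 * D1 * hp
  have h3 := (mul_eq_zero.mp h2).resolve_left hw
  have h4 := dsc_id a B c W0 D0 hp h3
  rcases mul_eq_zero.mp h4 with h5 | h5
  · exact absurd h5 (ne_zero_of_cc (by rw [map_ofNat]; norm_num))
  · exact (mul_eq_zero.mp h5).resolve_left (pow_ne_zero _ hD)

theorem sq_dvd_cancel {f g : PS} (hf : ¬ X 0 ∣ f) (h : X 0 ^ 2 ∣ f * g) : X 0 ^ 2 ∣ g := by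
  obtain ⟨g1, rfl⟩ := (X_dvd_mul (dvd_trans (dvd_pow_self _ two_ne_zero) h)).resolve_left hf
  obtain ⟨k, hk⟩ := h
  have h2 : X 0 ∣ f * g1 := ⟨k, mul_left_cancel₀ (X_ne_zero' 0) (by linear_combination hk)⟩
  obtain ⟨g2, rfl⟩ := (X_dvd_mul h2).resolve_left hf
  exact ⟨g2, by ring⟩

theorem not_dvd_of_cc {f : PS} (hf : constantCoeff f ≠ 0) : ¬ X 0 ∣ f := by
  rintro ⟨g, rfl⟩
  simp at hf

/-- the discriminant factor in `x` -/
def dx {R : Type*} [CommRing R] (x : R) : R := 1 + 4 * x + 2 * x ^ 2 + 2 * x ^ 3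

/-- the discriminant factor in `y` -/
def ey {R : Type*} [CommRing R] (y : R) : R := 2 + 2 * y + 4 * y ^ 2 + y ^ 3

/-- numerator of the critical value in `x` -/
def kx {R : Type*} [CommRing R] (x : R) : R :=
  x * (x ^ 5 + 2 * x ^ 4 + 2 * x ^ 3 + 4 * x ^ 2 + 6 * x + 2)

/-- numerator of the critical value in `y` -/
def ky {R : Type*} [CommRing R] (y : R) : R :=
  1 + 2 * y + 2 * y ^ 2 + 4 * y ^ 3 + 6 * y ^ 4 + 2 * y ^ 5

theorem ii_crit {R : Type*} [CommRing R] (x z t k : R) (h : z ^ 2 = t * dx z)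
    (hk : k * dx z ^ 2 = kx z) :
    dx z ^ 2 * (ii x t - k * x * (1 + x) ^ 2)
      = - (x - z) ^ 2 * (z * x - 1 - z) ^ 2 * (z ^ 2 * x - 1 - 2 * z) := by
  have e : dx z ^ 2 * ii x t = (-(1 + x) * (x ^ 2 + 1) * (x ^ 2 + 2) + (x ^ 2 + 2) ^ 2
      - 2 * (1 + x) ^ 3 + 3 * (1 + x)) * (t * dx z) ^ 2
      + ((1 + x) * (x ^ 2 + 1) * x - 2 * x * (x ^ 2 + 2) + (1 + x)) * dx z * (t * dx z)
      + x ^ 2 * dx z ^ 2 := by unfold ii; ring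
  rw [mul_sub, e, ← h]
  have e2 : dx z ^ 2 * (k * x * (1 + x) ^ 2) = (k * dx z ^ 2) * (x * (1 + x) ^ 2) := by ring
  rw [e2, hk]
  unfold kx dx
  ring

theorem jj_crit {R : Type*} [CommRing R] (y z t k : R) (h : z = t * ey z)
    (hk : k * ey z ^ 2 = ky z) :
    ey z ^ 2 * (jj y t - k * y ^ 2 * (1 + y) ^ 2)
      = - (y - z) ^ 2 * (1 - y * z - y) ^ 2 * (1 - z ^ 2 * y - 2 * z * y) := by
  have e : ey z ^ 2 * jj y t = (-(1 + y) * (1 + y ^ 2) * (1 + 2 * y ^ 2) + y * (1 + 2 * y ^ 2) ^ 2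
      - 2 * y ^ 2 * (1 + y) ^ 3 + 3 * y ^ 4 * (1 + y)) * (t * ey z) ^ 2
      + ((1 + y) * (1 + y ^ 2) * y - 2 * y ^ 2 * (1 + 2 * y ^ 2) + y ^ 4 * (1 + y)) * ey z * (t * ey z)
      + y ^ 3 * ey z ^ 2 := by unfold jj; ring
  rw [mul_sub, e, ← h]
  have e2 : ey z ^ 2 * (k * y ^ 2 * (1 + y) ^ 2) = (k * ey z ^ 2) * (y ^ 2 * (1 + y) ^ 2) := by ring
  rw [e2, hk]
  unfold ky ey
  ring

theorem xcase {z t k U r b d c : PS} (mz : z ∈ noVar 0) (mt : t ∈ noVar 0) (mk : k ∈ noVar 0)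
    (mb : b ∈ noVar 0) (md : d ∈ noVar 0) (mc : c ∈ noVar 0) (hz : z ≠ 0)
    (cz : constantCoeff z = 0) (ct : constantCoeff t = 0)
    (h : z ^ 2 = t * dx z) (hk : k * dx z ^ 2 = kx z)
    (hU : U = (z + X 0) - t * r)
    (hE : (ii (z + X 0) t + (z + X 0) * (U ^ 2 + (-(1 + 2 * t)) * (1 + (z + X 0)) * U
      + b * (1 + (z + X 0)) ^ 2)) * (U - d * (1 + (z + X 0)))
        = c * (z + X 0) * (1 + (z + X 0)) ^ 3) :
    dsc (-(1 + 2 * t) + 2 * d) (k + d ^ 2 + (-(1 + 2 * t)) * d + b) c = 0 := by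
  have n0 : ∀ n : ℕ, [n.AtLeastTwo] → (OfNat.ofNat n : PS) ∈ noVar 0 := fun n _ => ofNat_mem _ n
  have o0 : (1 : PS) ∈ noVar 0 := one_mem _
  obtain ⟨r0, r', hr, mr0, -, -⟩ := decomp 0 r
  obtain ⟨r1, r2, hr', mr1, -, -⟩ := decomp 0 r'
  have ma : -(1 + 2 * t) ∈ noVar 0 := neg_mem (add_mem o0 (mul_mem (n0 2) mt))
  refine dsc_zero (W0 := z - t * r0 - d * (1 + z)) (W1 := 1 - t * r1 - d) (W2 := - t * r2)
    (D0 := 1 + z) (D1 := 1) (add_mem ma (mul_mem (n0 2) md))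
    (add_mem (add_mem (add_mem mk (pow_mem md 2)) (mul_mem ma md)) mb) mc
    (sub_mem (sub_mem mz (mul_mem mt mr0)) (mul_mem md (add_mem o0 mz)))
    (sub_mem (sub_mem o0 (mul_mem mt mr1)) md) (add_mem o0 mz) o0 ?_
    (ne_zero_of_cc (by simp [cz])) (ne_zero_of_cc (by simp [cz, ct]))
  have eW : z - t * r0 - d * (1 + z) + X 0 * (1 - t * r1 - d) + X 0 ^ 2 * (- t * r2)
      = U - d * (1 + (z + X 0)) := by rw [hU, hr, hr']; ring
  have eD : 1 + z + X 0 * 1 = 1 + (z + X 0) := by ring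
  rw [eW, eD]
  have hcrit := ii_crit (z + X 0) z t k h hk
  set x : PS := z + X 0 with hx
  have hnx : ¬ X 0 ∣ x := by
    intro hd
    apply hz
    apply eq_zero_of_dvd mz
    have : z = x - X 0 := by rw [hx]; ring
    rw [this]; exact dvd_sub hd dvd_rfl
  have hnd : ¬ X 0 ∣ dx z ^ 2 := not_dvd_of_cc (by simp [dx, cz])
  apply sq_dvd_cancel hnd
  apply sq_dvd_cancel hnx
  refine ⟨(z * x - 1 - z) ^ 2 * (z ^ 2 * x - 1 - 2 * z) * (U - d * (1 + x)), ?_⟩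
  have hxz : x - z = X 0 := by rw [hx]; ring
  rw [hxz] at hcrit
  unfold cub
  linear_combination (dx z ^ 2) * hE - (U - d * (1 + x)) * hcrit

theorem ycase {z t k V b d c : PS} (mz : z ∈ noVar 0) (mt : t ∈ noVar 0) (mk : k ∈ noVar 0)
    (mb : b ∈ noVar 0) (md : d ∈ noVar 0) (mc : c ∈ noVar 0) (hz : z ≠ 0) (ht : t ≠ 0)
    (cz : constantCoeff z = 0)
    (h : z = t * ey z) (hk : k * ey z ^ 2 = ky z)
    (hV : constantCoeff V = 1)
    (hE : (jj (z + X 0) t + (1 + (z + X 0)) ^ 2 * ((t * V) ^ 2 + (-(1 + 2 * t)) * (z + X 0) * (t * V)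
      + b * (z + X 0) ^ 2)) * (t * V - d * (z + X 0)) = c * (z + X 0) ^ 3 * (1 + (z + X 0)) ^ 2) :
    dsc (-(1 + 2 * t) + 2 * d) (k + d ^ 2 + (-(1 + 2 * t)) * d + b) c = 0 := by
  have n0 : ∀ n : ℕ, [n.AtLeastTwo] → (OfNat.ofNat n : PS) ∈ noVar 0 := fun n _ => ofNat_mem _ n
  have o0 : (1 : PS) ∈ noVar 0 := one_mem _
  obtain ⟨r0, r', hr, mr0, -, -⟩ := decomp 0 V
  obtain ⟨r1, r2, hr', mr1, -, -⟩ := decomp 0 r'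
  have ma : -(1 + 2 * t) ∈ noVar 0 := neg_mem (add_mem o0 (mul_mem (n0 2) mt))
  have cr0 : constantCoeff r0 = 1 := by rw [hr] at hV; simpa using hV
  have hw : (t * r1 - d) * z - (t * r0 - d * z) * 1 ≠ 0 := by
    have : (t * r1 - d) * z - (t * r0 - d * z) * 1 = t * (r1 * z - r0) := by ring
    rw [this]
    exact mul_ne_zero ht (ne_zero_of_cc (by simp [cz, cr0]))
  refine dsc_zero (W0 := t * r0 - d * z) (W1 := t * r1 - d) (W2 := t * r2)
    (D0 := z) (D1 := 1) (add_mem ma (mul_mem (n0 2) md))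
    (add_mem (add_mem (add_mem mk (pow_mem md 2)) (mul_mem ma md)) mb) mc
    (sub_mem (mul_mem mt mr0) (mul_mem md mz))
    (sub_mem (mul_mem mt mr1) md) mz o0 ?_ hz hw
  have eW : t * r0 - d * z + X 0 * (t * r1 - d) + X 0 ^ 2 * (t * r2)
      = t * V - d * (z + X 0) := by rw [hr, hr']; ring
  have eD : z + X 0 * 1 = z + X 0 := by ring
  rw [eW, eD]
  have hcrit := jj_crit (z + X 0) z t k h hk
  set x : PS := z + X 0 with hx
  have hnx : ¬ X 0 ∣ (1 + x) ^ 2 := not_dvd_of_cc (by simp [hx, cz])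
  have hnd : ¬ X 0 ∣ ey z ^ 2 := not_dvd_of_cc (by simp [ey, cz, map_ofNat])
  apply sq_dvd_cancel hnd
  apply sq_dvd_cancel hnx
  refine ⟨(1 - x * z - x) ^ 2 * (1 - z ^ 2 * x - 2 * z * x) * (t * V - d * x), ?_⟩
  have hxz : x - z = X 0 := by rw [hx]; ring
  rw [hxz] at hcrit
  unfold cub
  linear_combination (ey z ^ 2) * hE - (t * V - d * x) * hcrit

theorem exists_z : ∃ z : PS, z ∈ noVar 0 ∧ z ∈ noVar 1 ∧ (1 + 4 * X 2) * z = 1 - 2 * X 2 ^ 3 * z ^ 2 := by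
  have red : ∀ i : Fin 3, i ≠ 2 → ∀ z : PS, (1 + 4 * X 2) * z = 1 - 2 * X 2 ^ 3 * z ^ 2 →
      ∃ z' : PS, (1 + 4 * X 2) * z' = 1 - 2 * X 2 ^ 3 * z' ^ 2 ∧ z' ∈ noVar i ∧
        ∀ j, z ∈ noVar j → z' ∈ noVar j := by
    intro i hi z hz
    obtain ⟨g, h, rfl, mg, hj, -⟩ := decomp i z
    refine ⟨g, ?_, mg, hj⟩
    rw [← sub_eq_zero]
    have s : (X 2 : PS) ∈ noVar i := X_mem_noVar hi.symm
    have n0 : ∀ n : ℕ, [n.AtLeastTwo] → (OfNat.ofNat n : PS) ∈ noVar i := fun n _ => ofNat_mem _ n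
    apply eq_zero_of_dvd (i := i)
    · exact sub_mem (mul_mem (add_mem (one_mem _) (mul_mem (n0 4) s)) mg)
        (sub_mem (one_mem _) (mul_mem (mul_mem (n0 2) (pow_mem s 3)) (pow_mem mg 2)))
    · refine ⟨-((1 + 4 * X 2) * h + 2 * X 2 ^ 3 * (2 * g * h + X i * h ^ 2)), ?_⟩
      linear_combination hz
  obtain ⟨w, hw⟩ := exists_inv (f := (1 + 4 * X 2 : PS)) (by simp)
  let Cq : PowerSeries ℚ := PowerSeries.map (Nat.castRingHom ℚ) PowerSeries.catalanSeries
  have hC : Cq ^ 2 * PowerSeries.X + 1 = Cq := by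
    have := congrArg (PowerSeries.map (Nat.castRingHom ℚ)) PowerSeries.catalanSeries_sq_mul_X_add_one
    simpa using this
  have hs : PowerSeries.HasSubst (-2 * X 2 ^ 3 * w ^ 2 : PS) :=
    PowerSeries.HasSubst.of_constantCoeff_zero (by simp)
  have h2 := congrArg (PowerSeries.substAlgHom hs) hC
  simp only [map_add, map_mul, map_pow, map_one, PowerSeries.substAlgHom_X] at h2
  set K : PS := PowerSeries.substAlgHom hs Cq
  have hz : (1 + 4 * X 2) * (w * K) = 1 - 2 * X 2 ^ 3 * (w * K) ^ 2 := by
    linear_combination K * hw - h2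
  obtain ⟨z1, e1, m1, -⟩ := red 0 (by decide) _ hz
  obtain ⟨z2, e2, m2, h3⟩ := red 1 (by decide) _ e1
  exact ⟨z2, h3 0 m1, m2, e2⟩

end WM


namespace WM
open MvPowerSeries

section algebra
variable {A : Type*} [CommRing A] [IsDomain A] [Algebra ℚ A]

/-- elements algebraic over the subalgebra generated by `S` -/
noncomputable def AC (S : Set A) : Subalgebra (Algebra.adjoin ℚ S) A :=
  Subalgebra.algebraicClosure (Algebra.adjoin ℚ S) A

theorem mem_AC_of_mem {S : Set A} {x : A} (h : x ∈ S) : x ∈ AC S := by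
  have : algebraMap (Algebra.adjoin ℚ S) A ⟨x, Algebra.subset_adjoin h⟩ ∈ AC S :=
    Subalgebra.algebraMap_mem _ _
  exact this

theorem root_mem {S : Set A} {w a0 a1 a2 a3 a4 : A} (h0 : a0 ∈ AC S) (h1 : a1 ∈ AC S)
    (h2 : a2 ∈ AC S) (h3 : a3 ∈ AC S) (h4 : a4 ∈ AC S)
    (hne : a0 ≠ 0 ∨ a1 ≠ 0 ∨ a2 ≠ 0 ∨ a3 ≠ 0 ∨ a4 ≠ 0)
    (h : a0 + a1 * w + a2 * w ^ 2 + a3 * w ^ 3 + a4 * w ^ 4 = 0) : w ∈ AC S := by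
  let p : Polynomial (AC S) := Polynomial.C ⟨a0, h0⟩ + Polynomial.C ⟨a1, h1⟩ * Polynomial.X
    + Polynomial.C ⟨a2, h2⟩ * Polynomial.X ^ 2 + Polynomial.C ⟨a3, h3⟩ * Polynomial.X ^ 3
    + Polynomial.C ⟨a4, h4⟩ * Polynomial.X ^ 4
  have hp : p ≠ 0 := by
    intro hp
    have c0 := congrArg (fun q => ((Polynomial.coeff q 0 : AC S) : A)) hp
    have c1 := congrArg (fun q => ((Polynomial.coeff q 1 : AC S) : A)) hp
    have c2 := congrArg (fun q => ((Polynomial.coeff q 2 : AC S) : A)) hp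
    have c3 := congrArg (fun q => ((Polynomial.coeff q 3 : AC S) : A)) hp
    have c4 := congrArg (fun q => ((Polynomial.coeff q 4 : AC S) : A)) hp
    simp [p, Polynomial.coeff_X, Polynomial.coeff_X_pow, Polynomial.coeff_C] at c0 c1 c2 c3 c4
    tauto
  have halg : IsAlgebraic (AC S) w := by
    refine ⟨p, hp, ?_⟩
    simp only [p, map_add, map_mul, map_pow, Polynomial.aeval_C, Polynomial.aeval_X]
    exact h
  have : Algebra.IsAlgebraic (Algebra.adjoin ℚ S) (AC S) := by
    unfold AC; infer_instance
  exact IsAlgebraic.restrictScalars (Algebra.adjoin ℚ S) halg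

theorem ofNat_AC (S : Set A) (n : ℕ) [n.AtLeastTwo] : (OfNat.ofNat n : A) ∈ AC S := ofNat_mem _ n

theorem lin_mem {S : Set A} {w f g : A} (hf : f ∈ AC S) (hg : g ∈ AC S) (hne : f ≠ 0)
    (h : f * w = g) : w ∈ AC S :=
  root_mem (neg_mem hg) hf (zero_mem _) (zero_mem _) (zero_mem _) (Or.inr (Or.inl hne))
    (by rw [← h]; ring)

theorem vieta {k1 k2 k3 a β c : A} (h12 : k1 ≠ k2) (h13 : k1 ≠ k3) (h23 : k2 ≠ k3)
    (e1 : dsc a (k1 + β) c = 0) (e2 : dsc a (k2 + β) c = 0) (e3 : dsc a (k3 + β) c = 0) :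
    a ^ 2 = 4 * (k1 + k2 + k3 + 3 * β) ∧
    18 * (a * c) = 4 * ((k1 + β) * (k2 + β) + (k1 + β) * (k3 + β) + (k2 + β) * (k3 + β)) ∧
    4 * a ^ 3 * c - 27 * c ^ 2 = 4 * ((k1 + β) * (k2 + β) * (k3 + β)) := by
  unfold dsc at e1 e2 e3
  have g12 : -4 * ((k1 + β) ^ 2 + (k1 + β) * (k2 + β) + (k2 + β) ^ 2)
      + a ^ 2 * ((k1 + β) + (k2 + β)) - 18 * (a * c) = 0 := by
    apply mul_left_cancel₀ (sub_ne_zero.mpr h12)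
    linear_combination e1 - e2
  have g13 : -4 * ((k1 + β) ^ 2 + (k1 + β) * (k3 + β) + (k3 + β) ^ 2)
      + a ^ 2 * ((k1 + β) + (k3 + β)) - 18 * (a * c) = 0 := by
    apply mul_left_cancel₀ (sub_ne_zero.mpr h13)
    linear_combination e1 - e3
  have i1 : a ^ 2 = 4 * (k1 + k2 + k3 + 3 * β) := by
    apply mul_left_cancel₀ (sub_ne_zero.mpr h23)
    linear_combination g12 - g13
  have i2 : 18 * (a * c) = 4 * ((k1 + β) * (k2 + β) + (k1 + β) * (k3 + β) + (k2 + β) * (k3 + β)) := by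
    linear_combination -g12 + (k1 + β + (k2 + β)) * i1
  refine ⟨i1, i2, ?_⟩
  linear_combination e1 - (k1 + β) ^ 2 * i1 + (k1 + β) * i2

theorem quartic {k1 k2 k3 a β c : A}
    (i1 : a ^ 2 = 4 * (k1 + k2 + k3 + 3 * β))
    (i2 : 18 * (a * c) = 4 * ((k1 + β) * (k2 + β) + (k1 + β) * (k3 + β) + (k2 + β) * (k3 + β)))
    (i3 : 4 * a ^ 3 * c - 27 * c ^ 2 = 4 * ((k1 + β) * (k2 + β) * (k3 + β))) (e1 e2 e3 p q : A)
    (he1 : e1 = k1 + k2 + k3) (he2 : e2 = k1 * k2 + k1 * k3 + k2 * k3) (he3 : e3 = k1 * k2 * k3)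
    (hp : p = 48 * e2 - 16 * e1 ^ 2) (hq : q = 1728 * e3 - 576 * e1 * e2 + 128 * e1 ^ 3) :
    8 * (27 * (a ^ 2) ^ 4 + 18 * p * (a ^ 2) ^ 2 - 4 * q * a ^ 2 - p ^ 2) = 0 := by
  obtain ⟨S2, hS2⟩ : ∃ S2, S2 = (k1 + β) * (k2 + β) + (k1 + β) * (k3 + β) + (k2 + β) * (k3 + β) :=
    ⟨_, rfl⟩
  obtain ⟨S3, hS3⟩ : ∃ S3, S3 = (k1 + β) * (k2 + β) * (k3 + β) := ⟨_, rfl⟩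
  rw [← hS2] at i2
  rw [← hS3] at i3
  obtain ⟨E, hE⟩ : ∃ E, E = a ^ 2 := ⟨_, rfl⟩
  have hb : E = 12 * β + 4 * e1 := by rw [hE, i1, he1]; ring
  have f1 : 8 * (9 * E * S3) = 8 * (2 * E ^ 2 * S2 - 3 * S2 ^ 2) := by
    rw [hE]
    linear_combination -18 * a ^ 2 * i3 + (4 * a ^ 4 - 3 * (9 * (a * c) + 2 * S2)) * i2
  have f2 : 48 * S2 = E ^ 2 + p := by
    rw [hb, hp, hS2, he2, he1]; ring
  have f3 : 1728 * S3 = E ^ 3 + 3 * p * E + q := by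
    rw [hb, hp, hq, hS3, he3, he2, he1]; ring
  rw [← hE]
  linear_combination (-768) * f1 + 32 * E * f3 - (8 * 32 * E ^ 2 - 8 * (48 * S2 + E ^ 2 + p)) * f2

theorem params_mem {S : Set A} {k1 k2 k3 a β c : A} (m1 : k1 ∈ AC S) (m2 : k2 ∈ AC S)
    (m3 : k3 ∈ AC S) (h12 : k1 ≠ k2) (h13 : k1 ≠ k3) (h23 : k2 ≠ k3)
    (e1 : dsc a (k1 + β) c = 0) (e2 : dsc a (k2 + β) c = 0) (e3 : dsc a (k3 + β) c = 0) :
    a ∈ AC S ∧ β ∈ AC S ∧ c ∈ AC S := by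
  have : CharZero A := algebraRat.charZero A
  obtain ⟨i1, i2, i3⟩ := vieta h12 h13 h23 e1 e2 e3
  have hq := quartic i1 i2 i3 _ _ _ _ _ rfl rfl rfl rfl rfl
  have n := ofNat_AC S
  set s1 := k1 + k2 + k3 with hs1
  set s2 := k1 * k2 + k1 * k3 + k2 * k3 with hs2
  set s3 := k1 * k2 * k3 with hs3
  have ms1 : s1 ∈ AC S := add_mem (add_mem m1 m2) m3
  have ms2 : s2 ∈ AC S := add_mem (add_mem (mul_mem m1 m2) (mul_mem m1 m3)) (mul_mem m2 m3)
  have ms3 : s3 ∈ AC S := mul_mem (mul_mem m1 m2) m3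
  set p := 48 * s2 - 16 * s1 ^ 2 with hp
  set q := 1728 * s3 - 576 * s1 * s2 + 128 * s1 ^ 3 with hq'
  have mp : p ∈ AC S := sub_mem (mul_mem (n 48) ms2) (mul_mem (n 16) (pow_mem ms1 2))
  have mq : q ∈ AC S := add_mem (sub_mem (mul_mem (n 1728) ms3)
    (mul_mem (mul_mem (n 576) ms1) ms2)) (mul_mem (n 128) (pow_mem ms1 3))
  have hA : a ^ 2 ∈ AC S := by
    refine root_mem (neg_mem (pow_mem mp 2)) (neg_mem (mul_mem (n 4) mq)) (mul_mem (n 18) mp)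
      (zero_mem _) (n 27) (Or.inr (Or.inr (Or.inr (Or.inr (by norm_num))))) ?_
    apply mul_left_cancel₀ (show (8 : A) ≠ 0 by norm_num)
    linear_combination hq
  have ha : a ∈ AC S := root_mem (neg_mem hA) (zero_mem _) (one_mem _)
      (zero_mem _) (zero_mem _) (Or.inr (Or.inr (Or.inl one_ne_zero))) (by ring)
  have hβ : β ∈ AC S := lin_mem (f := 12) (g := a ^ 2 - 4 * s1) (n 12)
    (sub_mem hA (mul_mem (n 4) ms1)) (by norm_num) (by rw [i1]; ring)
  refine ⟨ha, hβ, root_mem (a0 := 4 * ((k1 + β) * (k2 + β) * (k3 + β))) (a1 := -(4 * a ^ 3))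
    (a2 := 27) (mul_mem (n 4) (mul_mem (mul_mem (add_mem m1 hβ) (add_mem m2 hβ)) (add_mem m3 hβ)))
    (neg_mem (mul_mem (n 4) (pow_mem ha 3))) (n 27) (zero_mem _) (zero_mem _)
    (Or.inr (Or.inr (Or.inl (by norm_num)))) (by rw [← i3]; ring)⟩

/-- algebraic elements give a polynomial relation -/
theorem exists_rel {x y t q : A} (h : q ∈ AC ({x, y, t} : Set A)) :
    ∃ P : MvPolynomial (Fin 4) ℚ, P ≠ 0 ∧ MvPolynomial.aeval ![x, y, t, q] P = 0 := by
  have hn : ¬ AlgebraicIndependent ℚ ![x, y, t, q] := by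
    intro hi
    have h1 := hi.transcendental_adjoin (s := {0, 1, 2}) (i := 3) (by simp)
    have e : (![x, y, t, q] '' ({0, 1, 2} : Set (Fin 4))) = {x, y, t} := by
      simp [Set.image_insert_eq]
    rw [e] at h1
    exact h1 h
  rw [algebraicIndependent_iff] at hn
  push Not at hn
  obtain ⟨P, h1, h2⟩ := hn
  exact ⟨P, h2, h1⟩

end algebra
end WM


namespace WM
open MvPowerSeries

instance instDomPS : IsDomain PS := NoZeroDivisors.to_isDomain _

theorem sub_self (f : PS) : sub X (by simp) f = f := by
  unfold sub
  rw [substAlgHom_apply, subst_self]; rfl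

theorem theta_inj {t : PS} (hd : X 2 ∣ t) (ht0 : t ≠ 0)
    (h : ∀ i, constantCoeff ((![X 0, X 1, t] : Fin 3 → PS) i) = 0) {f : PS}
    (hf : sub ![X 0, X 1, t] h f = 0) : f = 0 := by
  have key : ∀ n : ℕ, (X 2 : PS) ^ n ∣ f := by
    intro n
    induction n with
    | zero => simp
    | succ n ih =>
      obtain ⟨g, rfl⟩ := ih
      rw [pow_succ]
      apply mul_dvd_mul_left
      rw [map_mul, map_pow, sub_X] at hf
      have hg := (mul_eq_zero.mp hf).resolve_left (pow_ne_zero _ ht0)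
      obtain ⟨g0, g1, rfl, m0, -, -⟩ := decomp 2 g
      rw [map_add, map_mul, sub_X] at hg
      have e : sub ![X 0, X 1, t] h g0 = g0 := by
        conv_rhs => rw [← sub_self g0]
        apply sub_congr
        intro i
        fin_cases i
        · left; rfl
        · left; rfl
        · right; exact m0
      rw [e] at hg
      have : g0 = 0 := by
        apply eq_zero_of_dvd m0
        have e2 : g0 = - (t * sub ![X 0, X 1, t] h g1) := eq_neg_of_add_eq_zero_left hg
        rw [e2]
        exact (dvd_mul_of_dvd_left hd _).neg_right
      rw [this, zero_add]
      exact dvd_mul_right _ _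
  ext m
  have := key (m 2 + 1)
  rw [X_pow_dvd_iff] at this
  rw [this m (by omega)]; simp

theorem map_ii {R S : Type*} [CommRing R] [CommRing S] (φ : R →+* S) (x t : R) :
    φ (ii x t) = ii (φ x) (φ t) := by simp [ii, map_ofNat]

theorem map_jj {R S : Type*} [CommRing R] [CommRing S] (φ : R →+* S) (x t : R) :
    φ (jj x t) = jj (φ x) (φ t) := by simp [jj, map_ofNat]

theorem E1_map (φ : PS →ₐ[ℚ] PS) {u b d c x t : PS} (hx : φ (X 0) = x) (ht : φ (X 2) = t)
    (h : (ii (X 0) (X 2) + X 0 * (u ^ 2 + (-(1 + 2 * X 2)) * (1 + X 0) * u + b * (1 + X 0) ^ 2))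
      * (u - d * (1 + X 0)) = c * X 0 * (1 + X 0) ^ 3) :
    (ii x t + x * (φ u ^ 2 + (-(1 + 2 * t)) * (1 + x) * φ u + φ b * (1 + x) ^ 2))
      * (φ u - φ d * (1 + x)) = φ c * x * (1 + x) ^ 3 := by
  have h1 := congrArg φ h
  have h2 : φ (ii (X 0) (X 2)) = ii (φ (X 0)) (φ (X 2)) := map_ii (φ : PS →+* PS) _ _
  simp only [map_mul, map_add, map_sub, map_neg, map_pow, map_one, map_ofNat, h2, hx, ht] at h1
  exact h1

theorem E2_map (φ : PS →ₐ[ℚ] PS) {v b d c y t : PS} (hy : φ (X 1) = y) (ht : φ (X 2) = t)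
    (h : (jj (X 1) (X 2) + (1 + X 1) ^ 2 * ((X 2 * v) ^ 2 + (-(1 + 2 * X 2)) * X 1 * (X 2 * v)
      + b * X 1 ^ 2)) * (X 2 * v - d * X 1) = c * X 1 ^ 3 * (1 + X 1) ^ 2) :
    (jj y t + (1 + y) ^ 2 * ((t * φ v) ^ 2 + (-(1 + 2 * t)) * y * (t * φ v)
      + φ b * y ^ 2)) * (t * φ v - φ d * y) = φ c * y ^ 3 * (1 + y) ^ 2 := by
  have h1 := congrArg φ h
  have h2 : φ (jj (X 1) (X 2)) = jj (φ (X 1)) (φ (X 2)) := map_jj (φ : PS →+* PS) _ _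
  simp only [map_mul, map_add, map_sub, map_neg, map_pow, map_one, map_ofNat, h2, hy, ht] at h1
  exact h1

theorem QW_alg : ∃ P : MvPolynomial (Fin 4) ℚ, P ≠ 0 ∧
    MvPolynomial.aeval ![(X 0 : PS), X 1, X 2, QW] P = 0 := by
  obtain ⟨u, v, b, d, c, r, v', hu1, hv0, hb0, hb1, hd0, hd1, hc0, hc1, hur, hvv, hrel, hE1, hE2⟩ :=
    catalytic
  obtain ⟨z, mz, -, hz⟩ := exists_z
  have n0 : ∀ n : ℕ, [n.AtLeastTwo] → (OfNat.ofNat n : PS) ∈ noVar 0 := fun n _ => ofNat_mem _ n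
  have o0 : (1 : PS) ∈ noVar 0 := one_mem _
  have s0 : (X 2 : PS) ∈ noVar 0 := X_mem_noVar (by decide)
  have cz : constantCoeff z = 1 := by simpa using congrArg constantCoeff hz
  set s : PS := X 2 with hs
  have hs0 : s ≠ 0 := X_ne_zero' 2
  have cs : constantCoeff s = 0 := by simp [hs]
  have mdx : ∀ w : PS, w ∈ noVar 0 → dx w ∈ noVar 0 := fun w hw =>
    add_mem (add_mem (add_mem o0 (mul_mem (n0 4) hw)) (mul_mem (n0 2) (pow_mem hw 2)))
      (mul_mem (n0 2) (pow_mem hw 3))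
  have mey : ∀ w : PS, w ∈ noVar 0 → ey w ∈ noVar 0 := fun w hw =>
    add_mem (add_mem (add_mem (n0 2) (mul_mem (n0 2) hw)) (mul_mem (n0 4) (pow_mem hw 2)))
      (pow_mem hw 3)
  have mkx : ∀ w : PS, w ∈ noVar 0 → kx w ∈ noVar 0 := fun w hw =>
    mul_mem hw (add_mem (add_mem (add_mem (add_mem (add_mem (pow_mem hw 5)
      (mul_mem (n0 2) (pow_mem hw 4))) (mul_mem (n0 2) (pow_mem hw 3)))
      (mul_mem (n0 4) (pow_mem hw 2))) (mul_mem (n0 6) hw)) (n0 2))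
  have mky : ∀ w : PS, w ∈ noVar 0 → ky w ∈ noVar 0 := fun w hw =>
    add_mem (add_mem (add_mem (add_mem (add_mem o0 (mul_mem (n0 2) hw))
      (mul_mem (n0 2) (pow_mem hw 2))) (mul_mem (n0 4) (pow_mem hw 3)))
      (mul_mem (n0 6) (pow_mem hw 4))) (mul_mem (n0 2) (pow_mem hw 5))
  have cdx : ∀ w : PS, constantCoeff w = 0 → constantCoeff (dx w) = 1 := fun w hw => by
    simp [dx, hw]
  have cey : ∀ w : PS, constantCoeff w = 0 → constantCoeff (ey w) = 2 := fun w hw => by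
    simp [ey, hw, map_ofNat]
  -- the second small root and the reciprocal of the large one
  obtain ⟨s', hs'⟩ : ∃ s', s' = - (s * z) := ⟨_, rfl⟩
  obtain ⟨y3, hy3⟩ : ∃ y3, y3 = 2 * s ^ 2 * z := ⟨_, rfl⟩
  have hz0 : z ≠ 0 := ne_zero_of_cc (by simp [cz])
  have ms' : s' ∈ noVar 0 := by rw [hs']; exact neg_mem (mul_mem s0 mz)
  have my3 : y3 ∈ noVar 0 := by rw [hy3]; exact mul_mem (mul_mem (n0 2) (pow_mem s0 2)) mz
  have cs' : constantCoeff s' = 0 := by rw [hs']; simp [cs]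
  have cy3 : constantCoeff y3 = 0 := by rw [hy3]; simp [cs]
  have hs'0 : s' ≠ 0 := by rw [hs']; exact neg_ne_zero.mpr (mul_ne_zero hs0 hz0)
  have h20 : (2 : PS) ≠ 0 := ne_zero_of_cc (by rw [map_ofNat]; norm_num)
  have hy30 : y3 ≠ 0 := by rw [hy3]; exact mul_ne_zero (mul_ne_zero h20 (pow_ne_zero _ hs0)) hz0
  obtain ⟨δ, hδ⟩ := exists_inv (f := dx s) (by rw [cdx s cs]; norm_num)
  obtain ⟨δ', hδ'⟩ := exists_inv (f := dx s') (by rw [cdx s' cs']; norm_num)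
  obtain ⟨η, hη⟩ := exists_inv (f := ey y3) (by rw [cey y3 cy3]; norm_num)
  have mδ := inv_mem_noVar (mdx s s0) hδ
  have mδ' := inv_mem_noVar (mdx s' ms') hδ'
  have mη := inv_mem_noVar (mey y3 my3) hη
  obtain ⟨t, htd⟩ : ∃ t, t = s ^ 2 * δ := ⟨_, rfl⟩
  have mt : t ∈ noVar 0 := by rw [htd]; exact mul_mem (pow_mem s0 2) mδ
  have ct : constantCoeff t = 0 := by rw [htd]; simp [cs]
  have ht1 : s ^ 2 = t * dx s := by rw [htd]; linear_combination (-(s ^ 2)) * hδ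
  have ht0 : t ≠ 0 := by
    rintro rfl
    rw [zero_mul] at ht1
    exact hs0 (pow_eq_zero_iff two_ne_zero |>.mp ht1)
  have hdx0 : dx s ≠ 0 := ne_zero_of_cc (by rw [cdx s cs]; norm_num)
  have ht2 : s' ^ 2 = t * dx s' := by
    apply mul_left_cancel₀ hdx0
    have e : dx s * s' ^ 2 = s ^ 2 * dx s' := by
      rw [hs']; unfold dx
      linear_combination (s ^ 2 * (1 + z)) * hz
    rw [e, ht1]; ring
  have ht3 : y3 = t * ey y3 := by
    apply mul_left_cancel₀ hdx0
    have e : dx s * y3 = s ^ 2 * ey y3 := by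
      rw [hy3]; unfold dx ey
      linear_combination (s ^ 2 * (2 - 4 * s ^ 3 * z)) * hz
    rw [e, ht1]; ring
  -- critical values
  obtain ⟨k1, hk1⟩ : ∃ k, k = kx s * δ ^ 2 := ⟨_, rfl⟩
  obtain ⟨k2, hk2⟩ : ∃ k, k = kx s' * δ' ^ 2 := ⟨_, rfl⟩
  obtain ⟨k3, hk3⟩ : ∃ k, k = ky y3 * η ^ 2 := ⟨_, rfl⟩
  have mk1 : k1 ∈ noVar 0 := by rw [hk1]; exact mul_mem (mkx s s0) (pow_mem mδ 2)
  have mk2 : k2 ∈ noVar 0 := by rw [hk2]; exact mul_mem (mkx s' ms') (pow_mem mδ' 2)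
  have mk3 : k3 ∈ noVar 0 := by rw [hk3]; exact mul_mem (mky y3 my3) (pow_mem mη 2)
  have f1 : k1 * dx s ^ 2 = kx s := by
    rw [hk1]; linear_combination (kx s * (dx s * δ + 1)) * hδ
  have f2 : k2 * dx s' ^ 2 = kx s' := by
    rw [hk2]; linear_combination (kx s' * (dx s' * δ' + 1)) * hδ'
  have f3 : k3 * ey y3 ^ 2 = ky y3 := by
    rw [hk3]; linear_combination (ky y3 * (ey y3 * η + 1)) * hη
  have ck1 : constantCoeff k1 = 0 := by rw [hk1]; simp [kx, cs]
  have ck2 : constantCoeff k2 = 0 := by rw [hk2]; simp [kx, cs']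
  have ck3 : constantCoeff k3 ≠ 0 := by
    intro h
    have := congrArg constantCoeff f3
    simp [h, ky, cy3] at this
  have h13 : k1 ≠ k3 := by rintro rfl; exact ck3 ck1
  have h23 : k2 ≠ k3 := by rintro rfl; exact ck3 ck2
  have h12 : k1 ≠ k2 := by
    intro h
    have e : (s ^ 5 + 2 * s ^ 4 + 2 * s ^ 3 + 4 * s ^ 2 + 6 * s + 2) * dx s' ^ 2 =
        - (z * (s' ^ 5 + 2 * s' ^ 4 + 2 * s' ^ 3 + 4 * s' ^ 2 + 6 * s' + 2)) * dx s ^ 2 := by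
      apply mul_left_cancel₀ hs0
      rw [h] at f1
      have g1 : s * ((s ^ 5 + 2 * s ^ 4 + 2 * s ^ 3 + 4 * s ^ 2 + 6 * s + 2) * dx s' ^ 2)
          = kx s * dx s' ^ 2 := by unfold kx; ring
      have g2 : s * (- (z * (s' ^ 5 + 2 * s' ^ 4 + 2 * s' ^ 3 + 4 * s' ^ 2 + 6 * s' + 2)) * dx s ^ 2)
          = kx s' * dx s ^ 2 := by
        unfold kx
        linear_combination (-(s' ^ 5 + 2 * s' ^ 4 + 2 * s' ^ 3 + 4 * s' ^ 2 + 6 * s' + 2) * dx s ^ 2)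
          * hs'
      rw [g1, g2, ← f1, ← f2]; ring
    have := congrArg constantCoeff e
    simp only [map_mul, map_add, map_neg, map_pow, cdx s cs, cdx s' cs', cs, cs', cz, map_ofNat] at this
    norm_num at this
  -- substitutions
  have hθ : ∀ i, constantCoeff ((![X 0, X 1, t] : Fin 3 → PS) i) = 0 := by
    intro i; fin_cases i <;> simp [ct]
  have h1 : ∀ i, constantCoeff ((![s + X 0, 0, t] : Fin 3 → PS) i) = 0 := by
    intro i; fin_cases i <;> simp [ct, cs]
  have h2 : ∀ i, constantCoeff ((![s' + X 0, 0, t] : Fin 3 → PS) i) = 0 := by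
    intro i; fin_cases i <;> simp [ct, cs']
  have h3 : ∀ i, constantCoeff ((![0, y3 + X 0, t] : Fin 3 → PS) i) = 0 := by
    intro i; fin_cases i <;> simp [ct, cy3]
  have agree : ∀ f : PS, f ∈ noVar 0 → f ∈ noVar 1 → ∀ p q : PS,
      ∀ h : (∀ i, constantCoeff ((![p, q, t] : Fin 3 → PS) i) = 0),
      sub ![p, q, t] h f = sub ![X 0, X 1, t] hθ f := by
    intro f m0 m1 p q h
    apply sub_congr
    intro i
    fin_cases i
    · exact Or.inr m0
    · exact Or.inr m1
    · exact Or.inl rfl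
  have memθ : ∀ f : PS, f ∈ noVar 0 → sub ![X 0, X 1, t] hθ f ∈ noVar 0 := by
    intro f m0
    apply sub_mem_noVar
    intro i
    fin_cases i
    · exact Or.inr m0
    · exact Or.inl (X_mem_noVar (by decide))
    · exact Or.inl mt
  set θ := sub ![X 0, X 1, t] hθ with hθd
  have D1 : dsc (-(1 + 2 * t) + 2 * θ d) (k1 + θ d ^ 2 + (-(1 + 2 * t)) * θ d + θ b) (θ c) = 0 := by
    have e := E1_map (sub ![s + X 0, 0, t] h1) (x := s + X 0) (t := t) (sub_X _ _ 0) (sub_X _ _ 2) hE1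
    rw [agree b hb0 hb1, agree c hc0 hc1, agree d hd0 hd1] at e
    refine xcase (r := sub ![s + X 0, 0, t] h1 r) s0 mt mk1 (memθ b hb0) (memθ d hd0) (memθ c hc0)
      hs0 cs ct ht1 f1 ?_ e
    rw [hur, map_sub, map_mul, sub_X, sub_X]; rfl
  have D2 : dsc (-(1 + 2 * t) + 2 * θ d) (k2 + θ d ^ 2 + (-(1 + 2 * t)) * θ d + θ b) (θ c) = 0 := by
    have e := E1_map (sub ![s' + X 0, 0, t] h2) (x := s' + X 0) (t := t) (sub_X _ _ 0) (sub_X _ _ 2)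
      hE1
    rw [agree b hb0 hb1, agree c hc0 hc1, agree d hd0 hd1] at e
    refine xcase (r := sub ![s' + X 0, 0, t] h2 r) ms' mt mk2 (memθ b hb0) (memθ d hd0) (memθ c hc0)
      hs'0 cs' ct ht2 f2 ?_ e
    rw [hur, map_sub, map_mul, sub_X, sub_X]; rfl
  have D3 : dsc (-(1 + 2 * t) + 2 * θ d) (k3 + θ d ^ 2 + (-(1 + 2 * t)) * θ d + θ b) (θ c) = 0 := by
    have e := E2_map (sub ![0, y3 + X 0, t] h3) (y := y3 + X 0) (t := t) (sub_X _ _ 1) (sub_X _ _ 2)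
      hE2
    rw [agree b hb0 hb1, agree c hc0 hc1, agree d hd0 hd1] at e
    refine ycase my3 mt mk3 (memθ b hb0) (memθ d hd0) (memθ c hc0)
      hy30 ht0 cy3 ht3 f3 ?_ e
    rw [constantCoeff_sub', hvv]; simp
  -- algebraicity
  set S : Set PS := {X 0, X 1, t} with hS
  have aX : X 0 ∈ AC S := mem_AC_of_mem (by simp [hS])
  have aY : X 1 ∈ AC S := mem_AC_of_mem (by simp [hS])
  have aT : t ∈ AC S := mem_AC_of_mem (by simp [hS])
  have n := ofNat_AC S
  have o : (1 : PS) ∈ AC S := one_mem _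
  have as : s ∈ AC S := by
    refine root_mem (a0 := t) (a1 := 4 * t) (a2 := 2 * t - 1) (a3 := 2 * t) (a4 := 0) aT
      (mul_mem (n 4) aT) (sub_mem (mul_mem (n 2) aT) o) (mul_mem (n 2) aT) (zero_mem _)
      (Or.inl ht0) ?_
    unfold dx at ht1
    linear_combination -ht1
  have az : z ∈ AC S := by
    refine root_mem (a0 := -1) (a1 := 1 + 4 * s) (a2 := 2 * s ^ 3) (a3 := 0) (a4 := 0)
      (neg_mem o) (add_mem o (mul_mem (n 4) as)) (mul_mem (n 2) (pow_mem as 3)) (zero_mem _)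
      (zero_mem _) (Or.inl (neg_ne_zero.mpr one_ne_zero)) ?_
    linear_combination hz
  have as' : s' ∈ AC S := by rw [hs']; exact neg_mem (mul_mem as az)
  have ay3 : y3 ∈ AC S := by rw [hy3]; exact mul_mem (mul_mem (n 2) (pow_mem as 2)) az
  have adx : ∀ w : PS, w ∈ AC S → dx w ∈ AC S := fun w hw =>
    add_mem (add_mem (add_mem o (mul_mem (n 4) hw)) (mul_mem (n 2) (pow_mem hw 2)))
      (mul_mem (n 2) (pow_mem hw 3))
  have aey : ey y3 ∈ AC S :=
    add_mem (add_mem (add_mem (n 2) (mul_mem (n 2) ay3)) (mul_mem (n 4) (pow_mem ay3 2)))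
      (pow_mem ay3 3)
  have akx : ∀ w : PS, w ∈ AC S → kx w ∈ AC S := fun w hw =>
    mul_mem hw (add_mem (add_mem (add_mem (add_mem (add_mem (pow_mem hw 5)
      (mul_mem (n 2) (pow_mem hw 4))) (mul_mem (n 2) (pow_mem hw 3)))
      (mul_mem (n 4) (pow_mem hw 2))) (mul_mem (n 6) hw)) (n 2))
  have aky : ky y3 ∈ AC S :=
    add_mem (add_mem (add_mem (add_mem (add_mem o (mul_mem (n 2) ay3))
      (mul_mem (n 2) (pow_mem ay3 2))) (mul_mem (n 4) (pow_mem ay3 3)))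
      (mul_mem (n 6) (pow_mem ay3 4))) (mul_mem (n 2) (pow_mem ay3 5))
  have ak1 : k1 ∈ AC S := lin_mem (pow_mem (adx s as) 2) (akx s as) (pow_ne_zero _ hdx0)
    (by rw [mul_comm]; exact f1)
  have ak2 : k2 ∈ AC S := lin_mem (pow_mem (adx s' as') 2) (akx s' as')
    (pow_ne_zero _ (ne_zero_of_cc (by rw [cdx s' cs']; norm_num))) (by rw [mul_comm]; exact f2)
  have ak3 : k3 ∈ AC S := lin_mem (pow_mem aey 2) aky
    (pow_ne_zero _ (ne_zero_of_cc (by rw [cey y3 cy3]; norm_num))) (by rw [mul_comm]; exact f3)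
  simp only [add_assoc] at D1 D2 D3
  obtain ⟨pa, pβ, pc⟩ := params_mem ak1 ak2 ak3 h12 h13 h23 D1 D2 D3
  have a1m : -(1 + 2 * t) ∈ AC S := neg_mem (add_mem o (mul_mem (n 2) aT))
  have ad : θ d ∈ AC S := lin_mem (n 2) (sub_mem pa a1m) h20 (by ring)
  have ab : θ b ∈ AC S := by
    have := sub_mem pβ (add_mem (pow_mem ad 2) (mul_mem a1m ad))
    convert this using 1
    ring
  have ax1 : 1 + X 0 ∈ AC S := add_mem o aX
  have ay1 : 1 + X 1 ∈ AC S := add_mem o aY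
  have aii : ii (X 0) t ∈ AC S := by
    unfold ii
    have q2 : (X 0 - t * (X 0 ^ 2 + 2) : PS) ∈ AC S :=
      sub_mem aX (mul_mem aT (add_mem (pow_mem aX 2) (n 2)))
    exact add_mem (sub_mem (add_mem (mul_mem (mul_mem (mul_mem aT ax1) (add_mem (pow_mem aX 2) o)) q2)
      (pow_mem q2 2)) (mul_mem (mul_mem (n 2) (pow_mem aT 2)) (pow_mem ax1 3)))
      (mul_mem (mul_mem aT ax1) (add_mem o (mul_mem (n 3) aT)))
  have ajj : jj (X 1) t ∈ AC S := by
    unfold jj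
    have q2 : (X 1 - t * (1 + 2 * X 1 ^ 2) : PS) ∈ AC S :=
      sub_mem aY (mul_mem aT (add_mem o (mul_mem (n 2) (pow_mem aY 2))))
    exact add_mem (sub_mem (add_mem (mul_mem (mul_mem (mul_mem aT ay1) (add_mem o (pow_mem aY 2))) q2)
      (mul_mem aY (pow_mem q2 2))) (mul_mem (mul_mem (mul_mem (n 2) (pow_mem aT 2)) (pow_mem aY 2))
      (pow_mem ay1 3))) (mul_mem (mul_mem (mul_mem aT (pow_mem aY 4)) ay1)
      (add_mem o (mul_mem (n 3) aT)))
  have g1 := E1_map θ (x := X 0) (t := t) (sub_X _ _ 0) (sub_X _ _ 2) hE1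
  have g2 := E2_map θ (y := X 1) (t := t) (sub_X _ _ 1) (sub_X _ _ 2) hE2
  have aU : θ u ∈ AC S := by
    refine root_mem
      (a0 := -(θ d * (1 + X 0) * (ii (X 0) t + X 0 * (θ b * (1 + X 0) ^ 2)))
        - θ c * X 0 * (1 + X 0) ^ 3)
      (a1 := ii (X 0) t + X 0 * (θ b * (1 + X 0) ^ 2)
        - X 0 * (-(1 + 2 * t) * (1 + X 0)) * (θ d * (1 + X 0)))
      (a2 := X 0 * (-(1 + 2 * t) * (1 + X 0)) - X 0 * (θ d * (1 + X 0)))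
      (a3 := X 0) (a4 := 0) ?_ ?_ ?_ aX (zero_mem _)
      (Or.inr (Or.inr (Or.inr (Or.inl (X_ne_zero' 0))))) (by linear_combination g1)
    · exact sub_mem (neg_mem (mul_mem (mul_mem ad ax1) (add_mem aii (mul_mem aX (mul_mem ab
        (pow_mem ax1 2)))))) (mul_mem (mul_mem pc aX) (pow_mem ax1 3))
    · exact sub_mem (add_mem aii (mul_mem aX (mul_mem ab (pow_mem ax1 2))))
        (mul_mem (mul_mem aX (mul_mem a1m ax1)) (mul_mem ad ax1))
    · exact sub_mem (mul_mem aX (mul_mem a1m ax1)) (mul_mem aX (mul_mem ad ax1))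
  have aV : t * θ v ∈ AC S := by
    refine root_mem
      (a0 := -(θ d * X 1 * (jj (X 1) t + (1 + X 1) ^ 2 * (θ b * X 1 ^ 2)))
        - θ c * X 1 ^ 3 * (1 + X 1) ^ 2)
      (a1 := jj (X 1) t + (1 + X 1) ^ 2 * (θ b * X 1 ^ 2)
        - (1 + X 1) ^ 2 * (-(1 + 2 * t) * X 1) * (θ d * X 1))
      (a2 := (1 + X 1) ^ 2 * (-(1 + 2 * t) * X 1) - (1 + X 1) ^ 2 * (θ d * X 1))
      (a3 := (1 + X 1) ^ 2) (a4 := 0) ?_ ?_ ?_ (pow_mem ay1 2) (zero_mem _)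
      (Or.inr (Or.inr (Or.inr (Or.inl (ne_zero_of_cc (by simp)))))) (by linear_combination g2)
    · exact sub_mem (neg_mem (mul_mem (mul_mem ad aY) (add_mem ajj (mul_mem (pow_mem ay1 2)
        (mul_mem ab (pow_mem aY 2)))))) (mul_mem (mul_mem pc (pow_mem aY 3)) (pow_mem ay1 2))
    · exact sub_mem (add_mem ajj (mul_mem (pow_mem ay1 2) (mul_mem ab (pow_mem aY 2))))
        (mul_mem (mul_mem (pow_mem ay1 2) (mul_mem a1m aY)) (mul_mem ad aY))
    · exact sub_mem (mul_mem (pow_mem ay1 2) (mul_mem a1m aY)) (mul_mem (pow_mem ay1 2)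
        (mul_mem ad aY))
  have inj : ∀ f : PS, θ f = 0 → f = 0 := fun f hf =>
    theta_inj ⟨s * δ, by rw [htd]; ring⟩ ht0 hθ hf
  have θX : θ (X 0) = X 0 := sub_X _ _ 0
  have θY : θ (X 1) = X 1 := sub_X _ _ 1
  have θT : θ (X 2) = t := sub_X _ _ 2
  obtain ⟨k, hk⟩ : ∃ k, k = X 0 * X 1 - t * (X 1 ^ 2 * (1 + X 0) ^ 2 + X 1 * (2 + X 0 ^ 2) + 1 + X 0) :=
    ⟨_, rfl⟩
  have hkθ : θ (X 0 * X 1 - X 2 * NN) = k := by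
    rw [hk]; unfold NN
    simp only [map_mul, map_add, map_sub, map_pow, map_one, map_ofNat, θX, θY, θT]
  have hk0 : k ≠ 0 := by
    intro h
    rw [h] at hkθ
    have h4 := inj _ hkθ
    have h5 : X 0 ∣ (X 2 * (1 + X 1) ^ 2 : PS) := by
      refine ⟨X 1 - X 2 * (X 1 ^ 2 * (2 + X 0) + X 0 * X 1 + 1), ?_⟩
      unfold NN at h4
      linear_combination -h4
    have h6 := eq_zero_of_dvd (mul_mem (X_mem_noVar (by decide)) (pow_mem (add_mem (one_mem _)
      (X_mem_noVar (by decide))) 2)) h5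
    rcases mul_eq_zero.mp h6 with h7 | h7
    · exact X_ne_zero' _ h7
    · exact ne_zero_of_cc (f := (1 + X 1) ^ 2) (by simp) h7
  have hrelθ : X 1 * θ u - (1 + X 0) * (t * θ v) = k * (t * (1 + X 0) * X 1 * θ QW + 1) := by
    have := congrArg θ hrel
    rw [map_mul θ (X 0 * X 1 - X 2 * NN), hkθ] at this
    simp only [map_mul, map_add, map_sub, map_one, θX, θY, show θ s = t from θT] at this
    rw [← this]; ring
  have ak : k ∈ AC S := by
    rw [hk]
    exact sub_mem (mul_mem aX aY) (mul_mem aT (add_mem (add_mem (add_mem (mul_mem (pow_mem aY 2)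
      (pow_mem ax1 2)) (mul_mem aY (add_mem (n 2) (pow_mem aX 2)))) o) aX))
  have aQ : θ QW ∈ AC S := by
    refine lin_mem (f := k * (t * (1 + X 0) * X 1)) (g := X 1 * θ u - (1 + X 0) * (t * θ v) - k)
      (mul_mem ak (mul_mem (mul_mem aT ax1) aY))
      (sub_mem (sub_mem (mul_mem aY aU) (mul_mem ax1 aV)) ak)
      (mul_ne_zero hk0 (mul_ne_zero (mul_ne_zero ht0 (ne_zero_of_cc (by simp))) (X_ne_zero' 1))) ?_
    rw [hrelθ]; ring
  obtain ⟨P, hP, hP0⟩ := exists_rel aQ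
  refine ⟨P, hP, inj _ ?_⟩
  rw [← hP0]
  change (θ.comp (MvPolynomial.aeval _)) P = _
  rw [MvPolynomial.comp_aeval]
  congr 2
  funext i
  fin_cases i
  · exact θX
  · exact θY
  · exact θT
  · rfl

end WM

/-- For the weighted model with weights `w(-1,0)=2, w(-1,1)=1, w(0,1)=2, w(1,1)=1,
`w(1,0)=1, w(0,-1)=1, w(-1,-1)=1`, the weighted generating function `Q(x,y;t)` is
algebraic: some nonzero `P ∈ ℚ[x,y,t,u]` satisfies `P(x,y,t,Q(x,y;t)) = 0`. -/
theorem weighted_model_algebraic :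
    ∃ P : MvPolynomial (Fin 4) ℚ, P ≠ 0 ∧
      MvPolynomial.aeval
        ![MvPowerSeries.X 0, MvPowerSeries.X 1, MvPowerSeries.X 2, QW] P = 0 := by
  exact WM.QW_alg
end

section
/- For Kreweras' model with starting point (0,1), the generating function Q^{(0,1)}(x,y;t) is transcendental: there is no nonzero polynomial P ∈ ℚ[x,y,t,u] such that P(x, y, t, Q^{(0,1)}(x,y;t)) = 0 in the formal power series ring ℚ[[x,y,t]]. -/
/-- The set of quadrant walks of length `n` from `(0,1)` to `(i,j)` with steps in `S`:
sequences of steps such that `(0,1)` plus every partial sum stays in `ℕ²` and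
`(0,1)` plus the total sum is `(i,j)`. -/
def quadWalksFrom01 (S : Set (ℤ × ℤ)) (i j n : ℕ) : Set (List (ℤ × ℤ)) :=
  {w | w.length = n ∧ (∀ s ∈ w, s ∈ S) ∧
    (∀ k, 0 ≤ ((w.take k).map Prod.fst).sum ∧ 0 ≤ 1 + ((w.take k).map Prod.snd).sum) ∧
    (w.map Prod.fst).sum = i ∧ 1 + (w.map Prod.snd).sum = j}

/-- The number `q^{(0,1)}(i,j;n)` of quadrant walks of length `n` from `(0,1)` to `(i,j)`. -/
noncomputable def q01 (S : Set (ℤ × ℤ)) (i j n : ℕ) : ℕ := Nat.card (quadWalksFrom01 S i j n)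

/-- The generating function `Q^{(0,1)}(x,y;t) = Σ q^{(0,1)}(i,j;n) x^i y^j t^n`, as a
formal power series in the three variables `x = X 0`, `y = X 1`, `t = X 2`. -/
noncomputable def Q01 (S : Set (ℤ × ℤ)) : MvPowerSeries (Fin 3) ℚ :=
  fun d => (q01 S (d 0) (d 1) (d 2) : ℚ)

/-- Kreweras' step set. -/
def krewerasSteps : Set (ℤ × ℤ) := {(1, 1), (-1, 0), (0, -1)}

section KrewAlg
open Polynomial

/-- An algebraic element has an annihilating polynomial whose specialization at `a` is nonzero. -/
theorem krew_exists_specialize {A B : Type*} [CommRing A] [IsDomain A] [CommRing B] [IsDomain B]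
    [Algebra A[X] B] (f : B) (hf : IsAlgebraic A[X] f) (a : A)
    (ha : algebraMap A[X] B (X - C a) ≠ 0) :
    ∃ p : A[X][X], p.map (evalRingHom a) ≠ 0 ∧ aeval f p = 0 := by
  obtain ⟨p, hp, hpf⟩ := hf
  induction h : p.leadingCoeff.natDegree using Nat.strong_induction_on generalizing p with
  | _ d ih =>
    by_cases h0 : p.map (evalRingHom a) = 0
    · have hdvd : C (X - C a) ∣ p := by
        rw [C_dvd_iff_dvd_coeff]
        intro i
        rw [dvd_iff_isRoot, IsRoot.def]
        have := congrArg (fun q => q.coeff i) h0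
        simpa using this
      obtain ⟨r, hr⟩ := hdvd
      have hr0 : r ≠ 0 := by rintro rfl; simp at hr; exact hp hr
      refine ih _ ?_ r hr0 ?_ rfl
      · rw [← h, hr, leadingCoeff_mul, leadingCoeff_C, natDegree_mul (X_sub_C_ne_zero a)
          (leadingCoeff_ne_zero.mpr hr0), natDegree_X_sub_C]
        omega
      · rw [hr, map_mul, aeval_C] at hpf
        exact (mul_eq_zero.mp hpf).resolve_left ha
    · exact ⟨p, h0, hpf⟩

theorem krew_alg_constCoeff {A R : Type*} [CommRing A] [IsDomain A] [CommRing R] [IsDomain R]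
    [Algebra A R] (f : PowerSeries R) (hf : IsAlgebraic A[X] f) :
    IsAlgebraic A (PowerSeries.constantCoeff f) := by
  obtain ⟨p, hp, hpf⟩ := krew_exists_specialize f hf 0 (by
    rw [PowerSeries.algebraMap_apply']
    simp [PowerSeries.X_ne_zero])
  refine ⟨_, hp, ?_⟩
  have := congrArg (PowerSeries.constantCoeff (R := R)) hpf
  rw [map_zero] at this
  rw [← this]
  refine (map_aeval_eq_aeval_map (φ := evalRingHom (0:A)) (ψ := PowerSeries.constantCoeff (R := R)) ?_ p f).symm
  ext x
  · simp [PowerSeries.algebraMap_apply']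
  · simp [PowerSeries.algebraMap_apply']

theorem krew_alg_coeff_one {A R : Type*} [CommRing A] [IsDomain A] [CommRing R] [IsDomain R]
    [Algebra A R] (f : PowerSeries R) (hf : IsAlgebraic A[X] f) :
    IsAlgebraic A (PowerSeries.coeff 1 f) := by
  have h0 := krew_alg_constCoeff f hf
  have h1 : IsAlgebraic A[X] (PowerSeries.C (PowerSeries.constantCoeff f)) := by
    refine IsAlgebraic.ringHom_of_comp_eq (C : A →+* A[X]) (PowerSeries.C : R →+* PowerSeries R)
      h0 C_injective ?_
    ext x
    simp [PowerSeries.algebraMap_apply']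
  have h2 : f - PowerSeries.C (PowerSeries.constantCoeff f) =
      PowerSeries.X * PowerSeries.mk (fun n => PowerSeries.coeff (n+1) f) := by
    rw [sub_eq_iff_eq_add, mul_comm]
    exact PowerSeries.eq_shift_mul_X_add_const f
  have h3 := hf.sub h1
  rw [h2] at h3
  have hX : IsAlgebraic A[X] (PowerSeries.X : PowerSeries R) := by
    have := isAlgebraic_algebraMap (R := A[X]) (A := PowerSeries R) X
    simpa [PowerSeries.algebraMap_apply'] using this
  have h4 := IsAlgebraic.of_mul (mem_nonZeroDivisors_of_ne_zero PowerSeries.X_ne_zero) hX h3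
  simpa using krew_alg_constCoeff _ h4

theorem krew_deriv_aeval (f : PowerSeries ℚ) (q : ℚ[X][X]) : ∃ q' : ℚ[X][X],
    PowerSeries.derivative ℚ (aeval f q) =
      aeval f q' + aeval f (derivative q) * PowerSeries.derivative ℚ f := by
  induction q using Polynomial.induction_on' with
  | add p q hp hq =>
    obtain ⟨p', hp⟩ := hp
    obtain ⟨q', hq⟩ := hq
    refine ⟨p' + q', ?_⟩
    rw [map_add, map_add, hp, hq, derivative_add, map_add, map_add]
    ring
  | monomial k a =>
    refine ⟨monomial k (derivative a), ?_⟩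
    have e : ∀ a : ℚ[X], algebraMap ℚ[X] (PowerSeries ℚ) a = (a : PowerSeries ℚ) := by
      intro a
      rw [PowerSeries.algebraMap_apply']
      simp
    rw [derivative_monomial, aeval_monomial, aeval_monomial, aeval_monomial, e, e, e,
      Derivation.leibniz, PowerSeries.derivative_pow, PowerSeries.derivative_coe]
    have e2 : ((k : ℚ[X]) : PowerSeries ℚ) = (k : PowerSeries ℚ) :=
      map_natCast (Polynomial.coeToPowerSeries.ringHom (R := ℚ)) k
    rw [Polynomial.coe_mul, e2]
    simp only [smul_eq_mul]
    ring

theorem krew_alg_deriv (f : PowerSeries ℚ) (hf : IsAlgebraic ℚ[X] f) :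
    IsAlgebraic ℚ[X] (PowerSeries.derivative ℚ f) := by
  obtain ⟨p, hp, hpf⟩ := hf
  induction h : p.natDegree using Nat.strong_induction_on generalizing p with
  | _ d ih =>
    by_cases hd : aeval f (derivative p) = 0
    · by_cases hz : derivative p = 0
      · have := derivative_eq_zero.mp hz
        rw [eq_C_of_natDegree_eq_zero this, aeval_C] at hpf
        rw [eq_C_of_natDegree_eq_zero this] at hp
        exfalso
        apply hp
        rw [PowerSeries.algebraMap_apply'] at hpf
        have h5 : p.coeff 0 = 0 := by simpa using hpf
        rw [h5, C_0]
      · refine ih _ ?_ _ hz hd rfl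
        rw [← h]
        exact natDegree_derivative_lt (fun h0 => hz (by
          rw [eq_C_of_natDegree_eq_zero h0, derivative_C]))
    · have halgf : IsAlgebraic ℚ[X] f := ⟨p, hp, hpf⟩
      have hall : ∀ q : ℚ[X][X], IsAlgebraic ℚ[X] (aeval f q) := by
        intro q
        exact Algebra.isAlgebraic_adjoin_singleton_iff.mpr halgf _ (aeval_mem_adjoin_singleton _ _)
      obtain ⟨q', hq'⟩ := krew_deriv_aeval f p
      refine IsAlgebraic.of_mul (mem_nonZeroDivisors_of_ne_zero hd) (hall _) ?_
      rw [hpf, map_zero] at hq'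
      rw [show aeval f (derivative p) * PowerSeries.derivative ℚ f = - aeval f q' by
        linear_combination -hq']
      exact (hall q').neg

/-- Multivariate power series algebraic over polynomials: view in the first variable. -/
theorem krew_alg_finSucc {n : ℕ} (f : MvPowerSeries (Fin (n+1)) ℚ)
    (hf : IsAlgebraic (MvPolynomial (Fin (n+1)) ℚ) f) :
    IsAlgebraic (MvPolynomial (Fin n) ℚ)[X] (MvPowerSeries.finSuccEquiv ℚ n f) := by
  refine IsAlgebraic.ringHom_of_comp_eq (MvPolynomial.finSuccEquiv ℚ n)
    (MvPowerSeries.finSuccEquiv ℚ n) hf (MvPolynomial.finSuccEquiv ℚ n).injective ?_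
  apply MvPolynomial.ringHom_ext
  · intro r
    simp [MvPowerSeries.algebraMap_apply']
    rw [show MvPolynomial.finSuccEquiv ℚ n (MvPolynomial.C r) = C (MvPolynomial.C r) by
      simp [MvPolynomial.finSuccEquiv_apply]]
    simp [PowerSeries.algebraMap_apply', MvPowerSeries.algebraMap_apply']
  · intro i
    refine Fin.cases ?_ (fun j => ?_) i
    · simp [MvPolynomial.finSuccEquiv_X_zero, PowerSeries.algebraMap_apply', MvPowerSeries.algebraMap_apply']
    · simp [MvPolynomial.finSuccEquiv_X_succ, PowerSeries.algebraMap_apply', MvPowerSeries.algebraMap_apply']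

theorem krew_alg_fin_zero (f : PowerSeries (MvPowerSeries (Fin 0) ℚ))
    (hf : IsAlgebraic (MvPolynomial (Fin 0) ℚ)[X] f) :
    IsAlgebraic ℚ[X] (PowerSeries.map (MvPowerSeries.constantCoeff) f) := by
  refine IsAlgebraic.ringHom_of_comp_eq
    (Polynomial.mapRingHom ((MvPolynomial.isEmptyAlgEquiv ℚ (Fin 0)) : MvPolynomial (Fin 0) ℚ →+* ℚ))
    (PowerSeries.map (MvPowerSeries.constantCoeff (σ := Fin 0) (R := ℚ))) hf
    (Polynomial.map_injective _ (MvPolynomial.isEmptyAlgEquiv ℚ (Fin 0)).injective) ?_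
  ext x i
  · have : (MvPolynomial.C x : MvPolynomial (Fin 0) ℚ).coeff 0 = x := by simp
    simp [PowerSeries.algebraMap_apply', MvPowerSeries.algebraMap_apply']
    exact congrArg (fun z => PowerSeries.coeff i (PowerSeries.C z)) this
  · exact x.elim0
  · simp [PowerSeries.algebraMap_apply']

theorem krew_alg_last (Q : MvPowerSeries (Fin 3) ℚ) (P : MvPolynomial (Fin 4) ℚ) (hP : P ≠ 0)
    (h : MvPolynomial.aeval ![MvPowerSeries.X 0, MvPowerSeries.X 1, MvPowerSeries.X 2, Q] P = 0) :
    IsAlgebraic (MvPolynomial (Fin 3) ℚ) Q := by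
  let φ : MvPolynomial (Fin 4) ℚ →ₐ[ℚ] (MvPolynomial (Fin 3) ℚ)[X] :=
    MvPolynomial.aeval ![C (MvPolynomial.X 0), C (MvPolynomial.X 1), C (MvPolynomial.X 2), X]
  let ψ : (MvPolynomial (Fin 3) ℚ)[X] →+* MvPolynomial (Fin 4) ℚ :=
    eval₂RingHom (MvPolynomial.rename Fin.castSucc : MvPolynomial (Fin 3) ℚ →ₐ[ℚ] MvPolynomial (Fin 4) ℚ).toRingHom
      (MvPolynomial.X 3)
  have h1 : ψ.comp φ.toRingHom = RingHom.id _ := by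
    apply MvPolynomial.ringHom_ext
    · intro r
      simp [φ, ψ]
    · intro i
      fin_cases i <;> simp [φ, ψ]
  have h2 : (aeval Q : (MvPolynomial (Fin 3) ℚ)[X] →ₐ[MvPolynomial (Fin 3) ℚ] _).toRingHom.comp φ.toRingHom =
      (MvPolynomial.aeval ![MvPowerSeries.X 0, MvPowerSeries.X 1, MvPowerSeries.X 2, Q] : 
        MvPolynomial (Fin 4) ℚ →ₐ[ℚ] _).toRingHom := by
    apply MvPolynomial.ringHom_ext
    · intro r
      simp [φ, MvPowerSeries.algebraMap_apply']
      rfl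
    · intro i
      fin_cases i <;> simp [φ, MvPowerSeries.algebraMap_apply']
  refine ⟨φ P, ?_, ?_⟩
  · intro h0
    apply hP
    have := congrArg (fun g => g P) h1
    simpa [h0] using this.symm
  · have := congrArg (fun g => g P) h2
    simpa [h] using this

theorem krew_alg_extract (Q : MvPowerSeries (Fin 3) ℚ)
    (hQ : IsAlgebraic (MvPolynomial (Fin 3) ℚ) Q) (i j : ℕ) (hi : i = 0 ∨ i = 1)
    (hj : j = 0 ∨ j = 1) :
    IsAlgebraic ℚ[X] (PowerSeries.mk fun n => MvPowerSeries.coeff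
      (Finsupp.cons i (Finsupp.cons j (Finsupp.cons n (0 : Fin 0 →₀ ℕ)))) Q) := by
  have key : ∀ (m k : ℕ) (f : MvPowerSeries (Fin (m+1)) ℚ),
      IsAlgebraic (MvPolynomial (Fin (m+1)) ℚ) f → (k = 0 ∨ k = 1) →
      IsAlgebraic (MvPolynomial (Fin m) ℚ)
        (PowerSeries.coeff k (MvPowerSeries.finSuccEquiv ℚ m f)) := by
    intro m k f hf hk
    have h := krew_alg_finSucc f hf
    have : IsDomain (MvPowerSeries (Fin m) ℚ) := NoZeroDivisors.to_isDomain _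
    rcases hk with rfl | rfl
    · rw [PowerSeries.coeff_zero_eq_constantCoeff]
      exact krew_alg_constCoeff _ h
    · exact krew_alg_coeff_one _ h
  have h1 := key 2 i Q hQ hi
  have h2 := key 1 j _ h1 hj
  have h3 := krew_alg_fin_zero _ (krew_alg_finSucc _ h2)
  convert h3 using 1
  ext n
  rw [PowerSeries.coeff_map, PowerSeries.coeff_mk, ← MvPowerSeries.coeff_zero_eq_constantCoeff_apply,
    MvPowerSeries.coeff_coeff_finSuccEquiv, MvPowerSeries.coeff_coeff_finSuccEquiv,
    MvPowerSeries.coeff_coeff_finSuccEquiv]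

/-- `X * df + c * f` is algebraic if `f` is. -/
theorem krew_alg_theta (f : PowerSeries ℚ) (hf : IsAlgebraic ℚ[X] f) (c : ℕ) :
    IsAlgebraic ℚ[X] (PowerSeries.mk fun n => ((n : ℚ) + c) * PowerSeries.coeff n f) := by
  have hX : IsAlgebraic ℚ[X] (PowerSeries.X : PowerSeries ℚ) := by
    have := isAlgebraic_algebraMap (R := ℚ[X]) (A := PowerSeries ℚ) X
    simpa [PowerSeries.algebraMap_apply'] using this
  have h := (hX.mul (krew_alg_deriv f hf)).add (hf.nsmul c)
  refine (congrArg (IsAlgebraic ℚ[X]) ?_).mpr h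
  apply PowerSeries.ext
  intro n
  rw [PowerSeries.coeff_mk, map_add, map_nsmul]
  cases n with
  | zero => simp
  | succ n =>
    rw [PowerSeries.coeff_succ_X_mul, PowerSeries.coeff_derivative]
    simp only [nsmul_eq_mul]
    push_cast
    ring

end KrewAlg

section KrewAnalysis
open Polynomial Filter Topology

/-- `f` converges absolutely at `t` with value `v`. -/
def KrewEv (t : ℝ) (f : PowerSeries ℚ) (v : ℝ) : Prop :=
  Summable (fun n => ‖((PowerSeries.coeff n f : ℚ) : ℝ) * t ^ n‖) ∧
    ∑' n, ((PowerSeries.coeff n f : ℚ) : ℝ) * t ^ n = v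

theorem KrewEv.add {t : ℝ} {f g : PowerSeries ℚ} {v w : ℝ} (hf : KrewEv t f v)
    (hg : KrewEv t g w) : KrewEv t (f + g) (v + w) := by
  have e : (fun n => ((PowerSeries.coeff n (f + g) : ℚ) : ℝ) * t ^ n) =
      fun n => ((PowerSeries.coeff n f : ℚ) : ℝ) * t ^ n +
        ((PowerSeries.coeff n g : ℚ) : ℝ) * t ^ n := by
    ext n; rw [map_add]; push_cast; ring
  constructor
  · refine Summable.of_nonneg_of_le (fun n => norm_nonneg _) (fun n => ?_) (hf.1.add hg.1)
    rw [congrFun e n]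
    exact norm_add_le _ _
  · rw [e, hf.1.of_norm.tsum_add hg.1.of_norm, hf.2, hg.2]

theorem KrewEv.mul {t : ℝ} {f g : PowerSeries ℚ} {v w : ℝ} (hf : KrewEv t f v)
    (hg : KrewEv t g w) : KrewEv t (f * g) (v * w) := by
  have e : (fun n => ((PowerSeries.coeff n (f * g) : ℚ) : ℝ) * t ^ n) =
      fun n => ∑ kl ∈ Finset.HasAntidiagonal.antidiagonal n, (((PowerSeries.coeff kl.1 f : ℚ) : ℝ) * t ^ kl.1) *
        (((PowerSeries.coeff kl.2 g : ℚ) : ℝ) * t ^ kl.2) := by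
    ext n
    rw [PowerSeries.coeff_mul]
    push_cast
    rw [Finset.sum_mul]
    refine Finset.sum_congr rfl fun kl hkl => ?_
    rw [← Finset.HasAntidiagonal.mem_antidiagonal.mp hkl, pow_add]
    ring
  constructor
  · have := summable_norm_sum_mul_antidiagonal_of_summable_norm hf.1 hg.1
    simpa only [← congrFun e] using this
  · rw [e, ← tsum_mul_tsum_eq_tsum_sum_antidiagonal_of_summable_norm hf.1 hg.1, hf.2, hg.2]

theorem KrewEv.C (t : ℝ) (a : ℚ) : KrewEv t (PowerSeries.C a) (a : ℝ) := by
  have h : ∀ n, n ≠ 0 → ((PowerSeries.coeff n (PowerSeries.C a) : ℚ) : ℝ) * t ^ n = 0 := by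
    intro n hn
    simp [PowerSeries.coeff_C, hn]
  constructor
  · refine summable_of_ne_finset_zero (s := {0}) (fun n hn => ?_)
    rw [h n (by simpa using hn), norm_zero]
  · rw [tsum_eq_single 0 h]
    simp

theorem KrewEv.X (t : ℝ) : KrewEv t PowerSeries.X t := by
  have h : ∀ n, n ≠ 1 → ((PowerSeries.coeff n (PowerSeries.X : PowerSeries ℚ) : ℚ) : ℝ) * t ^ n = 0 := by
    intro n hn
    simp [PowerSeries.coeff_X, hn]
  constructor
  · refine summable_of_ne_finset_zero (s := {1}) (fun n hn => ?_)
    rw [h n (by simpa using hn), norm_zero]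
  · rw [tsum_eq_single 1 h]
    simp

theorem KrewEv.pow {t : ℝ} {f : PowerSeries ℚ} {v : ℝ} (hf : KrewEv t f v) (n : ℕ) :
    KrewEv t (f ^ n) (v ^ n) := by
  induction n with
  | zero => simpa using KrewEv.C t 1
  | succ n ih => rw [pow_succ, pow_succ]; exact ih.mul hf

theorem KrewEv.poly (t : ℝ) (p : ℚ[X]) : KrewEv t (p : PowerSeries ℚ) (aeval t p) := by
  induction p using Polynomial.induction_on' with
  | add p q hp hq => rw [Polynomial.coe_add, map_add]; exact hp.add hq
  | monomial n a =>
    rw [← C_mul_X_pow_eq_monomial, Polynomial.coe_mul, Polynomial.coe_pow, Polynomial.coe_C,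
      Polynomial.coe_X, map_mul, map_pow, aeval_C, aeval_X]
    exact (KrewEv.C t a).mul ((KrewEv.X t).pow n)

theorem KrewEv.aeval {t : ℝ} {f : PowerSeries ℚ} {v : ℝ} (hf : KrewEv t f v) (p : ℚ[X][X]) :
    KrewEv t (aeval f p) (p.sum fun k a => Polynomial.aeval t a * v ^ k) := by
  rw [aeval_eq_sum_range, Polynomial.sum_over_range _ (by simp)]
  have : ∀ s : Finset ℕ, KrewEv t (∑ i ∈ s, p.coeff i • f ^ i)
      (∑ i ∈ s, Polynomial.aeval t (p.coeff i) * v ^ i) := by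
    intro s
    induction s using Finset.induction_on with
    | empty => simpa using KrewEv.C t 0
    | insert a s ha ih =>
      rw [Finset.sum_insert ha, Finset.sum_insert ha]
      refine KrewEv.add ?_ ih
      rw [Algebra.smul_def, PowerSeries.algebraMap_apply']
      simpa using (KrewEv.poly t (p.coeff a)).mul (hf.pow a)
  exact this _

/-- Key analytic lemma: a slowly divergent function is not algebraic. -/
theorem krew_not_algebraic (F : PowerSeries ℚ) (v : ℝ → ℝ)
    (hv : ∀ t : ℝ, 0 < t → t < 1/3 → KrewEv t F (v t))
    (hinf : Tendsto v (𝓝[<] (1/3)) atTop)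
    (hslow : ∀ k : ℕ, Tendsto (fun t => (t - 1/3) * v t ^ k) (𝓝[<] (1/3)) (𝓝 0)) 
    (p : ℚ[X][X]) (hp : p.map (evalRingHom (1/3 : ℚ)) ≠ 0) (hpF : Polynomial.aeval F p = 0) : False := by
  -- the limit polynomial
  set R : ℝ[X] := (p.map (evalRingHom (1/3 : ℚ))).map (algebraMap ℚ ℝ) with hR
  have hR0 : R ≠ 0 := by
    rw [hR]
    exact (Polynomial.map_ne_zero_iff (algebraMap ℚ ℝ).injective).mpr hp
  have hzero : ∀ t : ℝ, 0 < t → t < 1/3 → (p.sum fun k a => Polynomial.aeval t a * v t ^ k) = 0 := by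
    intro t h0 h1
    have h := ((hv t h0 h1).aeval p).2
    rw [hpF] at h
    rw [← h]
    simp
  have hev : ∀ᶠ t : ℝ in 𝓝[<] (1/3), 0 < t ∧ t < 1/3 := by
    have : Set.Ioo (0:ℝ) (1/3) ∈ 𝓝[<] (1/3 : ℝ) := Ioo_mem_nhdsLT (by norm_num)
    exact this
  have hRlim : Tendsto (fun t => R.eval (v t)) (𝓝[<] (1/3)) (𝓝 0) := by
    have h1 : Tendsto (fun t => ∑ k ∈ Finset.range (p.natDegree + 1),
        (R.coeff k - Polynomial.aeval t (p.coeff k)) * v t ^ k) (𝓝[<] (1/3)) (𝓝 0) := by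
      rw [show (0:ℝ) = ∑ k ∈ Finset.range (p.natDegree + 1), (0:ℝ) by simp]
      refine tendsto_finsetSum _ fun k _ => ?_
      obtain ⟨q, hq⟩ := X_sub_C_dvd_sub_C_eval (a := (1/3 : ℚ)) (p := p.coeff k)
      have hq' : ∀ t : ℝ, R.coeff k - Polynomial.aeval t (p.coeff k) =
          - (Polynomial.aeval t q) * (t - 1/3) := by
        intro t
        have := congrArg (fun z => Polynomial.aeval t z) hq
        simp only [map_sub, map_mul, aeval_C, aeval_X] at this
        rw [hR, coeff_map, coeff_map, coe_evalRingHom]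
        have e : (algebraMap ℚ ℝ) (1/3) = 1/3 := by simp
        rw [e] at this
        linear_combination -this
      have hqc : Tendsto (fun t : ℝ => - Polynomial.aeval t q) (𝓝[<] (1/3))
          (𝓝 (- Polynomial.aeval (1/3 : ℝ) q)) := by
        refine Tendsto.mono_left ?_ nhdsWithin_le_nhds
        exact (Polynomial.continuous_aeval q).neg.tendsto _
      have := hqc.mul (hslow k)
      rw [mul_zero] at this
      refine this.congr fun t => ?_
      rw [hq']
      ring
    refine h1.congr' ?_
    filter_upwards [hev] with t ht
    have h2 := hzero t ht.1 ht.2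
    rw [Polynomial.sum_over_range _ (by simp)] at h2
    rw [Polynomial.eval_eq_sum_range' (n := p.natDegree + 1)]
    · simp only [sub_mul, Finset.sum_sub_distrib]
      rw [h2, sub_zero]
    · rw [hR]
      exact Nat.lt_succ_of_le ((natDegree_map_le).trans natDegree_map_le)
  by_cases hd : 0 < R.degree
  · have h3 := (R.abs_tendsto_atTop hd).comp hinf
    exact not_tendsto_nhds_of_tendsto_atTop h3 _ hRlim.abs
  · have h4 := eq_C_of_degree_le_zero (not_lt.mp hd)
    rw [h4] at hRlim
    simp only [eval_C] at hRlim
    have h5 := tendsto_nhds_unique tendsto_const_nhds hRlim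
    rw [h5, C_0] at h4
    exact hR0 h4

theorem krew_g_bounds (g : ℕ → ℝ) (h0 : g 0 = 1)
    (hs : ∀ m, g (m+1) * (m+1)^2 = g m * ((m:ℝ)^2 + m + 2/9)) (m : ℕ) :
    (2/9) / ((m:ℝ)+1) ≤ g m ∧ g m ≤ 1 / ((m:ℝ)+1) := by
  constructor
  · cases m with
    | zero => rw [h0]; norm_num
    | succ m =>
      have key : ∀ m : ℕ, 2/9 ≤ ((m:ℝ)+1) * g (m+1) := by
        intro m
        induction m with
        | zero => have := hs 0; rw [h0] at this; norm_num at this ⊢; linarith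
        | succ m ih =>
          have h := hs (m+1)
          push_cast at h ⊢
          have hm : (0:ℝ) ≤ m := Nat.cast_nonneg m
          have hg : 0 ≤ g (m+1) := by
            by_contra hneg
            push Not at hneg
            nlinarith
          have e : ((m:ℝ)+1+1) * (((m:ℝ)+1+1) * g (m+1+1)) = 
            ((m:ℝ)+1+1) * (((m:ℝ)+1) * g (m+1)) + 2/9 * g (m+1) := by linear_combination h
          have : ((m:ℝ)+1+1) * (2/9) ≤ ((m:ℝ)+1+1) * (((m:ℝ)+1+1) * g (m+1+1)) := by
            rw [e]; nlinarith
          exact le_of_mul_le_mul_left this (by positivity)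
      have := key m
      have hm : (0:ℝ) ≤ m := Nat.cast_nonneg m
      push_cast
      rw [div_le_iff₀ (by positivity)]
      nlinarith [this, hs 0, h0, key m, mul_nonneg hm hm, show 0 ≤ g (m+1) by
        by_contra hneg
        push Not at hneg
        nlinarith]
  · rw [le_div_iff₀ (by positivity)]
    induction m with
    | zero => rw [h0]; norm_num
    | succ m ih =>
      have h := hs m
      push_cast
      have hm : (0:ℝ) ≤ m := Nat.cast_nonneg m
      have h1 : g m ≤ 1/((m:ℝ)+1) := by rw [le_div_iff₀ (by positivity)]; exact ih
      have h2 : g (m+1) * (m+1)^2 ≤ 1/((m:ℝ)+1) * ((m:ℝ)^2 + m + 2/9) := by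
        rw [h]; gcongr
      have h3 : g (m+1) ≤ ((m:ℝ)^2 + m + 2/9) / ((m:ℝ)+1)^3 := by
        rw [le_div_iff₀ (by positivity)]
        have := mul_le_mul_of_nonneg_right h2 (show (0:ℝ) ≤ m+1 by positivity)
        rw [show 1/((m:ℝ)+1) * ((m:ℝ)^2 + m + 2/9) * (m+1) = (m:ℝ)^2 + m + 2/9 by field_simp] at this
        nlinarith
      calc g (m+1) * ((m:ℝ)+1+1) ≤ ((m:ℝ)^2 + m + 2/9) / ((m:ℝ)+1)^3 * ((m:ℝ)+1+1) := by gcongr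
        _ ≤ 1 := by
          rw [div_mul_eq_mul_div, div_le_one (by positivity)]
          nlinarith

theorem krew_main_analytic (g : ℕ → ℝ) (h0 : g 0 = 1)
    (hs : ∀ m, g (m+1) * (m+1)^2 = g m * ((m:ℝ)^2 + m + 2/9))
    (F : PowerSeries ℚ) (hF : ∀ m : ℕ, ((PowerSeries.coeff (3*m) F : ℚ) : ℝ) = 54 * (g m * 27 ^ m))
    (hF' : ∀ n : ℕ, ¬ 3 ∣ n → PowerSeries.coeff n F = 0) : ¬ IsAlgebraic ℚ[X] F := by
  intro halg
  have hb := krew_g_bounds g h0 hs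
  have hgpos : ∀ m, 0 ≤ g m := fun m => le_trans (by positivity) (hb m).1
  have hsum : ∀ w : ℝ, 0 < w → w < 1 → Summable (fun m => g m * w ^ m) := by
    intro w hw0 hw1
    refine Summable.of_nonneg_of_le (fun m => mul_nonneg (hgpos m) (by positivity)) (fun m => ?_)
      (summable_geometric_of_lt_one hw0.le hw1)
    have : g m ≤ 1 := (hb m).2.trans (by
      rw [div_le_one (by positivity)]
      have : (0:ℝ) ≤ m := Nat.cast_nonneg m
      linarith)
    calc g m * w ^ m ≤ 1 * w ^ m := by gcongr
      _ = w ^ m := one_mul _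
  have hlog : ∀ w : ℝ, 0 < w → w < 1 → HasSum (fun m : ℕ => w ^ (m+1) / ((m:ℝ)+1)) (-Real.log (1 - w)) :=
    fun w hw0 hw1 => Real.hasSum_pow_div_log_of_abs_lt_one (by rw [abs_of_pos hw0]; exact hw1)
  let v : ℝ → ℝ := fun t => 54 * ∑' m, g m * (27 * t ^ 3) ^ m
  have hw : ∀ t : ℝ, 0 < t → t < 1/3 → 0 < 27 * t ^ 3 ∧ 27 * t ^ 3 < 1 := by
    intro t ht0 ht1
    refine ⟨by positivity, ?_⟩
    have : t ^ 3 < (1/3) ^ 3 := by gcongr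
    norm_num at this
    linarith
  have hv : ∀ t : ℝ, 0 < t → t < 1/3 → KrewEv t F (v t) := by
    intro t ht0 ht1
    obtain ⟨hw0, hw1⟩ := hw t ht0 ht1
    have hinj : Function.Injective (fun m : ℕ => 3 * m) := fun a b h => by simpa using h
    have hout : ∀ n, n ∉ Set.range (fun m : ℕ => 3 * m) →
        ((PowerSeries.coeff n F : ℚ) : ℝ) * t ^ n = 0 := by
      intro n hn
      rw [hF' n, Rat.cast_zero, zero_mul]
      rintro ⟨m, hm⟩
      exact hn ⟨m, hm.symm⟩
    have hcomp : (fun n => ((PowerSeries.coeff n F : ℚ) : ℝ) * t ^ n) ∘ (fun m : ℕ => 3 * m) =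
        fun m => 54 * (g m * (27 * t ^ 3) ^ m) := by
      ext m
      simp only [Function.comp]
      rw [hF, pow_mul, mul_pow]
      ring
    have hS : HasSum (fun n => ((PowerSeries.coeff n F : ℚ) : ℝ) * t ^ n) (v t) := by
      rw [← hinj.hasSum_iff hout, hcomp]
      exact (hsum _ hw0 hw1).hasSum.mul_left 54
    refine ⟨?_, hS.tsum_eq⟩
    exact hS.summable.norm
  -- two sided bounds
  have hlow : ∀ t : ℝ, 0 < t → t < 1/3 → 12 * (-Real.log (1 - 27 * t ^ 3)) ≤ v t := by
    intro t ht0 ht1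
    obtain ⟨hw0, hw1⟩ := hw t ht0 ht1
    have h1 : 2/9 * (-Real.log (1 - 27 * t ^ 3)) ≤ ∑' m, g m * (27 * t ^ 3) ^ m := by
      refine hasSum_le (fun m => ?_) ((hlog _ hw0 hw1).mul_left (2/9)) (hsum _ hw0 hw1).hasSum
      calc 2/9 * ((27 * t ^ 3) ^ (m+1) / ((m:ℝ)+1)) = (2/9 / ((m:ℝ)+1)) * (27 * t ^ 3) ^ (m+1) := by ring
        _ ≤ g m * (27 * t ^ 3) ^ m := by
          refine mul_le_mul (hb m).1 ?_ (by positivity) (hgpos m)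
          exact pow_le_pow_of_le_one hw0.le hw1.le (Nat.le_succ m)
    change _ ≤ 54 * _
    linarith
  have hup : ∀ t : ℝ, 0 < t → t < 1/3 → 27 * t ^ 3 * v t ≤ 54 * (-Real.log (1 - 27 * t ^ 3)) := by
    intro t ht0 ht1
    obtain ⟨hw0, hw1⟩ := hw t ht0 ht1
    have h1 : 27 * t ^ 3 * ∑' m, g m * (27 * t ^ 3) ^ m ≤ -Real.log (1 - 27 * t ^ 3) := by
      refine hasSum_le (fun m => ?_) ((hsum _ hw0 hw1).hasSum.mul_left (27 * t ^ 3)) (hlog _ hw0 hw1)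
      calc 27 * t ^ 3 * (g m * (27 * t ^ 3) ^ m) = g m * (27 * t ^ 3) ^ (m+1) := by ring
        _ ≤ 1 / ((m:ℝ)+1) * (27 * t ^ 3) ^ (m+1) := by
          gcongr
          exact (hb m).2
        _ = _ := by ring
    change 27 * t ^ 3 * (54 * _) ≤ _
    linarith
  have hev : ∀ᶠ t : ℝ in 𝓝[<] (1/3), 3/10 < t ∧ t < 1/3 := by
    have : Set.Ioo (3/10:ℝ) (1/3) ∈ 𝓝[<] (1/3 : ℝ) := Ioo_mem_nhdsLT (by norm_num)
    exact this
  have hx : Tendsto (fun t : ℝ => 1 - 27 * t ^ 3) (𝓝[<] (1/3)) (𝓝[>] 0) := by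
    refine tendsto_nhdsWithin_iff.mpr ⟨?_, ?_⟩
    · have : Tendsto (fun t : ℝ => 1 - 27 * t ^ 3) (𝓝 (1/3)) (𝓝 (1 - 27 * (1/3) ^ 3)) := by
        apply Continuous.tendsto
        fun_prop
      norm_num at this
      exact (by simpa using this : Tendsto (fun t : ℝ => 1 - 27 * t ^ 3) (𝓝 (1/3)) (𝓝 0)).mono_left nhdsWithin_le_nhds
    · filter_upwards [hev] with t ht
      have := (hw t (by linarith) ht.2).2
      simp only [Set.mem_Ioi]
      linarith
  have hinf : Tendsto v (𝓝[<] (1/3)) atTop := by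
    have h1 : Tendsto (fun t : ℝ => 12 * (-Real.log (1 - 27 * t ^ 3))) (𝓝[<] (1/3)) atTop := by
      refine Tendsto.const_mul_atTop (by norm_num) ?_
      exact tendsto_neg_atBot_atTop.comp (Real.tendsto_log_nhdsGT_zero.comp hx)
    refine tendsto_atTop_mono' _ ?_ h1
    filter_upwards [hev] with t ht
    exact hlow t (by linarith) ht.2
  have hslow : ∀ k : ℕ, Tendsto (fun t => (t - 1/3) * v t ^ k) (𝓝[<] (1/3)) (𝓝 0) := by
    intro k
    have hy : Tendsto (fun x : ℝ => x * (-Real.log x) ^ k) (𝓝[>] 0) (𝓝 0) := by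
      have h1 := (Real.isLittleO_pow_log_id_atTop (n := k)).tendsto_div_nhds_zero.comp
        (tendsto_inv_nhdsGT_zero (𝕜 := ℝ))
      refine h1.congr fun x => ?_
      simp only [Function.comp, id, Real.log_inv, div_inv_eq_mul]
      ring
    have h2 := (hy.comp hx).const_mul (108 ^ k)
    rw [mul_zero] at h2
    refine squeeze_zero_norm' ?_ h2
    filter_upwards [hev] with t ht
    obtain ⟨hw0, hw1⟩ := hw t (by linarith) ht.2
    have hL : 0 ≤ -Real.log (1 - 27 * t ^ 3) := by
      have := Real.log_nonpos (x := 1 - 27 * t ^ 3) (by linarith) (by linarith)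
      linarith
    have hv0 : 0 ≤ v t := le_trans (by positivity) (hlow t (by linarith) ht.2)
    have hw2 : 1/2 ≤ 27 * t ^ 3 := by
      have : (3/10:ℝ) ^ 3 ≤ t ^ 3 := by gcongr; exact ht.1.le
      norm_num at this
      linarith
    have hv1 : v t ≤ 108 * (-Real.log (1 - 27 * t ^ 3)) := by
      have := hup t (by linarith) ht.2
      nlinarith
    rw [norm_mul, Real.norm_eq_abs, Real.norm_eq_abs, abs_of_nonpos (by linarith [ht.2]),
      abs_of_nonneg (by positivity)]
    simp only [Function.comp]
    calc -(t - 1/3) * v t ^ k ≤ (1 - 27 * t ^ 3) * (108 * (-Real.log (1 - 27 * t ^ 3))) ^ k := by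
          refine mul_le_mul ?_ (by gcongr) (by positivity) (by linarith)
          have : 1 - 27 * t ^ 3 = (1 - 3 * t) * (1 + 3 * t + 9 * t ^ 2) := by ring
          rw [this]
          nlinarith [ht.1, ht.2, sq_nonneg t]
      _ = _ := by rw [mul_pow]; ring
  obtain ⟨p, hp, hpF⟩ := krew_exists_specialize F halg (1/3 : ℚ) (by
    rw [PowerSeries.algebraMap_apply']
    intro h
    have := congrArg (PowerSeries.coeff 1) h
    simp at this)
  exact krew_not_algebraic F v hv hinf hslow p hp hpF

end KrewAnalysis

/-- Integer version of the set of walks. -/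
def krewW (i j : ℤ) (n : ℕ) : Set (List (ℤ × ℤ)) :=
  {w | w.length = n ∧ (∀ s ∈ w, s ∈ krewerasSteps) ∧
    (∀ k, 0 ≤ ((w.take k).map Prod.fst).sum ∧ 0 ≤ 1 + ((w.take k).map Prod.snd).sum) ∧
    (w.map Prod.fst).sum = i ∧ 1 + (w.map Prod.snd).sum = j}

theorem krewW_nonneg {i j : ℤ} {n : ℕ} {w : List (ℤ × ℤ)} (h : w ∈ krewW i j n) :
    0 ≤ i ∧ 0 ≤ j := by
  obtain ⟨_, _, h3, h4, h5⟩ := h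
  have := h3 w.length
  rw [List.take_length, h4, h5] at this
  exact this

theorem krewW_append {i j : ℤ} {n : ℕ} {w : List (ℤ × ℤ)} {s : ℤ × ℤ} :
    w ++ [s] ∈ krewW i j (n+1) ↔
      s ∈ krewerasSteps ∧ 0 ≤ i ∧ 0 ≤ j ∧ w ∈ krewW (i - s.1) (j - s.2) n := by
  constructor
  · intro h
    have hn := krewW_nonneg h
    obtain ⟨h1, h2, h3, h4, h5⟩ := h
    refine ⟨h2 s (by simp), hn.1, hn.2, ?_, fun x hx => h2 x (by simp [hx]), ?_, ?_, ?_⟩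
    · simpa using h1
    · intro k
      by_cases hk : k ≤ w.length
      · have := h3 k
        rwa [List.take_append_of_le_length hk] at this
      · have := h3 w.length
        rw [List.take_append_of_le_length le_rfl, List.take_length] at this
        rwa [List.take_of_length_le (by omega)]
    · simp at h4
      linarith
    · simp at h5
      linarith
  · rintro ⟨hs, hi, hj, h1, h2, h3, h4, h5⟩
    refine ⟨by simp [h1], ?_, ?_, ?_, ?_⟩
    · intro x hx
      rcases List.mem_append.mp hx with hx | hx
      · exact h2 x hx
      · rw [List.mem_singleton.mp hx]; exact hs
    · intro k
      by_cases hk : k ≤ w.length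
      · rw [List.take_append_of_le_length hk]
        exact h3 k
      · rw [List.take_of_length_le (by simp; omega)]
        simp
        constructor <;> linarith
    · simp; linarith
    · simp; linarith

theorem krewW_succ (i j : ℤ) (n : ℕ) (hi : 0 ≤ i) (hj : 0 ≤ j) :
    krewW i j (n+1) = (Set.image (fun w => w ++ [((1:ℤ),(1:ℤ))]) (krewW (i-1) (j-1) n) ∪
      Set.image (fun w => w ++ [((-1:ℤ),(0:ℤ))]) (krewW (i+1) j n)) ∪
      Set.image (fun w => w ++ [((0:ℤ),(-1:ℤ))]) (krewW i (j+1) n) := by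
  ext w
  rcases List.eq_nil_or_concat' w with rfl | ⟨w', s, rfl⟩
  · simp [krewW]
  · rw [krewW_append]
    simp only [Set.mem_union, Set.mem_image]
    constructor
    · rintro ⟨hs, -, -, hw⟩
      rcases hs with rfl | rfl | rfl
      · exact Or.inl (Or.inl ⟨w', by simpa using hw, by simp⟩)
      · exact Or.inl (Or.inr ⟨w', by simpa using hw, by simp⟩)
      · exact Or.inr ⟨w', by simpa using hw, by simp⟩
    · intro h
      rcases h with (⟨u, hu, he⟩ | ⟨u, hu, he⟩) | ⟨u, hu, he⟩ <;>
      · obtain ⟨h1, h2⟩ := List.append_inj' he rfl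
        simp only [List.cons.injEq, and_true] at h2
        subst h1 h2
        exact ⟨by simp [krewerasSteps], hi, hj, by simpa using hu⟩

theorem krewW_finite (i j : ℤ) (n : ℕ) : (krewW i j n).Finite := by
  induction n generalizing i j with
  | zero =>
    refine (Set.finite_singleton []).subset ?_
    rintro w ⟨h, -⟩
    simpa using h
  | succ n ih =>
    by_cases h : 0 ≤ i ∧ 0 ≤ j
    · rw [krewW_succ i j n h.1 h.2]
      exact (((ih _ _).image _).union ((ih _ _).image _)).union ((ih _ _).image _)
    · convert Set.finite_empty
      ext w
      simp only [Set.mem_empty_iff_false, iff_false]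
      exact fun hw => h (krewW_nonneg hw)

noncomputable def krewQ (i j : ℤ) (n : ℕ) : ℕ := (krewW i j n).ncard

theorem krewQ_neg (i j : ℤ) (n : ℕ) (h : i < 0 ∨ j < 0) : krewQ i j n = 0 := by
  have : krewW i j n = ∅ := by
    ext w
    simp only [Set.mem_empty_iff_false, iff_false]
    intro hw
    have := krewW_nonneg hw
    omega
  rw [krewQ, this, Set.ncard_empty]

theorem krewQ_succ (i j : ℤ) (n : ℕ) (hi : 0 ≤ i) (hj : 0 ≤ j) :
    krewQ i j (n+1) = krewQ (i-1) (j-1) n + krewQ (i+1) j n + krewQ i (j+1) n := by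
  have hinj : ∀ r : ℤ × ℤ, Function.Injective (fun w : List (ℤ × ℤ) => w ++ [r]) :=
    fun r a b h => List.append_cancel_right h
  have hdis : ∀ (r r₂ : ℤ × ℤ) (A B : Set (List (ℤ × ℤ))), r ≠ r₂ →
      Disjoint (Set.image (fun w => w ++ [r]) (A)) (Set.image (fun w => w ++ [r₂]) (B)) := by
    intro r r₂ A B hne
    rw [Set.disjoint_left]
    rintro _ ⟨a, _, rfl⟩ ⟨b, _, hb⟩
    have := (List.append_inj' hb rfl).2
    simp at this
    exact hne this.symm
  unfold krewQ
  have hfin : ∀ (r : ℤ × ℤ) (i j : ℤ), (Set.image (fun w => w ++ [r]) (krewW i j n)).Finite :=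
    fun r i j => (krewW_finite i j n).image _
  rw [krewW_succ i j n hi hj,
    Set.ncard_union_eq (Set.disjoint_union_left.mpr
      ⟨hdis _ _ _ _ (by decide), hdis _ _ _ _ (by decide)⟩)
      ((hfin _ _ _).union (hfin _ _ _)) (hfin _ _ _),
    Set.ncard_union_eq (hdis _ _ _ _ (by decide)) (hfin _ _ _) (hfin _ _ _),
    Set.ncard_image_of_injective _ (hinj _), Set.ncard_image_of_injective _ (hinj _),
    Set.ncard_image_of_injective _ (hinj _)]

theorem krewQ_zero (i j : ℤ) : krewQ i j 0 = if i = 0 ∧ j = 1 then 1 else 0 := by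
  have : krewW i j 0 = if i = 0 ∧ j = 1 then {[]} else ∅ := by
    ext w
    constructor
    · rintro ⟨h1, -, -, h4, h5⟩
      have : w = [] := by simpa using h1
      subst this
      simp at h4 h5
      simp [← h4, ← h5]
    · intro h
      split_ifs at h with hij
      · rw [Set.mem_singleton_iff] at h
        subst h
        obtain ⟨rfl, rfl⟩ := hij
        simp [krewW]
      · exact absurd h (Set.notMem_empty w)
  rw [krewQ, this]
  split_ifs <;> simp

theorem krewQ_support (i j : ℤ) (n : ℕ) (h : krewQ i j n ≠ 0) :
    ∃ p q r : ℕ, n = p + q + r ∧ i = p - q ∧ j = 1 + p - r := by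
  induction n generalizing i j with
  | zero =>
    rw [krewQ_zero] at h
    split_ifs at h with hij
    · exact ⟨0, 0, 0, by simp, by simp [hij.1], by simp [hij.2]⟩
    · exact absurd rfl h
  | succ n ih =>
    have hij : 0 ≤ i ∧ 0 ≤ j := by
      by_contra hc
      exact h (krewQ_neg i j _ (by omega))
    rw [krewQ_succ i j n hij.1 hij.2] at h
    by_cases h1 : krewQ (i-1) (j-1) n = 0
    · by_cases h2 : krewQ (i+1) j n = 0
      · have h3 : krewQ i (j+1) n ≠ 0 := by omega
        obtain ⟨p, q, r, e1, e2, e3⟩ := ih _ _ h3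
        exact ⟨p, q, r+1, by omega, by omega, by push_cast; omega⟩
      · obtain ⟨p, q, r, e1, e2, e3⟩ := ih _ _ h2
        exact ⟨p, q+1, r, by omega, by push_cast; omega, by omega⟩
    · obtain ⟨p, q, r, e1, e2, e3⟩ := ih _ _ h1
      exact ⟨p+1, q, r, by omega, by push_cast; omega, by push_cast; omega⟩

/-- Antisymmetrised count. -/
noncomputable def krewD (i j : ℤ) (n : ℕ) : ℚ := (krewQ i j n : ℚ) - krewQ j i n

theorem krewD_succ (i j : ℤ) (n : ℕ) (hi : 0 ≤ i) (hj : 0 ≤ j) :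
    krewD i j (n+1) = krewD (i-1) (j-1) n + krewD (i+1) j n + krewD i (j+1) n := by
  unfold krewD
  rw [krewQ_succ i j n hi hj, krewQ_succ j i n hj hi]
  push_cast
  ring

theorem krewD_zero_of (i j : ℤ) (n : ℕ)
    (h : ∀ p q r : ℕ, n = p + q + r → ¬ (i = p - q ∧ j = 1 + p - r) ∧ ¬ (j = p - q ∧ i = 1 + p - r)) :
    krewD i j n = 0 := by
  have h1 : krewQ i j n = 0 := by
    by_contra hc
    obtain ⟨p, q, r, e1, e2, e3⟩ := krewQ_support _ _ _ hc
    exact (h p q r e1).1 ⟨e2, e3⟩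
  have h2 : krewQ j i n = 0 := by
    by_contra hc
    obtain ⟨p, q, r, e1, e2, e3⟩ := krewQ_support _ _ _ hc
    exact (h p q r e1).2 ⟨e2, e3⟩
  rw [krewD, h1, h2]
  simp

/-- Hook length type formula for the antisymmetrised count. -/
theorem krewD_formula (n a b c : ℕ) (habc : a + b + c = n + 3) (hab : b ≤ a) (hac : c ≤ a) :
    krewD (a - b - 1) (a - c - 1) n * ((a.factorial : ℚ) * b.factorial * c.factorial) =
      n.factorial * (((a:ℚ) - b) * (b - c) * (a - c)) := by
  induction n generalizing a b c with
  | zero =>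
    have ha : a ≤ 3 := by omega
    have hb : b ≤ 3 := by omega
    have hc : c ≤ 3 := by omega
    unfold krewD
    simp only [krewQ_zero]
    interval_cases a <;> interval_cases b <;> interval_cases c <;> simp_all [Nat.factorial]
    all_goals norm_num
  | succ n ih =>
    rcases hab.eq_or_lt with rfl | hab
    · rw [krewD, krewQ_neg _ _ _ (Or.inl (by omega)), krewQ_neg _ _ _ (Or.inr (by omega))]
      simp
    rcases hac.eq_or_lt with rfl | hac
    · rw [krewD, krewQ_neg _ _ _ (Or.inr (by omega)), krewQ_neg _ _ _ (Or.inl (by omega))]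
      simp
    rw [krewD_succ _ _ _ (by omega) (by omega)]
    obtain ⟨a, rfl⟩ : ∃ a', a = a' + 1 := ⟨a - 1, by omega⟩
    have h1 := ih a b c (by omega) (by omega) (by omega)
    have h2 : krewD (((a+1:ℕ):ℤ) - b - 1 + 1) (((a+1:ℕ):ℤ) - c - 1) n *
        (((a+1).factorial : ℚ) * b.factorial * c.factorial) =
        b * (n.factorial * (((a:ℚ) + 1 - (b - 1)) * ((b - 1) - c) * (a + 1 - c))) := by
      rcases Nat.eq_zero_or_pos b with rfl | hb
      · rw [krewD_zero_of]
        · simp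
        · intro p q r e
          constructor <;> omega
      · obtain ⟨b, rfl⟩ : ∃ b', b = b' + 1 := ⟨b - 1, by omega⟩
        have := ih (a+1) b c (by omega) (by omega) (by omega)
        rw [Nat.factorial_succ b]
        rw [show ((a+1:ℕ):ℤ) - ((b+1:ℕ):ℤ) - 1 + 1 = ((a+1:ℕ):ℤ) - b - 1 by push_cast; ring]
        push_cast at this ⊢
        linear_combination ((b:ℚ) + 1) * this
    have h3 : krewD (((a+1:ℕ):ℤ) - b - 1) (((a+1:ℕ):ℤ) - c - 1 + 1) n *
        (((a+1).factorial : ℚ) * b.factorial * c.factorial) =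
        c * (n.factorial * (((a:ℚ) + 1 - b) * (b - (c - 1)) * (a + 1 - (c - 1)))) := by
      rcases Nat.eq_zero_or_pos c with rfl | hb
      · rw [krewD_zero_of]
        · simp
        · intro p q r e
          constructor <;> omega
      · obtain ⟨c, rfl⟩ : ∃ c', c = c' + 1 := ⟨c - 1, by omega⟩
        have := ih (a+1) b c (by omega) (by omega) (by omega)
        rw [Nat.factorial_succ c]
        rw [show ((a+1:ℕ):ℤ) - ((c+1:ℕ):ℤ) - 1 + 1 = ((a+1:ℕ):ℤ) - c - 1 by push_cast; ring]
        push_cast at this ⊢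
        linear_combination ((c:ℚ) + 1) * this
    rw [show ((a+1:ℕ):ℤ) - b - 1 - 1 = (a:ℤ) - b - 1 by push_cast; ring,
      show ((a+1:ℕ):ℤ) - c - 1 - 1 = (a:ℤ) - c - 1 by push_cast; ring]
    have hn : (a:ℚ) + 1 + b + c = n + 4 := by exact_mod_cast habc
    have h1' : krewD ((a:ℤ) - b - 1) ((a:ℤ) - c - 1) n *
        (((a+1).factorial : ℚ) * b.factorial * c.factorial) =
        (a + 1) * (n.factorial * (((a:ℚ) - b) * (b - c) * (a - c))) := by
      rw [Nat.factorial_succ a]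
      push_cast
      linear_combination ((a:ℚ) + 1) * h1
    rw [Nat.factorial_succ n, add_mul, add_mul, h1', h2, h3]
    have hn' : (n:ℚ) = a + b + c - 3 := by linarith
    push_cast
    rw [hn']
    ring

theorem krew_q01_eq (i j n : ℕ) : q01 krewerasSteps i j n = krewQ i j n := by
  unfold q01 krewQ
  rw [Nat.card_coe_set_eq]
  rfl

theorem krew_coeff_Q01 (i j n : ℕ) :
    MvPowerSeries.coeff (Finsupp.cons i (Finsupp.cons j (Finsupp.cons n (0 : Fin 0 →₀ ℕ))))
      (Q01 krewerasSteps) = (krewQ i j n : ℚ) := by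
  rw [← krew_q01_eq]
  rfl

theorem krewD_excursion (m : ℕ) :
    krewD 0 1 (3 * m) * ((m + 1 : ℚ) ^ 2 * (m + 2)) * (m.factorial : ℚ) ^ 3 =
      2 * ((3 * m).factorial : ℚ) := by
  have h := krewD_formula (3 * m) (m + 2) (m + 1) m (by omega) (by omega) (by omega)
  rw [show ((m + 2 : ℕ) : ℤ) - ((m + 1 : ℕ) : ℤ) - 1 = 0 by push_cast; ring,
    show ((m + 2 : ℕ) : ℤ) - (m : ℤ) - 1 = 1 by push_cast; ring,
    Nat.factorial_succ (m + 1), Nat.factorial_succ m] at h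
  push_cast at h
  linear_combination h

theorem krewD_excursion_zero (n : ℕ) (hn : ¬ 3 ∣ n) : krewD 0 1 n = 0 := by
  apply krewD_zero_of
  intro p q r e
  constructor <;> omega

/-- For Kreweras' model started at `(0,1)`, the generating function `Q^{(0,1)}(x,y;t)`
is transcendental: no nonzero polynomial `P ∈ ℚ[x,y,t,u]` satisfies
`P(x,y,t,Q^{(0,1)}(x,y;t)) = 0`. -/
theorem kreweras_from01_transcendental :
    ¬ ∃ P : MvPolynomial (Fin 4) ℚ, P ≠ 0 ∧
      MvPolynomial.aeval
        ![MvPowerSeries.X 0, MvPowerSeries.X 1, MvPowerSeries.X 2,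
          Q01 krewerasSteps] P = 0 := by
  rintro ⟨P, hP, h⟩
  have hQ := krew_alg_last _ P hP h
  have hA := krew_alg_extract _ hQ 0 1 (Or.inl rfl) (Or.inr rfl)
  have hB := krew_alg_extract _ hQ 1 0 (Or.inr rfl) (Or.inl rfl)
  have hG := hA.sub hB
  have hF := krew_alg_theta _ (krew_alg_theta _ (krew_alg_theta _ hG 3) 3) 6
  have hco : ∀ n, PowerSeries.coeff n ((PowerSeries.mk fun n => MvPowerSeries.coeff
      (Finsupp.cons 0 (Finsupp.cons 1 (Finsupp.cons n (0 : Fin 0 →₀ ℕ)))) (Q01 krewerasSteps)) -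
      (PowerSeries.mk fun n => MvPowerSeries.coeff
      (Finsupp.cons 1 (Finsupp.cons 0 (Finsupp.cons n (0 : Fin 0 →₀ ℕ)))) (Q01 krewerasSteps)))
      = krewD 0 1 n := by
    intro n
    rw [map_sub, PowerSeries.coeff_mk, PowerSeries.coeff_mk, krew_coeff_Q01, krew_coeff_Q01, krewD]
    simp
  refine krew_main_analytic
    (fun m => ((3 * m).factorial : ℝ) / ((m.factorial : ℝ) ^ 3 * 27 ^ m)) (by simp) ?_ _ ?_ ?_ hF
  · intro m
    have h1 : (m.factorial : ℝ) ≠ 0 := by exact_mod_cast m.factorial_ne_zero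
    have h2 : (m : ℝ) + 1 ≠ 0 := by positivity
    rw [show 3 * (m + 1) = 3 * m + 1 + 1 + 1 by ring, Nat.factorial_succ (3 * m + 1 + 1),
      Nat.factorial_succ (3 * m + 1), Nat.factorial_succ (3 * m), Nat.factorial_succ m]
    push_cast
    field_simp
    ring
  · intro m
    rw [PowerSeries.coeff_mk, PowerSeries.coeff_mk, PowerSeries.coeff_mk, hco]
    have h1 : (m.factorial : ℝ) ≠ 0 := by exact_mod_cast m.factorial_ne_zero
    have h3 : ((krewD 0 1 (3 * m) : ℚ) : ℝ) * (((m : ℝ) + 1) ^ 2 * (m + 2)) * (m.factorial : ℝ) ^ 3 =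
      2 * ((3 * m).factorial : ℝ) := by exact_mod_cast krewD_excursion m
    push_cast
    field_simp
    linear_combination 27 * h3
  · intro n hn
    rw [PowerSeries.coeff_mk, PowerSeries.coeff_mk, PowerSeries.coeff_mk, hco,
      krewD_excursion_zero n hn]
    simp
end
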